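/- Let G be a finitely generated group that is quasi-isometric to the hyperbolic plane ℍ (the upper half-plane {(x,y) ∈ ℝ² : y > 0} with its Riemannian metric ds² = (dx² + dy²)/y²), where G carries a word metric. Then there exists a nonempty G-SFT X with m(X) > 0_M. -/

import Mathlib

namespace MedvedevFormal

/-! ### Medvedev reducibility on Baire space -/

/-- The finite prefix of length `k` of a point of Baire space, as a list. -/
def pref (x : ℕ → ℕ) (k : ℕ) : List ℕ := (List.range k).map x

/-- Medvedev reducibility `m(P) ≤ m(Q)` between subsets of Baire space: some computable
monotone prefix-functional (i.e. a partial computable type-two functional), defined on all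
of `Q`, maps every element of `Q` to an element of `P`. -/
def BaireLE (P Q : Set (ℕ → ℕ)) : Prop :=
  ∃ φ : List ℕ → List ℕ, Computable φ ∧
    (∀ l₁ l₂ : List ℕ, l₁ <+: l₂ → φ l₁ <+: φ l₂) ∧
    ∀ x ∈ Q, ∃ y ∈ P, ∀ n : ℕ, ∃ k : ℕ, (φ (pref x k))[n]? = some (y n)

/-- Medvedev equivalence: `m(P) = m(Q)`. -/
def BaireEquiv (P Q : Set (ℕ → ℕ)) : Prop := BaireLE P Q ∧ BaireLE Q P

/-- A canonical representative of the join `m(P) ∨ m(Q)`. -/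
def joinSet (P Q : Set (ℕ → ℕ)) : Set (ℕ → ℕ) :=
  {x | (fun n => x (2 * n)) ∈ P ∧ (fun n => x (2 * n + 1)) ∈ Q}

/-- A canonical representative of the meet `m(P) ∧ m(Q)`. -/
def meetSet (P Q : Set (ℕ → ℕ)) : Set (ℕ → ℕ) :=
  {x | (x 0 = 0 ∧ (fun n => x (n + 1)) ∈ P) ∨ (x 0 = 1 ∧ (fun n => x (n + 1)) ∈ Q)}

/-- `P` has the zero Medvedev degree `0_M`: it contains a computable point. -/
def IsZeroDeg (P : Set (ℕ → ℕ)) : Prop := ∃ y ∈ P, Computable y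

/-- The cylinder of a finite word in Baire space. -/
def cylinder (l : List ℕ) : Set (ℕ → ℕ) :=
  {x | ∀ (i : ℕ) (h : i < l.length), x i = l[i]}

/-- Cantor space `{0,1}^ℕ` inside Baire space. -/
def cantorSpace : Set (ℕ → ℕ) := {x | ∀ n, x n ≤ 1}

/-- `P` is an effectively closed (`Π⁰₁`) subset of Cantor space: its complement within
Cantor space is the union of the cylinders of a computably enumerable sequence of words. -/
def IsPi01Cantor (P : Set (ℕ → ℕ)) : Prop :=
  ∃ f : ℕ → List ℕ, Computable f ∧ P = cantorSpace \ ⋃ n, cylinder (f n)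

/-- The Medvedev degree of `P` is a `Π⁰₁` Medvedev degree. -/
def IsPi01Deg (P : Set (ℕ → ℕ)) : Prop :=
  ∃ Q, IsPi01Cantor Q ∧ Q.Nonempty ∧ BaireEquiv P Q

/-- `P` realizes the maximal `Π⁰₁` Medvedev degree (the degree of the class of complete
consistent extensions of Peano arithmetic): it is a nonempty `Π⁰₁` subset of Cantor space
to which every nonempty `Π⁰₁` subset of Cantor space is Medvedev reducible. -/
def IsMaxPi01 (P : Set (ℕ → ℕ)) : Prop :=
  IsPi01Cantor P ∧ P.Nonempty ∧ ∀ Q, IsPi01Cantor Q → Q.Nonempty → BaireLE Q P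

/-! ### Encoding of configuration spaces -/

/-- The canonical encoding of a configuration `x : α → A` as a point of Baire space. -/
def confFun {α A : Type*} [Encodable α] [Encodable A] (x : α → A) : ℕ → ℕ :=
  fun n => Encodable.encode ((Encodable.decode (α := α) n).map x)

/-- The image of a set of configurations in Baire space, used to measure its
Medvedev degree. -/
def mSet {α A : Type*} [Encodable α] [Encodable A] (X : Set (α → A)) : Set (ℕ → ℕ) :=
  confFun '' X

/-- A configuration is computable if its Baire-space encoding is computable. -/
def ComputablePoint {α A : Type*} [Encodable α] [Encodable A] (x : α → A) : Prop :=
  Computable (confFun x)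

/-- `m(X) ≤ m(Y)` for sets of configurations. -/
def MedLE {α A β B : Type*} [Encodable α] [Encodable A] [Encodable β] [Encodable B]
    (X : Set (α → A)) (Y : Set (β → B)) : Prop :=
  BaireLE (mSet X) (mSet Y)

/-- `m(X) = m(Y)` for sets of configurations. -/
def MedEquiv {α A β B : Type*} [Encodable α] [Encodable A] [Encodable β] [Encodable B]
    (X : Set (α → A)) (Y : Set (β → B)) : Prop :=
  MedLE X Y ∧ MedLE Y X

/-! ### Subshifts -/

/-- The left shift action: `(g • x) h = x (g⁻¹ h)`. -/
def shift {G A : Type*} [Group G] (g : G) (x : G → A) : G → A := fun h => x (g⁻¹ * h)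

/-- The prodiscrete topology on `A^G`. -/
def prodiscrete (G A : Type*) : TopologicalSpace (G → A) :=
  @Pi.topologicalSpace G (fun _ => A) fun _ => ⊥

/-- A subshift: a shift-invariant subset of `A^G`, closed in the prodiscrete topology. -/
def IsSubshift {G A : Type*} [Group G] (X : Set (G → A)) : Prop :=
  (∀ x ∈ X, ∀ g : G, shift g x ∈ X) ∧ @IsClosed (G → A) (prodiscrete G A) X

/-- A pattern: a map `p : D → A` with `D ⊆ G` finite. -/
structure Pattern (G A : Type*) where
  dom : Finset G
  val : {g // g ∈ dom} → A

/-- The translate `g • x` agrees with the pattern `p` on its domain. -/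
def MatchesAt {G A : Type*} [Group G] (p : Pattern G A) (g : G) (x : G → A) : Prop :=
  ∀ h : {g' // g' ∈ p.dom}, shift g x h = p.val h

/-- A subshift of finite type: defined by a finite list of forbidden patterns. -/
def IsSFT {G A : Type*} [Group G] (X : Set (G → A)) : Prop :=
  ∃ F : List (Pattern G A), X = {x | ∀ p ∈ F, ∀ g : G, ¬MatchesAt p g x}

/-- A morphism between subshifts: a continuous shift-equivariant map from `X` to `Y`. -/
def IsMorphism {G A B : Type*} [Group G] (X : Set (G → A)) (Y : Set (G → B))
    (φ : (G → A) → (G → B)) : Prop :=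
  Set.MapsTo φ X Y ∧
    @ContinuousOn (G → A) (G → B) (prodiscrete G A) (prodiscrete G B) φ X ∧
    ∀ x ∈ X, ∀ g : G, φ (shift g x) = shift g (φ x)

/-- A sofic subshift: the image of an SFT (on some finite alphabet) under a topological
factor map. -/
def IsSofic {G A : Type*} [Group G] (X : Set (G → A)) : Prop :=
  ∃ (B : Type) (_ : Finite B) (Y : Set (G → B)) (φ : (G → B) → (G → A)),
    IsSFT Y ∧ IsMorphism Y X φ ∧ φ '' Y = X

/-! ### Finitely generated groups, covers and pullbacks -/

/-- `σ` enumerates a finite symmetric generating set of `G`. -/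
def IsSymmGen {G : Type*} [Group G] {k : ℕ} (σ : Fin k → G) : Prop :=
  Subgroup.closure (Set.range σ) = ⊤ ∧ ∀ i, (σ i)⁻¹ ∈ Set.range σ

/-- The canonical encoding of a free group via reduced words. -/
instance freeGroupEncodable {α : Type*} [DecidableEq α] [Encodable α] :
    Encodable (FreeGroup α) :=
  Encodable.ofLeftInjection FreeGroup.toWord (fun l => some (FreeGroup.mk l))
    fun _ => congrArg some FreeGroup.mk_toWord

/-- The canonical homomorphism from the free group determined by `σ`. -/
def cover {G : Type*} [Group G] {k : ℕ} (σ : Fin k → G) : FreeGroup (Fin k) →* G :=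
  FreeGroup.lift σ

/-- The pullback of a subshift along a group homomorphism. -/
def pullback {K G A : Type*} [Group K] [Group G] (ρ : K →* G) (X : Set (G → A)) :
    Set (K → A) :=
  (fun x => x ∘ ρ) '' X

/-- The group element represented by a word over the generators. -/
def wordVal {G : Type*} [Group G] {k : ℕ} (σ : Fin k → G) (w : List (Fin k × Bool)) : G :=
  cover σ (FreeGroup.mk w)

/-- `G` is recursively presented w.r.t. `σ`: its word problem is recursively enumerable. -/
def RecursivelyPresented {G : Type*} [Group G] {k : ℕ} (σ : Fin k → G) : Prop :=
  ∃ f : ℕ → Option (List (Fin k × Bool)), Computable f ∧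
    ∀ w : List (Fin k × Bool), (wordVal σ w = 1 ↔ ∃ n, f n = some w)

/-- The membership problem of the subgroup `H` in `G` is decidable w.r.t. `σ`. -/
def DecidableMembership {G : Type*} [Group G] {k : ℕ} (σ : Fin k → G)
    (H : Subgroup G) : Prop :=
  ∃ φ : List (Fin k × Bool) → Bool, Computable φ ∧
    ∀ w : List (Fin k × Bool), (φ w = true ↔ wordVal σ w ∈ H)

/-- `G` has decidable word problem w.r.t. `σ`. -/
def DecidableWordProblem {G : Type*} [Group G] {k : ℕ} (σ : Fin k → G) : Prop :=
  ∃ φ : List (Fin k × Bool) → Bool, Computable φ ∧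
    ∀ w : List (Fin k × Bool), (φ w = true ↔ wordVal σ w = 1)

/-- The set of configurations on the free group matching a coded pattern: a pattern is
coded as a list of pairs (code of a group element, code of a letter). -/
def codedCylinder {k : ℕ} {A : Type*} [Encodable A] (p : List (ℕ × ℕ)) :
    Set (FreeGroup (Fin k) → A) :=
  {x | ∀ q ∈ p, ∀ g : FreeGroup (Fin k),
    Encodable.encode g = q.1 → Encodable.encode (x g) = q.2}

/-- `X` is an effective subshift: the complement of its pullback to the free group is the
union of the cylinders of a computably enumerable sequence of finitely supported patterns. -/
def IsEffective {G : Type*} [Group G] {k : ℕ} (σ : Fin k → G) {A : Type*} [Encodable A]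
    (X : Set (G → A)) : Prop :=
  ∃ f : ℕ → List (ℕ × ℕ), Computable f ∧
    (pullback (cover σ) X)ᶜ = ⋃ n, codedCylinder (f n)

/-! ### Degree spectra -/

/-- The Medvedev degree of `P` belongs to `M_SFT(G)`: some nonempty `G`-SFT has the
Medvedev degree of `P`. -/
def IsSFTDeg {G : Type*} [Group G] {k : ℕ} (σ : Fin k → G) (P : Set (ℕ → ℕ)) : Prop :=
  ∃ (n : ℕ) (X : Set (G → Fin n)), IsSFT X ∧ X.Nonempty ∧
    BaireEquiv (mSet (pullback (cover σ) X)) P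

/-- The Medvedev degree of `P` belongs to `M_sof(G)`. -/
def IsSoficDeg {G : Type*} [Group G] {k : ℕ} (σ : Fin k → G) (P : Set (ℕ → ℕ)) : Prop :=
  ∃ (n : ℕ) (X : Set (G → Fin n)), IsSofic X ∧ X.Nonempty ∧
    BaireEquiv (mSet (pullback (cover σ) X)) P

/-- The Medvedev degree of `P` belongs to `M_eff(G)`. -/
def IsEffDeg {G : Type*} [Group G] {k : ℕ} (σ : Fin k → G) (P : Set (ℕ → ℕ)) : Prop :=
  ∃ (n : ℕ) (X : Set (G → Fin n)), IsSubshift X ∧ IsEffective σ X ∧ X.Nonempty ∧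
    BaireEquiv (mSet (pullback (cover σ) X)) P

/-! ### Word metrics and quasi-isometries -/

/-- The word length of `g` w.r.t. the (symmetric) generating map `σ`. -/
noncomputable def wordNorm {G : Type*} [Group G] {k : ℕ} (σ : Fin k → G) (g : G) : ℕ :=
  sInf {n | ∃ w : List (Fin k), w.length = n ∧ (w.map σ).prod = g}

/-- The word metric on `G` w.r.t. `σ`, as a real number. -/
noncomputable def wordDist {G : Type*} [Group G] {k : ℕ} (σ : Fin k → G) (g g' : G) : ℝ :=
  (wordNorm σ (g⁻¹ * g') : ℝ)

/-- `f : G → H` is a quasi-isometry w.r.t. the word metrics given by `σ` and `τ`. -/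
def IsQIGroups {G H : Type*} [Group G] [Group H] {k r : ℕ} (σ : Fin k → G)
    (τ : Fin r → H) (f : G → H) : Prop :=
  ∃ C : ℝ, 1 ≤ C ∧
    (∀ g g' : G, (1 / C) * wordDist σ g g' - C ≤ wordDist τ (f g) (f g') ∧
      wordDist τ (f g) (f g') ≤ C * wordDist σ g g' + C) ∧
    ∀ h : H, ∃ g : G, wordDist τ h (f g) ≤ C

/-- `f : G → Y` is a quasi-isometry from the group `G` (with word metric from `σ`) to the
metric space `Y`. -/
def IsQIToSpace {G : Type*} [Group G] {k : ℕ} (σ : Fin k → G) {Y : Type*}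
    [MetricSpace Y] (f : G → Y) : Prop :=
  ∃ C : ℝ, 1 ≤ C ∧
    (∀ g g' : G, (1 / C) * wordDist σ g g' - C ≤ dist (f g) (f g') ∧
      dist (f g) (f g') ≤ C * wordDist σ g g' + C) ∧
    ∀ y : Y, ∃ g : G, dist y (f g) ≤ C

/-- `f : G → H` is computable w.r.t. the generating maps `σ` and `τ`: some computable map
on words sends each word representing `g` to a word representing `f g`. -/
def ComputableMap {G H : Type*} [Group G] [Group H] {k r : ℕ} (σ : Fin k → G)
    (τ : Fin r → H) (f : G → H) : Prop :=
  ∃ φ : List (Fin k × Bool) → List (Fin r × Bool), Computable φ ∧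
    ∀ w : List (Fin k × Bool), wordVal τ (φ w) = f (wordVal σ w)

/-! ### Stack machines -/

/-- A nondeterministic machine with finitely many stacks: the instruction `d` replaces the word
`popW d k` on top of the stack `k` by `pushW d k`. The symbol `bot` marks the bottom. -/
structure StackMachine (Δ κ Γ : Type) where
  bot : Γ
  popW : Δ → κ → List Γ
  pushW : Δ → κ → List Γ
  ok : ∀ d k, (bot ∉ popW d k ∧ bot ∉ pushW d k) ∨
    (popW d k = [bot] ∧ ∃ l, pushW d k = l ++ [bot] ∧ bot ∉ l)
  growth : ∀ d k, (pushW d k).length ≤ (popW d k).length + 1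

namespace StackMachine

variable {Δ κ Γ : Type} (W : StackMachine Δ κ Γ)

/-- One step of a stack machine. -/
def Step (d : Δ) (L L' : κ → List Γ) : Prop :=
  ∀ k, ∃ l, L k ++ [W.bot] = W.popW d k ++ l ∧ L' k ++ [W.bot] = W.pushW d k ++ l

/-- The stack contents `L` are obtained from empty stacks by a list of instructions. -/
inductive Reach : List Δ → (κ → List Γ) → Prop
  | nil : Reach [] (fun _ => [])
  | snoc {l L d L'} : Reach l L → W.Step d L L' → Reach (l ++ [d]) L'

/-- The list of instructions `l` can be executed from empty stacks. -/
def Runs (l : List Δ) : Prop := ∃ L, W.Reach l L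

end StackMachine

/-! ### The recursive stack system -/

/-- Stack symbols of the recursive system. -/
inductive Sy (Δ Γ : Type)
  | blank
  | mk (i : Fin 4)
  | dig (d : Δ)
  | elo
  | ehi
  | sym (s : Γ)

/-- Registers: two tapes `A`, `B`, two numbers, and the stacks of the simulated machine. -/
abbrev Reg (κ : Type) := Fin 4 ⊕ κ

abbrev rA {κ : Type} : Reg κ := Sum.inl 0
abbrev rB {κ : Type} : Reg κ := Sum.inl 1
abbrev rLo {κ : Type} : Reg κ := Sum.inl 2
abbrev rHi {κ : Type} : Reg κ := Sum.inl 3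

/-- Control states: `(false, p)` is the work state of phase `p`, `(true, p)` the state after
returning from a call made in phase `p`. -/
abbrev Ctl := Bool × Fin 4

/-- The phases in which the tape head moves up. -/
def upP (q : Bool) : Fin 4 := if q then 2 else 0

/-- The phases in which the tape head moves down. -/
def downP (q : Bool) : Fin 4 := if q then 3 else 1

/-- Transitions of the recursive system. -/
inductive Lab {Δ κ Γ : Type} (W : StackMachine Δ κ Γ)
  | callUp (q : Bool)
  | turnUp (q : Bool) (j : Fin 4)
  | up1 (d : Δ)
  | up3 (cl : κ → Option {s // s ≠ W.bot})
  | callDown2 (d : Δ)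
  | callDown4
  | turn2 (j : Fin 4)
  | ret (j : Fin 4)
  | down (q : Bool)

namespace Lab

variable {Δ κ Γ : Type} {W : StackMachine Δ κ Γ}

/-- Assemble a register-indexed family. -/
def mkReg {α : Type} (a b lo hi : α) (k : κ → α) : Reg κ → α := Sum.elim ![a, b, lo, hi] k

@[simp] theorem mkReg_zero {α : Type} (a b lo hi : α) (k : κ → α) :
    mkReg a b lo hi k (Sum.inl 0) = a := rfl
@[simp] theorem mkReg_one {α : Type} (a b lo hi : α) (k : κ → α) :
    mkReg a b lo hi k (Sum.inl 1) = b := rfl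
@[simp] theorem mkReg_two {α : Type} (a b lo hi : α) (k : κ → α) :
    mkReg a b lo hi k (Sum.inl 2) = lo := rfl
@[simp] theorem mkReg_three {α : Type} (a b lo hi : α) (k : κ → α) :
    mkReg a b lo hi k (Sum.inl 3) = hi := rfl
@[simp] theorem mkReg_inr {α : Type} (a b lo hi : α) (k : κ → α) (x : κ) :
    mkReg a b lo hi k (Sum.inr x) = k x := rfl

def src : Lab W → Ctl
  | callUp q => (false, upP q)
  | turnUp q _ => (false, upP q)
  | up1 _ => (true, 0)
  | up3 _ => (true, 2)
  | callDown2 _ => (false, 1)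
  | callDown4 => (false, 3)
  | turn2 _ => (false, 1)
  | ret _ => (false, 3)
  | down q => (true, downP q)

def tgt : Lab W → Ctl
  | callUp _ => (false, 0)
  | turnUp q _ => (false, downP q)
  | up1 _ => (false, 0)
  | up3 _ => (false, 2)
  | callDown2 _ => (false, 0)
  | callDown4 => (false, 0)
  | turn2 _ => (false, 2)
  | ret j => (true, j)
  | down q => (false, downP q)

open Sy in
/-- The words popped by a transition. -/
def popR : Lab W → Reg κ → List (Sy Δ Γ)
  | callUp _ => mkReg [blank] [] [] [] fun _ => []
  | turnUp q j => mkReg [mk j] [] [] [] fun _ => if q then [] else [sym W.bot]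
  | up1 _ => mkReg [blank] [] [] [] fun _ => []
  | up3 cl => mkReg [blank] [] [] [] fun k => ((cl k).map fun s => sym s.1).toList
  | callDown2 d => mkReg [] [blank] [dig d] [dig d] fun k => (W.popW d k).map sym
  | callDown4 => mkReg [] [blank] [] [] fun _ => []
  | turn2 j => mkReg [] [mk j] [] [] fun _ => []
  | ret j => mkReg [] [mk j] [elo] [ehi] fun _ => [sym W.bot]
  | down _ => mkReg [blank] [] [] [] fun _ => []

open Sy in
/-- The words pushed by a transition. -/
def pushR : Lab W → Reg κ → List (Sy Δ Γ)
  | callUp q => mkReg [mk (upP q), blank] [] [elo] [ehi] fun _ => [sym W.bot]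
  | turnUp q j => mkReg [mk j] [] [] [] fun _ => if q then [] else [sym W.bot]
  | up1 d => mkReg [] [blank] [dig d] [dig d] fun _ => []
  | up3 _ => mkReg [] [blank] [] [] fun _ => []
  | callDown2 d => mkReg [mk 1, blank] [] [elo] [ehi] fun k => sym W.bot :: (W.pushW d k).map sym
  | callDown4 => mkReg [mk 3, blank] [] [elo] [ehi] fun _ => [sym W.bot]
  | turn2 j => mkReg [] [mk j] [] [] fun _ => []
  | ret _ => mkReg [] [] [] [] fun _ => []
  | down _ => mkReg [blank] [] [] [] fun _ => []

/-- Whether a transition exchanges the two tapes. -/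
def swaps : Lab W → Bool
  | callUp _ | callDown2 _ | callDown4 | ret _ => true
  | _ => false

/-- The destination of the contents of a register. -/
def perm (l : Lab W) : Reg κ ≃ Reg κ :=
  if l.swaps then Equiv.sumCongr (Equiv.swap 0 1) (Equiv.refl κ) else Equiv.refl _

/-- Whether a transition compares the two numbers with the oracle. -/
def isCmp : Lab W → Bool
  | turnUp false _ => true
  | _ => false

/-- One transition, over abstract stacks `V`. -/
def Step {V : Type} (push : Sy Δ Γ → V → V) (C : V → V → Prop) (l : Lab W)
    (c c' : Ctl × (Reg κ → V)) : Prop :=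
  c.1 = l.src ∧ c'.1 = l.tgt ∧
    (∃ core : Reg κ → V, (∀ j, c.2 j = (l.popR j).foldr push (core j)) ∧
      ∀ j, c'.2 (l.perm j) = (l.pushR j).foldr push (core j)) ∧
    (l.isCmp = true → C (c.2 rLo) (c.2 rHi))

/-- Interpretation of transitions as a stream of calls and returns: the state is the call
depth together with the digits seen at depth zero. -/
def fstep (s : Option (ℕ × List Δ)) (l : Lab W) : Option (ℕ × List Δ) :=
  s.bind fun p => match p.1, l with
    | 0, callDown2 d => some (1, p.2 ++ [d])
    | 0, down _ => some p
    | 0, _ => none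
    | e + 1, callUp _ => some (e + 2, p.2)
    | e + 1, callDown2 _ => some (e + 2, p.2)
    | e + 1, callDown4 => some (e + 2, p.2)
    | e + 1, ret _ => some (e, p.2)
    | _ + 1, _ => some p

/-- Reading a sequence of transitions from time `p.1` on with `fstep`. -/
def Tr (lab : ℕ → Lab W) : ℕ × Option (ℕ × List Δ) → ℕ × Option (ℕ × List Δ) → Prop :=
  Relation.ReflTransGen fun p q => q = (p.1 + 1, fstep p.2 (lab p.1))

end Lab

namespace Lab

variable {Δ κ Γ : Type} {W : StackMachine Δ κ Γ} {V : Type}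
  {push : Sy Δ Γ → V → V} {C : V → V → Prop}

theorem step_up {l : Lab W} {c c' : Ctl × (Reg κ → V)} (h : l.Step push C c c') (q : Bool)
    (hc : c.1 = (false, upP q)) :
    (l = callUp q ∧ c'.1 = (false, 0) ∧ (∃ a, c.2 rA = push .blank a) ∧ c'.2 rA = c.2 rB ∧
      c'.2 rB = push (.mk (upP q)) (c.2 rA)) ∨
    ∃ j, l = turnUp q j ∧ c'.1 = (false, downP q) ∧ (∃ a, c.2 rA = push (.mk j) a) ∧
      c'.2 rA = c.2 rA ∧ c'.2 rB = c.2 rB := by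
  obtain ⟨h1, h2, ⟨core, h3, h4⟩, -⟩ := h
  rw [hc] at h1
  have a3 := h3 rA
  have b3 := h3 rB
  have a4 := h4 rA
  have b4 := h4 rB
  cases l with
  | callUp q' =>
    have : q' = q := by
      cases q <;> cases q' <;> simp_all [src, upP]
    subst this
    left
    simp_all [perm, swaps, tgt, popR, pushR]
  | turnUp q' j =>
    have : q' = q := by
      cases q <;> cases q' <;> simp_all [src, upP]
    subst this
    right
    refine ⟨j, rfl, h2, ⟨core rA, a3⟩, ?_, ?_⟩ <;> simp_all [perm, swaps, popR, pushR]
  | _ => exfalso; cases q <;> simp_all [src, upP, downP]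

theorem step_returned_up {l : Lab W} {c c' : Ctl × (Reg κ → V)} (h : l.Step push C c c') (q : Bool)
    (hc : c.1 = (true, upP q)) :
    c'.1 = (false, upP q) ∧ (∃ a, c.2 rA = push .blank a ∧ c'.2 rA = a) ∧
      c'.2 rB = push .blank (c.2 rB) ∧
      ∀ d out, fstep (some (d + 1, out)) l = some (d + 1, out) := by
  obtain ⟨h1, h2, ⟨core, h3, h4⟩, -⟩ := h
  rw [hc] at h1
  have a3 := h3 rA
  have b3 := h3 rB
  have a4 := h4 rA
  have b4 := h4 rB
  cases l with
  | up1 =>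
    cases q <;> simp_all [perm, swaps, tgt, popR, pushR, src, upP, fstep]
  | up3 =>
    cases q <;> simp_all [perm, swaps, tgt, popR, pushR, src, upP, fstep]
  | down q' => exfalso; cases q <;> cases q' <;> simp_all [src, upP, downP]
  | _ => exfalso; cases q <;> simp_all [src, upP]

theorem step_down {l : Lab W} {c c' : Ctl × (Reg κ → V)} (h : l.Step push C c c') (q : Bool)
    (hc : c.1 = (false, downP q)) :
    (c'.1 = (false, 0) ∧ c.2 rB = push .blank (c'.2 rA) ∧
      c'.2 rB = push (.mk (downP q)) (push .blank (c.2 rA)) ∧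
      (∀ d out, fstep (some (d + 1, out)) l = some (d + 2, out)) ∧
      (q = false → ∃ e, ∀ out, fstep (some (0, out)) l = some (1, out ++ [e]))) ∨
    ∃ j b, c.2 rB = push (.mk j) b ∧
      ((q = false ∧ c'.1 = (false, 2) ∧ c'.2 rA = c.2 rA ∧ c'.2 rB = c.2 rB ∧
        ∀ d out, fstep (some (d + 1, out)) l = some (d + 1, out)) ∨
       (q = true ∧ c'.1 = (true, j) ∧ c'.2 rA = b ∧ c'.2 rB = c.2 rA ∧
        ∀ d out, fstep (some (d + 1, out)) l = some (d, out))) := by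
  obtain ⟨h1, h2, ⟨core, h3, h4⟩, -⟩ := h
  rw [hc] at h1
  have a3 := h3 rA
  have b3 := h3 rB
  have a4 := h4 rA
  have b4 := h4 rB
  cases l with
  | callDown2 e =>
    left
    have : q = false := by cases q <;> simp_all [src, downP]
    subst this
    simp_all [perm, swaps, tgt, popR, pushR, fstep, downP]
  | callDown4 =>
    left
    have : q = true := by cases q <;> simp_all [src, downP]
    subst this
    simp_all [perm, swaps, tgt, popR, pushR, fstep, downP]
  | turn2 j =>
    right
    have : q = false := by cases q <;> simp_all [src, downP]
    subst this
    refine ⟨j, core rB, ?_⟩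
    simp_all [perm, swaps, tgt, popR, pushR, fstep]
  | ret j =>
    right
    have : q = true := by cases q <;> simp_all [src, downP]
    subst this
    refine ⟨j, core rB, ?_⟩
    simp_all [perm, swaps, tgt, popR, pushR, fstep]
  | callUp q' => exfalso; cases q <;> cases q' <;> simp_all [src, upP, downP]
  | turnUp q' => exfalso; cases q <;> cases q' <;> simp_all [src, upP, downP]
  | _ => exfalso; cases q <;> simp_all [src, downP]

theorem step_returned_down {l : Lab W} {c c' : Ctl × (Reg κ → V)} (h : l.Step push C c c')
    (q : Bool) (hc : c.1 = (true, downP q)) :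
    c'.1 = (false, downP q) ∧ c'.2 rA = c.2 rA ∧ c'.2 rB = c.2 rB ∧
      (∃ a, c.2 rA = push .blank a) ∧ ∀ p, fstep (some p) l = some p := by
  obtain ⟨h1, h2, ⟨core, h3, h4⟩, -⟩ := h
  rw [hc] at h1
  have a3 := h3 rA
  have b3 := h3 rB
  have a4 := h4 rA
  have b4 := h4 rB
  cases l with
  | up1 => exfalso; cases q <;> simp_all [src, downP]
  | up3 => exfalso; cases q <;> simp_all [src, downP]
  | down q' =>
    have : q' = q := by cases q <;> cases q' <;> simp_all [src, downP]
    subst this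
    refine ⟨h2, ?_, ?_, ⟨_, a3⟩, ?_⟩
    · simp_all [perm, swaps, popR, pushR]
    · simp_all [perm, swaps, popR, pushR]
    · rintro ⟨_ | d, o⟩ <;> rfl
  | _ => exfalso; cases q <;> simp_all [src, upP, downP]

end Lab

namespace Lab

/-- Infinite sequences of transitions of the recursive system. -/
structure Orbit {Δ κ Γ : Type} (W : StackMachine Δ κ Γ) {V : Type} (push : Sy Δ Γ → V → V)
    (C : V → V → Prop) where
  lab : ℕ → Lab W
  cfg : ℕ → Ctl × (Reg κ → V)
  step : ∀ n, (lab n).Step push C (cfg n) (cfg (n + 1))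

variable {Δ κ Γ : Type} {W : StackMachine Δ κ Γ} {V : Type}
  {push : Sy Δ Γ → V → V} {C : V → V → Prop}

theorem Tr.one {lab : ℕ → Lab W} {n : ℕ} {s s' : Option (ℕ × List Δ)}
    (h : fstep s (lab n) = s') : Tr lab (n, s) (n + 1, s') :=
  Relation.ReflTransGen.single (by simp [h])

namespace Orbit

variable (o : Orbit W push C)

/-- The orbit is at time `n` in control state `s` with the tapes `a` and `b`. -/
def At (n : ℕ) (s : Ctl) (a b : V) : Prop :=
  (o.cfg n).1 = s ∧ (o.cfg n).2 rA = a ∧ (o.cfg n).2 rB = b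

variable (push) in
/-- Push `t` blanks. -/
def bl (t : ℕ) (v : V) : V := (push .blank)^[t] v

theorem bl_succ (t : ℕ) (v : V) : bl push (t + 1) v = push .blank (bl push t v) :=
  Function.iterate_succ_apply' _ _ _

theorem bl_succ' (t : ℕ) (v : V) : bl push (t + 1) v = bl push t (push .blank v) :=
  Function.iterate_succ_apply _ _ _

theorem bl_add (s t : ℕ) (v : V) : bl push (s + t) v = bl push s (bl push t v) :=
  Function.iterate_add_apply _ _ _ _

@[simp] theorem bl_zero (v : V) : bl push 0 v = v := rfl

/-- Calls of size `t` return and restore the tapes. -/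
def RunOK (t : ℕ) : Prop :=
  ∀ n j i ρ ρ', o.At n (false, 0) (bl push t (push (.mk j) ρ)) (push (.mk i) ρ') →
    ∃ n', o.At n' (true, i) ρ' (bl push t (push (.mk j) ρ)) ∧
      ∀ d out, Tr o.lab (n, some (d + 1, out)) (n', some (d, out))

variable {o} (hinj : ∀ a b v w, push a v = push b w → a = b ∧ v = w)

include hinj

theorem up_pass (q : Bool) (r : ℕ) : ∀ (s n : ℕ) (a : V) (i : Fin 4) (ρ : V),
    (∀ s' < s + r, o.RunOK s') →
    o.At n (false, upP q) (bl push r a) (bl push s (push (.mk i) ρ)) →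
    ∃ n', o.At n' (false, upP q) a (bl push (s + r) (push (.mk i) ρ)) ∧
      ∀ d out, Tr o.lab (n, some (d + 1, out)) (n', some (d + 1, out)) := by
  induction r with
  | zero =>
    intro s n a i ρ _ h
    exact ⟨n, h, fun d out => Relation.ReflTransGen.refl⟩
  | succ r ih =>
    intro s n a i ρ hr ⟨h1, h2, h3⟩
    rcases step_up (o.step n) q h1 with ⟨e1, e2, -, e3, e4⟩ | ⟨j, -, -, ⟨a', e⟩, -⟩
    · obtain ⟨n1, ⟨f1, f2, f3⟩, f4⟩ := hr s (by omega) (n + 1) i (upP q) ρ _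
        ⟨e2, e3.trans h3, e4⟩
      obtain ⟨g1, ⟨a', g2, g3⟩, g4, g5⟩ := step_returned_up (o.step n1) q f1
      have : a' = bl push r a := by
        rw [f2, h2, bl_succ] at g2
        exact ((hinj _ _ _ _ g2).2).symm
      obtain ⟨n', k1, k2⟩ := ih (s + 1) (n1 + 1) a i ρ (fun s' hs => hr s' (by omega))
        ⟨g1, g3.trans this, by rw [g4, f3, bl_succ]⟩
      refine ⟨n', by rwa [show s + (r + 1) = s + 1 + r by omega], fun d out => ?_⟩
      exact (Tr.one (by simp [e1, fstep])).trans
        ((f4 (d + 1) out).trans ((Tr.one (g5 _ _)).trans (k2 d out)))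
    · rw [h2, bl_succ] at e
      cases (hinj _ _ _ _ e).1

theorem down_pass (q : Bool) (s : ℕ) : ∀ (n : ℕ) (a : V) (i : Fin 4) (ρ : V),
    (∀ s' < s, o.RunOK s') →
    o.At n (false, downP q) a (bl push s (push (.mk i) ρ)) →
    ∃ n', o.At n' (false, downP q) (bl push s a) (push (.mk i) ρ) ∧
      (∀ d out, Tr o.lab (n, some (d + 1, out)) (n', some (d + 1, out))) ∧
      (q = false → ∀ out, ∃ w, w.length = s ∧
        Tr o.lab (n, some (0, out)) (n', some (0, out ++ w))) := by
  induction s with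
  | zero =>
    intro n a i ρ _ h
    exact ⟨n, h, fun d out => Relation.ReflTransGen.refl,
      fun _ out => ⟨[], rfl, by rw [List.append_nil]; exact Relation.ReflTransGen.refl⟩⟩
  | succ s ih =>
    intro n a i ρ hr ⟨h1, h2, h3⟩
    rcases step_down (o.step n) q h1 with ⟨e1, e2, e3, e4, e5⟩ | ⟨j, b, e, -⟩
    · rw [h3, bl_succ] at e2
      have e2 := (hinj _ _ _ _ e2).2
      obtain ⟨n1, ⟨f1, f2, f3⟩, f4⟩ := hr s (by omega) (n + 1) i (downP q) ρ _
        ⟨e1, e2.symm, e3⟩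
      obtain ⟨g1, g2, g3, -, g5⟩ := step_returned_down (o.step n1) q f1
      obtain ⟨n', k1, k2, k3⟩ := ih (n1 + 1) _ i ρ (fun s' hs => hr s' (by omega))
        ⟨g1, g2.trans f2, g3.trans f3⟩
      refine ⟨n', by rwa [bl_succ', ← h2], fun d out => ?_, fun hq out => ?_⟩
      · exact (Tr.one (e4 d out)).trans
          ((f4 (d + 1) out).trans ((Tr.one (g5 _)).trans (k2 d out)))
      · obtain ⟨x, hx⟩ := e5 hq
        obtain ⟨w, hw, k⟩ := k3 hq (out ++ [x])
        refine ⟨x :: w, by simp [hw], ?_⟩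
        rw [List.append_cons]
        exact (Tr.one (hx out)).trans ((f4 0 _).trans ((Tr.one (g5 _)).trans k))
    · rw [h3, bl_succ] at e
      cases (hinj _ _ _ _ e).1

theorem turn_up (q : Bool) {n : ℕ} {j : Fin 4} {a b : V}
    (h : o.At n (false, upP q) (push (.mk j) a) b) :
    o.At (n + 1) (false, downP q) (push (.mk j) a) b ∧ o.lab n = turnUp q j := by
  obtain ⟨h1, h2, h3⟩ := h
  rcases step_up (o.step n) q h1 with ⟨-, -, ⟨a', e⟩, -⟩ | ⟨j', e1, e2, ⟨a', e3⟩, e4, e5⟩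
  · rw [h2] at e
    cases (hinj _ _ _ _ e).1
  · rw [h2] at e3
    cases (hinj _ _ _ _ e3).1
    exact ⟨⟨e2, e4.trans h2, e5.trans h3⟩, e1⟩

theorem turn_down {n : ℕ} {j : Fin 4} {a b : V}
    (h : o.At n (false, 1) a (push (.mk j) b)) :
    o.At (n + 1) (false, 2) a (push (.mk j) b) ∧
      ∀ d out, fstep (some (d + 1, out)) (o.lab n) = some (d + 1, out) := by
  obtain ⟨h1, h2, h3⟩ := h
  rcases step_down (o.step n) false h1 with ⟨-, e, -⟩ | ⟨j', b', e, ⟨-, e1, e2, e3, e4⟩ | ⟨h, -⟩⟩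
  · rw [h3] at e
    cases (hinj _ _ _ _ e).1
  · exact ⟨⟨e1, e2.trans h2, e3.trans h3⟩, e4⟩
  · cases h

theorem return_step {n : ℕ} {j : Fin 4} {a b : V}
    (h : o.At n (false, 3) a (push (.mk j) b)) :
    o.At (n + 1) (true, j) b a ∧
      ∀ d out, fstep (some (d + 1, out)) (o.lab n) = some (d, out) := by
  obtain ⟨h1, h2, h3⟩ := h
  rcases step_down (o.step n) true h1 with ⟨-, e, -⟩ | ⟨j', b', e, ⟨h, -⟩ | ⟨-, e1, e2, e3, e4⟩⟩
  · rw [h3] at e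
    cases (hinj _ _ _ _ e).1
  · cases h
  · rw [h3] at e
    obtain ⟨e, e'⟩ := hinj _ _ _ _ e
    cases e
    subst e'
    exact ⟨⟨e1, e2, e3.trans h2⟩, e4⟩

theorem run_ok (t : ℕ) : o.RunOK t := by
  induction t using Nat.strong_induction_on with
  | _ t ih =>
    intro n j i ρ ρ' h
    obtain ⟨n1, h1, k1⟩ := up_pass hinj false t 0 n _ i ρ' (by simpa using ih) h
    obtain ⟨h2, k2⟩ := turn_up hinj false h1
    rw [Nat.zero_add] at h2
    obtain ⟨n3, h3, k3, -⟩ := down_pass hinj false t _ _ i ρ' ih h2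
    obtain ⟨h4, k4⟩ := turn_down hinj h3
    obtain ⟨n5, h5, k5⟩ := up_pass hinj true t 0 _ _ i ρ' (by simpa using ih) h4
    obtain ⟨h6, k6⟩ := turn_up hinj true h5
    rw [Nat.zero_add] at h6
    obtain ⟨n7, h7, k7, -⟩ := down_pass hinj true t _ _ i ρ' ih h6
    obtain ⟨h8, k8⟩ := return_step hinj h7
    refine ⟨_, h8, fun d out => ?_⟩
    refine (k1 d out).trans ((Tr.one ?_).trans ((k3 d out).trans ((Tr.one (k4 d out)).trans
      ((k5 d out).trans ((Tr.one ?_).trans ((k7 d out).trans (Tr.one (k8 d out))))))))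
    · rw [k2]; rfl
    · rw [k6]; rfl

/-- A call of size `t` contains a first phase turn followed by `t` digits at depth zero. -/
theorem exists_digits {t n : ℕ} {j i : Fin 4} {ρ ρ' : V}
    (h : o.At n (false, 0) (bl push t (push (.mk j) ρ)) (push (.mk i) ρ')) :
    ∃ m n' j w, o.lab m = turnUp false j ∧ w.length = t ∧
      Tr o.lab (m + 1, some (0, [])) (n', some (0, w)) := by
  obtain ⟨n1, h1, -⟩ := up_pass hinj false t 0 n _ i ρ' (fun s _ => run_ok hinj s) h
  obtain ⟨h2, k2⟩ := turn_up hinj false h1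
  rw [Nat.zero_add] at h2
  obtain ⟨n3, h3, -, k3⟩ := down_pass hinj false t _ _ i ρ' (fun s _ => run_ok hinj s) h2
  obtain ⟨w, hw, k⟩ := k3 rfl []
  exact ⟨n1, n3, j, w, k2, hw, k⟩

end Orbit
end Lab

namespace Lab
namespace Orbit

variable {Δ κ Γ : Type} {W : StackMachine Δ κ Γ} {V : Type}
  {push : Sy Δ Γ → V → V} {C : V → V → Prop} (o : Orbit W push C)

/-- There is a call of finite size at least `N`. -/
def LargeCall (N : ℕ) : Prop :=
  ∃ n t j i ρ ρ', N ≤ t ∧ o.At n (false, 0) (bl push t (push (.mk j) ρ)) (push (.mk i) ρ')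

/-- There is a call with at least `m` blanks on the first tape. -/
def BlankCall (m : ℕ) : Prop :=
  ∃ n i a ρ, o.At n (false, 0) (bl push m a) (push (.mk i) ρ)

/-- There is a return with at least `m` blanks on the second tape. -/
def BlankRet (m : ℕ) : Prop :=
  ∃ n i a b, o.At n (true, i) a (bl push m b)

variable {o} (hinj : ∀ a b v w, push a v = push b w → a = b ∧ v = w)

theorem BlankRet.mono {m m' : ℕ} (h : m ≤ m') : o.BlankRet m' → o.BlankRet m := by
  rintro ⟨n, i, a, b, h'⟩
  obtain ⟨k, rfl⟩ := Nat.exists_eq_add_of_le h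
  exact ⟨n, i, a, bl push k b, by rwa [← bl_add]⟩

theorem BlankCall.mono {m m' : ℕ} (h : m ≤ m') : o.BlankCall m' → o.BlankCall m := by
  rintro ⟨n, i, a, ρ, h'⟩
  obtain ⟨k, rfl⟩ := Nat.exists_eq_add_of_le h
  exact ⟨n, i, bl push k a, ρ, by rwa [← bl_add]⟩

/-- A call made while moving up. -/
theorem call_up {n : ℕ} {q : Bool} {a b : V} (h : o.At n (false, upP q) a b) :
    (∃ a', a = push .blank a' ∧ o.At (n + 1) (false, 0) b (push (.mk (upP q)) a)) ∨
    ∃ j a', a = push (.mk j) a' ∧ o.At (n + 1) (false, downP q) a b := by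
  obtain ⟨h1, h2, h3⟩ := h
  rcases step_up (o.step n) q h1 with ⟨-, e1, ⟨a', e2⟩, e3, e4⟩ | ⟨j, -, e2, ⟨a', e3⟩, e4, e5⟩
  · exact Or.inl ⟨a', h2 ▸ e2, e1, e3.trans h3, h2 ▸ e4⟩
  · exact Or.inr ⟨j, a', h2 ▸ e3, e2, e4.trans h2, e5.trans h3⟩

theorem call_down {n : ℕ} {q : Bool} {a b : V} (h : o.At n (false, downP q) a b) :
    (∃ b', b = push .blank b' ∧
      o.At (n + 1) (false, 0) b' (push (.mk (downP q)) (push .blank a))) ∨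
    ∃ j b', b = push (.mk j) b' := by
  obtain ⟨h1, h2, h3⟩ := h
  rcases step_down (o.step n) q h1 with ⟨e1, e2, e3, -⟩ | ⟨j, b', e2, -⟩
  · exact Or.inl ⟨_, h3 ▸ e2, e1, rfl, h2 ▸ e3⟩
  · exact Or.inr ⟨j, b', h3 ▸ e2⟩

include hinj

theorem BlankCall.largeCall {m : ℕ} : o.BlankCall m → o.LargeCall m := by
  rintro ⟨n, i, a, ρ, h⟩
  obtain ⟨n1, h1, -⟩ := up_pass hinj false m 0 n a i ρ (fun s _ => run_ok hinj s) h
  rw [Nat.zero_add] at h1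
  rcases call_up h1 with ⟨a', -, h2⟩ | ⟨j, a', rfl, -⟩
  · exact ⟨_, m, _, _, _, _, le_rfl, h2⟩
  · exact ⟨_, m, _, _, _, _, le_rfl, h⟩

theorem LargeCall.blankRet {m : ℕ} : o.LargeCall m → o.BlankRet m := by
  rintro ⟨n, t, j, i, ρ, ρ', ht, h⟩
  obtain ⟨n', h', -⟩ := run_ok hinj t n j i ρ ρ' h
  exact BlankRet.mono ht ⟨n', _, _, _, h'⟩

theorem BlankCall.blankRet {m : ℕ} (h : o.BlankCall m) : o.BlankRet m :=
  (h.largeCall hinj).blankRet hinj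

theorem blankCall_of_down {n m : ℕ} {q : Bool} {a b : V}
    (h : o.At n (false, downP q) a (bl push (m + 1) b)) : o.BlankCall m := by
  rcases call_down h with ⟨b', e, h'⟩ | ⟨j, b', e⟩
  · rw [bl_succ] at e
    rw [← (hinj _ _ _ _ e).2] at h'
    exact ⟨_, _, _, _, h'⟩
  · rw [bl_succ] at e
    cases (hinj _ _ _ _ e).1

theorem blankCall_of_up {n m : ℕ} {q : Bool} {a b : V}
    (h : o.At n (false, upP q) a (bl push (m + 1) b)) : o.BlankCall m := by
  rcases call_up h with ⟨a', -, h'⟩ | ⟨j, a', e, h'⟩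
  · exact BlankCall.mono (Nat.le_succ m) ⟨_, _, _, _, h'⟩
  · exact blankCall_of_down hinj h'

theorem BlankRet.blankCall {m : ℕ} : o.BlankRet (m + 1) → o.BlankCall m := by
  rintro ⟨n, i, a, b, h1, h2, h3⟩
  have key : (∃ q, i = upP q) ∨ ∃ q, i = downP q := by
    fin_cases i
    · exact Or.inl ⟨false, rfl⟩
    · exact Or.inr ⟨false, rfl⟩
    · exact Or.inl ⟨true, rfl⟩
    · exact Or.inr ⟨true, rfl⟩
  rcases key with ⟨q, rfl⟩ | ⟨q, rfl⟩
  · obtain ⟨g1, -, g4, -⟩ := step_returned_up (o.step n) q h1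
    rw [h3, ← bl_succ (push := push)] at g4
    exact BlankCall.mono (Nat.le_succ m) (blankCall_of_up hinj ⟨g1, rfl, g4⟩)
  · obtain ⟨g1, -, g4, -⟩ := step_returned_down (o.step n) q h1
    rw [h3] at g4
    exact blankCall_of_down hinj ⟨g1, rfl, g4⟩

omit hinj in
theorem trichotomy (a : V) : (∃ t j ρ, a = bl push t (push (.mk j) ρ)) ∨
    (∀ m, ∃ ρ, a = bl push m ρ) ∨
    ∃ t ρ, a = bl push t ρ ∧ (∀ ρ', ρ ≠ push .blank ρ') ∧ ∀ j ρ', ρ ≠ push (.mk j) ρ' := by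
  classical
  by_cases h : ∀ m, ∃ ρ, a = bl push m ρ
  · exact Or.inr (Or.inl h)
  · push Not at h
    have h' := Nat.find_spec h
    cases e : Nat.find h with
    | zero => exact absurd rfl (e ▸ h' a)
    | succ t =>
      rw [e] at h'
      have := Nat.find_min h (m := t) (by omega)
      push Not at this
      obtain ⟨ρ, hρ⟩ := this
      by_cases hm : ∃ j ρ', ρ = push (.mk j) ρ'
      · obtain ⟨j, ρ', rfl⟩ := hm
        exact Or.inl ⟨t, j, ρ', hρ⟩
      · push Not at hm
        refine Or.inr (Or.inr ⟨t, ρ, hρ, ?_, hm⟩)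
        rintro ρ' rfl
        exact h' ρ' (by rw [bl_succ', ← hρ])

/-- Moving down, either the markers are at finite distance or there are calls of all sizes. -/
theorem down_finite {n : ℕ} {q : Bool} {a b : V} (h : o.At n (false, downP q) a b) :
    (∃ s i ρ, b = bl push s (push (.mk i) ρ)) ∨ ∀ m, o.BlankCall m := by
  rcases trichotomy (push := push) b with h' | h' | ⟨t, ρ, rfl, h1, h2⟩
  · exact Or.inl h'
  · refine Or.inr fun m => ?_
    obtain ⟨ρ, rfl⟩ := h' (m + 1)
    exact blankCall_of_down hinj h
  · exfalso
    cases t with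
    | zero =>
      rcases call_down h with ⟨b', e, -⟩ | ⟨j, b', e⟩
      · exact h1 _ e
      · exact h2 _ _ e
    | succ t =>
      rcases call_down h with ⟨b', e, h'⟩ | ⟨j, b', e⟩
      · rw [bl_succ] at e
        rw [← (hinj _ _ _ _ e).2] at h'
        obtain ⟨n1, k1, -⟩ := up_pass hinj false t 0 _ _ _ _ (fun s _ => run_ok hinj s) h'
        rcases call_up k1 with ⟨a', e, -⟩ | ⟨j, a', e, -⟩
        · exact h1 _ e
        · exact h2 _ _ e
      · rw [bl_succ] at e
        cases (hinj _ _ _ _ e).1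

theorem ret_of_down {n r s : ℕ} {a ρ : V} {i : Fin 4}
    (h : o.At n (false, 3) (bl push r a) (bl push s (push (.mk i) ρ))) :
    o.BlankRet (s + r) := by
  obtain ⟨n1, h1, -⟩ := down_pass hinj true s _ _ _ _ (fun s _ => run_ok hinj s) h
  obtain ⟨h2, -⟩ := return_step hinj h1
  exact ⟨_, _, _, _, by rwa [← bl_add] at h2⟩

theorem ret_of_turned {n r s : ℕ} {a ρ : V} {i : Fin 4}
    (h : o.At n (false, 1) (bl push r a) (bl push s (push (.mk i) ρ))) :
    o.BlankRet (s + r) := by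
  obtain ⟨n1, h1, -⟩ := down_pass hinj false s _ _ _ _ (fun s _ => run_ok hinj s) h
  obtain ⟨h2, -⟩ := turn_down hinj h1
  rw [← bl_add] at h2
  obtain ⟨n3, h3, -⟩ := up_pass hinj true (s + r) 0 _ _ _ _ (fun s _ => run_ok hinj s) h2
  rw [Nat.zero_add] at h3
  rcases call_up h3 with ⟨a', -, h4⟩ | ⟨j, a', -, h4⟩
  · exact BlankCall.blankRet hinj ⟨_, _, _, _, h4⟩
  · exact ret_of_down hinj (r := 0) h4

theorem finite_of_bl {m s : ℕ} {i : Fin 4} {b ρ : V}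
    (h : bl push m b = bl push s (push (.mk i) ρ)) : m ≤ s := by
  induction m generalizing s with
  | zero => exact Nat.zero_le _
  | succ m ih =>
    cases s with
    | zero => rw [bl_succ, bl_zero] at h; cases (hinj _ _ _ _ h).1
    | succ s =>
      rw [bl_succ, bl_succ] at h
      exact Nat.succ_le_succ (ih (hinj _ _ _ _ h).2)

theorem BlankRet.succ {m : ℕ} : o.BlankRet m → o.BlankRet (m + 1) := by
  rintro ⟨n, i, a, b, h1, h2, h3⟩
  have key : (∃ q, i = upP q) ∨ ∃ q, i = downP q := by
    fin_cases i
    · exact Or.inl ⟨false, rfl⟩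
    · exact Or.inr ⟨false, rfl⟩
    · exact Or.inl ⟨true, rfl⟩
    · exact Or.inr ⟨true, rfl⟩
  rcases key with ⟨q, rfl⟩ | ⟨q, rfl⟩
  · obtain ⟨g1, -, g4, -⟩ := step_returned_up (o.step n) q h1
    rw [h3, ← bl_succ (push := push)] at g4
    rcases call_up ⟨g1, rfl, g4⟩ with ⟨_, -, h⟩ | ⟨j, a', -, h⟩
    · exact BlankCall.blankRet hinj ⟨_, _, _, _, h⟩
    · rcases down_finite hinj h with ⟨s, i, ρ, e⟩ | hall
      · have hs := finite_of_bl hinj e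
        rw [e] at h
        cases q
        · exact BlankRet.mono hs (ret_of_turned hinj (r := 0) h)
        · exact BlankRet.mono hs (ret_of_down hinj (r := 0) h)
      · exact (hall _).blankRet hinj
  · obtain ⟨g1, g2, g4, ⟨a', ha⟩, -⟩ := step_returned_down (o.step n) q h1
    have h : o.At (n + 1) (false, downP q) (bl push 1 a') (bl push m b) :=
      ⟨g1, g2.trans ha, g4.trans h3⟩
    rcases down_finite hinj h with ⟨s, i, ρ, e⟩ | hall
    · have hs := finite_of_bl hinj e
      rw [e] at h
      cases q
      · exact BlankRet.mono (Nat.succ_le_succ hs) (ret_of_turned hinj h)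
      · exact BlankRet.mono (Nat.succ_le_succ hs) (ret_of_down hinj h)
    · exact (hall _).blankRet hinj

theorem blankRet_zero : o.BlankRet 0 := by
  have h3 : ∀ n a b, o.At n (false, 3) a b → o.BlankRet 0 := by
    intro n a b h
    rcases call_down (q := true) h with ⟨_, -, h'⟩ | ⟨j, b', e⟩
    · exact BlankCall.blankRet hinj ⟨_, _, _, _, h'⟩
    · rw [e] at h
      exact ⟨_, _, _, _, (return_step hinj h).1⟩
  have h2 : ∀ n a b, o.At n (false, 2) a b → o.BlankRet 0 := by
    intro n a b h
    rcases call_up (q := true) h with ⟨_, -, h'⟩ | ⟨j, b', -, h'⟩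
    · exact BlankCall.blankRet hinj ⟨_, _, _, _, h'⟩
    · exact h3 _ _ _ h'
  have h1 : ∀ n a b, o.At n (false, 1) a b → o.BlankRet 0 := by
    intro n a b h
    rcases call_down (q := false) h with ⟨_, -, h'⟩ | ⟨j, b', e⟩
    · exact BlankCall.blankRet hinj ⟨_, _, _, _, h'⟩
    · rw [e] at h
      exact h2 _ _ _ (turn_down hinj h).1
  have h0 : ∀ n a b, o.At n (false, 0) a b → o.BlankRet 0 := by
    intro n a b h
    rcases call_up (q := false) h with ⟨_, -, h'⟩ | ⟨j, b', -, h'⟩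
    · exact BlankCall.blankRet hinj ⟨_, _, _, _, h'⟩
    · exact h1 _ _ _ h'
  rcases e : (o.cfg 0).1 with ⟨r, p⟩
  cases r
  · fin_cases p
    · exact h0 0 _ _ ⟨e, rfl, rfl⟩
    · exact h1 0 _ _ ⟨e, rfl, rfl⟩
    · exact h2 0 _ _ ⟨e, rfl, rfl⟩
    · exact h3 0 _ _ ⟨e, rfl, rfl⟩
  · exact ⟨0, p, _, _, e, rfl, rfl⟩

theorem blankRet (m : ℕ) : o.BlankRet m := by
  induction m with
  | zero => exact blankRet_zero hinj
  | succ m ih => exact ih.succ hinj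

/-- Every orbit contains, after a first phase turn, arbitrarily long digit sequences at depth
zero. -/
theorem exists_long_digits (N : ℕ) : ∃ m n j w, o.lab m = turnUp false j ∧ N ≤ w.length ∧
    Tr o.lab (m + 1, some (0, [])) (n, some (0, w)) := by
  obtain ⟨n, t, j, i, ρ, ρ', ht, h⟩ := ((blankRet hinj (N + 1)).blankCall hinj).largeCall hinj
  obtain ⟨m, n', j, w, h1, h2, h3⟩ := exists_digits hinj h
  exact ⟨m, n', j, w, h1, h2 ▸ ht, h3⟩

end Orbit
end Lab

/-! ### Frames on stacks -/

/-- The rewriting `p → q` of the top of a stack respects the frame marker `m`. -/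
def Neut {S : Type} (m : S) (p q : List S) : Prop :=
  (m ∉ p ∧ m ∉ q) ∨ (p = [m] ∧ ∃ l, q = l ++ [m] ∧ m ∉ l)

/-- The stack `v` consists of `d` frames, ended by the marker `m`, on top of `e`. -/
def Frames {S V : Type} (push : S → V → V) (m : S) : ℕ → V → V → Prop
  | 0, v, e => v = e
  | d + 1, v, e => ∃ (l : List S) (v' : V), m ∉ l ∧ v = l.foldr push (push m v') ∧ Frames push m d v' e

section Frames

variable {S V : Type} {push : S → V → V} (hinj : ∀ a b v w, push a v = push b w → a = b ∧ v = w)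

include hinj

theorem foldr_push_of_notMem {m : S} {ρ : V} {p : List S} : ∀ {L : List S} {core : V}, m ∉ p → m ∉ L →
    L.foldr push (push m ρ) = p.foldr push core →
    ∃ l, L = p ++ l ∧ core = l.foldr push (push m ρ) := by
  induction p with
  | nil => intro L core _ _ h; exact ⟨L, rfl, h.symm⟩
  | cons a p ih =>
    intro L core hp hL h
    cases L with
    | nil =>
      exact absurd (hinj _ _ _ _ h).1 (by rintro rfl; simp at hp)
    | cons b L =>
      obtain ⟨rfl, h'⟩ := hinj _ _ _ _ h
      obtain ⟨l, rfl, hl⟩ := ih (by simp_all) (by simp_all) h'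
      exact ⟨l, rfl, hl⟩

theorem neut_core {m : S} {ρ core : V} {L p q : List S} (hL : m ∉ L) (hn : Neut m p q)
    (h : L.foldr push (push m ρ) = p.foldr push core) :
    ∃ L' l, m ∉ L' ∧ L ++ [m] = p ++ l ∧ L' ++ [m] = q ++ l ∧
      q.foldr push core = L'.foldr push (push m ρ) := by
  rcases hn with ⟨hp, hq⟩ | ⟨rfl, l, rfl, hl⟩
  · obtain ⟨l, rfl, rfl⟩ := foldr_push_of_notMem hinj hp hL h
    exact ⟨q ++ l, l ++ [m], by simp_all, by simp, by simp, by simp⟩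
  · cases L with
    | nil =>
      have := (hinj _ _ _ _ h).2
      refine ⟨l, [], hl, rfl, by simp, ?_⟩
      simp only [List.foldr_append, List.foldr_cons, List.foldr_nil]
      rw [this]; rfl
    | cons b L => exact absurd (hinj _ _ _ _ h).1 (by rintro rfl; simp at hL)

theorem Frames.neut {m : S} {d : ℕ} {core e : V} {p q : List S} (hn : Neut m p q)
    (h : Frames push m (d + 1) (p.foldr push core) e) :
    Frames push m (d + 1) (q.foldr push core) e := by
  obtain ⟨l, v', hl, h, hf⟩ := h
  obtain ⟨L', -, h1, -, -, h2⟩ := neut_core hinj hl hn h.symm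
  exact ⟨L', v', h1, h2, hf⟩

theorem Frames.pop {m : S} {d : ℕ} {v e : V} (h : Frames push m (d + 1) (push m v) e) :
    Frames push m d v e := by
  obtain ⟨l, v', hl, h, hf⟩ := h
  cases l with
  | nil => exact (hinj _ _ _ _ h).2 ▸ hf
  | cons b l => exact absurd (hinj _ _ _ _ h).1 (by rintro rfl; simp at hl)

end Frames

theorem Frames.push {S V : Type} {push : S → V → V} {m : S} {d : ℕ} {v e : V}
    (h : Frames push m d v e) : Frames push m (d + 1) (push m v) e :=
  ⟨[], v, by simp, rfl, h⟩

namespace Lab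

variable {Δ κ Γ : Type} {W : StackMachine Δ κ Γ}

/-- The registers carrying frames, with their markers. -/
def IsMarker (W : StackMachine Δ κ Γ) (j : Reg κ) (m : Sy Δ Γ) : Prop :=
  (j = rLo ∧ m = .elo) ∨ (j = rHi ∧ m = .ehi) ∨ ∃ k, j = Sum.inr k ∧ m = .sym W.bot

theorem IsMarker.perm {j : Reg κ} {m : Sy Δ Γ} (h : IsMarker W j m) (l : Lab W) :
    l.perm j = j := by
  unfold Lab.perm
  split_ifs
  · rcases h with ⟨rfl, -⟩ | ⟨rfl, -⟩ | ⟨k, rfl, -⟩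
    · simp [Equiv.swap_apply_def]
    · simp [Equiv.swap_apply_def]
    · simp
  · rfl

theorem Neut.map_sym {m : Γ} {p q : List Γ} (h : Neut m p q) :
    Neut (Sy.sym m : Sy Δ Γ) (p.map .sym) (q.map .sym) := by
  rcases h with ⟨h1, h2⟩ | ⟨rfl, l, rfl, h⟩
  · left; simp_all
  · right; exact ⟨rfl, l.map .sym, by simp, by simp_all⟩

theorem neut_of_fstep {l : Lab W} {d d' : ℕ} {out out' : List Δ} {j : Reg κ} {m : Sy Δ Γ}
    (hm : IsMarker W j m) (h : fstep (some (d + 1, out)) l = some (d', out')) :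
    out' = out ∧ ((d' = d + 1 ∧ Neut m (l.popR j) (l.pushR j)) ∨
      (d' = d + 2 ∧ ∃ q, l.pushR j = m :: q ∧ Neut m (l.popR j) q) ∨
      (d' = d ∧ l.popR j = [m] ∧ l.pushR j = [])) := by
  have nn : Neut m [] [] := Or.inl (by simp)
  have n1 : Neut m [m] [m] := Or.inr ⟨rfl, [], by simp⟩
  cases l with
  | callUp =>
    simp only [fstep, Option.bind_some, Option.some.injEq, Prod.mk.injEq] at h
    refine ⟨h.2.symm, Or.inr (Or.inl ⟨h.1.symm, [], ?_⟩)⟩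
    rcases hm with ⟨rfl, rfl⟩ | ⟨rfl, rfl⟩ | ⟨k, rfl, rfl⟩ <;> simpa [popR, pushR] using nn
  | callDown4 =>
    simp only [fstep, Option.bind_some, Option.some.injEq, Prod.mk.injEq] at h
    refine ⟨h.2.symm, Or.inr (Or.inl ⟨h.1.symm, [], ?_⟩)⟩
    rcases hm with ⟨rfl, rfl⟩ | ⟨rfl, rfl⟩ | ⟨k, rfl, rfl⟩ <;> simpa [popR, pushR] using nn
  | callDown2 e =>
    simp only [fstep, Option.bind_some, Option.some.injEq, Prod.mk.injEq] at h
    refine ⟨h.2.symm, Or.inr (Or.inl ⟨h.1.symm, ?_⟩)⟩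
    rcases hm with ⟨rfl, rfl⟩ | ⟨rfl, rfl⟩ | ⟨k, rfl, rfl⟩
    · exact ⟨[], rfl, Or.inl (by simp [popR])⟩
    · exact ⟨[], rfl, Or.inl (by simp [popR])⟩
    · exact ⟨_, rfl, Neut.map_sym (W.ok e k)⟩
  | ret =>
    simp only [fstep, Option.bind_some, Option.some.injEq, Prod.mk.injEq] at h
    refine ⟨h.2.symm, Or.inr (Or.inr ⟨h.1.symm, ?_⟩)⟩
    rcases hm with ⟨rfl, rfl⟩ | ⟨rfl, rfl⟩ | ⟨k, rfl, rfl⟩ <;> simp [popR, pushR]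
  | turnUp q =>
    simp only [fstep, Option.bind_some, Option.some.injEq, Prod.mk.injEq] at h
    refine ⟨h.2.symm, Or.inl ⟨h.1.symm, ?_⟩⟩
    rcases hm with ⟨rfl, rfl⟩ | ⟨rfl, rfl⟩ | ⟨k, rfl, rfl⟩
    · simpa [popR, pushR] using nn
    · simpa [popR, pushR] using nn
    · cases q
      · simpa [popR, pushR] using n1
      · simpa [popR, pushR] using nn
  | up1 =>
    simp only [fstep, Option.bind_some, Option.some.injEq, Prod.mk.injEq] at h
    refine ⟨h.2.symm, Or.inl ⟨h.1.symm, Or.inl ?_⟩⟩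
    rcases hm with ⟨rfl, rfl⟩ | ⟨rfl, rfl⟩ | ⟨k, rfl, rfl⟩ <;> simp [popR, pushR]
  | up3 cl =>
    simp only [fstep, Option.bind_some, Option.some.injEq, Prod.mk.injEq] at h
    refine ⟨h.2.symm, Or.inl ⟨h.1.symm, Or.inl ?_⟩⟩
    rcases hm with ⟨rfl, rfl⟩ | ⟨rfl, rfl⟩ | ⟨k, rfl, rfl⟩
    · simp [popR, pushR]
    · simp [popR, pushR]
    · cases e : cl k with
      | none => simp [popR, pushR, e]
      | some s => simpa [popR, pushR, e] using s.2.symm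
  | turn2 =>
    simp only [fstep, Option.bind_some, Option.some.injEq, Prod.mk.injEq] at h
    refine ⟨h.2.symm, Or.inl ⟨h.1.symm, ?_⟩⟩
    rcases hm with ⟨rfl, rfl⟩ | ⟨rfl, rfl⟩ | ⟨k, rfl, rfl⟩ <;> simpa [popR, pushR] using nn
  | down =>
    simp only [fstep, Option.bind_some, Option.some.injEq, Prod.mk.injEq] at h
    refine ⟨h.2.symm, Or.inl ⟨h.1.symm, ?_⟩⟩
    rcases hm with ⟨rfl, rfl⟩ | ⟨rfl, rfl⟩ | ⟨k, rfl, rfl⟩ <;> simpa [popR, pushR] using nn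

variable {V : Type} {push : Sy Δ Γ → V → V} {C : V → V → Prop}

/-- The registers in the middle of the second phase, the digits `p.2` having been read. -/
def Inv (W : StackMachine Δ κ Γ) (push : Sy Δ Γ → V → V) (lo hi : V) (p : ℕ × List Δ)
    (c : Reg κ → V) : Prop :=
  ∃ (x y : V) (L : κ → List Γ) (ρ : κ → V), W.Reach p.2 L ∧
    lo = (p.2.map Sy.dig).foldr push x ∧ hi = (p.2.map Sy.dig).foldr push y ∧
    Frames push .elo p.1 (c rLo) x ∧ Frames push .ehi p.1 (c rHi) y ∧
    ∀ k, W.bot ∉ L k ∧ Frames push (.sym W.bot) p.1 (c (Sum.inr k))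
      (((L k).map Sy.sym).foldr push (push (.sym W.bot) (ρ k)))

variable (hinj : ∀ a b v w, push a v = push b w → a = b ∧ v = w)
include hinj

theorem frames_step {l : Lab W} {d d' : ℕ} {out out' : List Δ} {c c' : Ctl × (Reg κ → V)}
    (h : l.Step push C c c') (hf : fstep (some (d + 1, out)) l = some (d', out'))
    {j : Reg κ} {m : Sy Δ Γ} (hm : IsMarker W j m) {e : V}
    (hF : Frames push m (d + 1) (c.2 j) e) : Frames push m d' (c'.2 j) e := by
  obtain ⟨-, -, ⟨core, h3, h4⟩, -⟩ := h
  have h4 := h4 j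
  rw [hm.perm] at h4
  rw [h3] at hF
  rw [h4]
  obtain ⟨-, ⟨rfl, h⟩ | ⟨rfl, q, h1, h2⟩ | ⟨rfl, h1, h2⟩⟩ := neut_of_fstep hm hf
  · exact hF.neut hinj h
  · rw [h1]; exact (hF.neut hinj h2).push
  · rw [h2]; rw [h1] at hF; exact hF.pop hinj

theorem inv_step {l : Lab W} {lo hi : V} {p p' : ℕ × List Δ} {c c' : Ctl × (Reg κ → V)}
    (h : l.Step push C c c') (hI : Inv W push lo hi p c.2)
    (hf : fstep (some p) l = some p') : Inv W push lo hi p' c'.2 := by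
  obtain ⟨d, out⟩ := p
  obtain ⟨d', out'⟩ := p'
  obtain ⟨x, y, L, ρ, hR, hlo, hhi, hFl, hFh, hK⟩ := hI
  cases d with
  | succ d =>
    have hout := (neut_of_fstep (j := rLo) (Or.inl ⟨rfl, rfl⟩) hf).1
    subst hout
    exact ⟨x, y, L, ρ, hR, hlo, hhi, frames_step hinj h hf (Or.inl ⟨rfl, rfl⟩) hFl,
      frames_step hinj h hf (Or.inr (Or.inl ⟨rfl, rfl⟩)) hFh, fun k => ⟨(hK k).1,
      frames_step hinj h hf (Or.inr (Or.inr ⟨k, rfl, rfl⟩)) (hK k).2⟩⟩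
  | zero =>
    obtain ⟨-, -, ⟨core, h3, h4⟩, -⟩ := h
    cases l with
    | callDown2 e =>
      simp only [fstep, Option.bind_some, Option.some.injEq, Prod.mk.injEq] at hf
      obtain ⟨rfl, rfl⟩ := hf
      have l3 := h3 rLo
      have l4 := h4 rLo
      have i3 := h3 rHi
      have i4 := h4 rHi
      rw [IsMarker.perm (m := .elo) (Or.inl ⟨rfl, rfl⟩)] at l4
      rw [IsMarker.perm (m := .ehi) (Or.inr (Or.inl ⟨rfl, rfl⟩))] at i4
      simp only [Frames, popR, pushR, mkReg_two, mkReg_three, List.foldr_cons,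
        List.foldr_nil] at l3 l4 i3 i4 hFl hFh
      have key : ∀ k, ∃ L' l, W.bot ∉ L' ∧ L k ++ [W.bot] = W.popW e k ++ l ∧
          L' ++ [W.bot] = W.pushW e k ++ l ∧
          (W.pushW e k).foldr (fun s => push (.sym s)) (core (Sum.inr k)) =
            L'.foldr (fun s => push (.sym s)) (push (.sym W.bot) (ρ k)) := by
        intro k
        refine neut_core (push := fun s => push (.sym s)) ?_ (hK k).1 (W.ok e k) ?_
        · intro a b v w hab
          have := hinj _ _ _ _ hab
          simpa using this
        · have h1 := (hK k).2
          have h2 := h3 (Sum.inr k)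
          simp only [Frames, popR, mkReg_inr] at h1 h2
          rw [h1] at h2
          simpa [List.foldr_map] using h2
      choose L' l hL' e1 e2 e3 using key
      refine ⟨core rLo, core rHi, L', ρ, hR.snoc fun k => ⟨l k, e1 k, e2 k⟩, ?_, ?_, ?_, ?_,
        fun k => ⟨hL' k, ?_⟩⟩
      · rw [hlo, ← hFl, l3]; simp
      · rw [hhi, ← hFh, i3]; simp
      · rw [l4]; exact Frames.push rfl
      · rw [i4]; exact Frames.push rfl
      · have h5 := h4 (Sum.inr k)
        rw [IsMarker.perm (m := .sym W.bot) (Or.inr (Or.inr ⟨k, rfl, rfl⟩))] at h5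
        rw [h5]
        simp only [pushR, mkReg_inr, List.foldr_cons, List.foldr_map]
        rw [e3 k]
        exact Frames.push rfl
    | down q =>
      simp only [fstep, Option.bind_some, Option.some.injEq, Prod.mk.injEq] at hf
      obtain ⟨rfl, rfl⟩ := hf
      have key : ∀ j m, IsMarker W j m → c'.2 j = c.2 j := by
        intro j m hm
        have h5 := h4 j
        rw [hm.perm] at h5
        rw [h5, h3 j]
        rcases hm with ⟨rfl, -⟩ | ⟨rfl, -⟩ | ⟨k, rfl, -⟩ <;> rfl
      refine ⟨x, y, L, ρ, hR, hlo, hhi, ?_, ?_, fun k => ⟨(hK k).1, ?_⟩⟩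
      · rw [key _ _ (Or.inl ⟨rfl, rfl⟩)]; exact hFl
      · rw [key _ _ (Or.inr (Or.inl ⟨rfl, rfl⟩))]; exact hFh
      · rw [key _ _ (Or.inr (Or.inr ⟨k, rfl, rfl⟩))]; exact (hK k).2
    | _ => simp [fstep] at hf

namespace Orbit

variable (o : Orbit W push C)

/-- The digits read after a first phase turn form a run of the simulated machine and a prefix
of the oracle. -/
theorem runs_of_tr {z : V}
    (hC : ∀ lo hi, C lo hi → ∀ (w : List Δ) (x y : V), lo = (w.map Sy.dig).foldr push x →
      hi = (w.map Sy.dig).foldr push y → ∃ x', z = (w.map Sy.dig).foldr push x')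
    {m n d : ℕ} {j : Fin 4} {w : List Δ} (hm : o.lab m = turnUp false j)
    (h : Tr o.lab (m + 1, some (0, [])) (n, some (d, w))) :
    W.Runs w ∧ ∃ x, z = (w.map Sy.dig).foldr push x := by
  obtain ⟨h1, h2, ⟨core, h3, h4⟩, h5⟩ := o.step m
  rw [hm] at h3 h4 h5
  have h0 : Inv W push ((o.cfg m).2 rLo) ((o.cfg m).2 rHi) (0, []) (o.cfg (m + 1)).2 := by
    refine ⟨_, _, fun _ => [], fun k => core (Sum.inr k), .nil, rfl, rfl, ?_, ?_, fun k =>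
      ⟨by simp, ?_⟩⟩
    · exact (h4 rLo).trans (h3 rLo).symm
    · exact (h4 rHi).trans (h3 rHi).symm
    · exact h4 (Sum.inr k)
  have key : ∀ q, Tr o.lab (m + 1, some (0, [])) q → ∀ p, q.2 = some p →
      Inv W push ((o.cfg m).2 rLo) ((o.cfg m).2 rHi) p (o.cfg q.1).2 := by
    intro q hq
    induction hq with
    | refl => rintro p ⟨⟩; exact h0
    | @tail a b hab hb ih =>
      subst hb
      intro p hp
      obtain ⟨i, s⟩ := a
      cases s with
      | none => simp [fstep] at hp
      | some s => exact inv_step hinj (o.step i) (ih s rfl) hp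
  obtain ⟨x, y, L, ρ, hR, hlo, hhi, -⟩ := key _ h _ rfl
  exact ⟨⟨L, hR⟩, hC _ _ (h5 rfl) w x y hlo hhi⟩

end Orbit
end Lab

theorem StackMachine.Runs.of_append {Δ κ Γ : Type} {W : StackMachine Δ κ Γ} {l l' : List Δ} :
    W.Runs (l ++ l') → W.Runs l := by
  induction l' using List.reverseRecOn with
  | nil => simp
  | append_singleton l' a ih =>
    rw [← List.append_assoc]
    rintro ⟨L, h⟩
    apply ih
    generalize hm : (l ++ l') ++ [a] = m at h
    cases h with
    | nil => simp at hm
    | snoc h' _ =>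
      have := (List.append_inj' hm rfl).1
      exact ⟨_, this ▸ h'⟩

namespace Lab

variable {Δ κ Γ : Type} {W : StackMachine Δ κ Γ}

/-- The effect of a transition at depth zero. -/
def act0 : Lab W → Option (Option Δ)
  | callDown2 d => some (some d)
  | down _ => some none
  | _ => none

/-- One more than the change of depth. -/
def act1 : Lab W → ℕ
  | callUp _ | callDown2 _ | callDown4 => 2
  | ret _ => 0
  | _ => 1

theorem fstep_eq (s : Option (ℕ × List Δ)) (l : Lab W) :
    fstep s l = s.bind fun p => Nat.casesOn (motive := fun _ => Option (ℕ × List Δ)) p.1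
      (l.act0.map fun x => Option.casesOn (motive := fun _ => ℕ × List Δ) x (0, p.2)
        fun d => (1, p.2 ++ [d]))
      fun e => some (e + l.act1, p.2) := by
  rcases s with _ | ⟨_ | e, out⟩
  · rfl
  · cases l <;> rfl
  · cases l <;> rfl

theorem fstep_primrec [Primcodable Δ] {N : ℕ} (f : Fin N → Lab W) :
    Primrec₂ fun (s : Option (ℕ × List Δ)) (i : Fin N) => fstep s (f i) := by
  simp only [fstep_eq]
  have h0 : Primrec fun i : Fin N => (f i).act0 := Primrec.dom_finite _
  have h1 : Primrec fun i : Fin N => (f i).act1 := Primrec.dom_finite _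
  refine Primrec.option_bind Primrec.fst ?_
  refine Primrec.nat_casesOn (Primrec.fst.comp Primrec.snd) ?_ ?_
  · refine Primrec.option_map (h0.comp (Primrec.snd.comp Primrec.fst)) ?_
    refine Primrec.option_casesOn Primrec.snd ?_ ?_
    · exact Primrec.pair (Primrec.const 0) ((Primrec.snd.comp Primrec.snd).comp Primrec.fst)
    · exact Primrec.pair (Primrec.const 1) (Primrec.list_concat.comp
        (((Primrec.snd.comp Primrec.snd).comp Primrec.fst).comp Primrec.fst) Primrec.snd)
  · exact Primrec.option_some.comp (Primrec.pair (Primrec.nat_add.comp Primrec.snd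
      (h1.comp ((Primrec.snd.comp Primrec.fst).comp Primrec.fst)))
      ((Primrec.snd.comp Primrec.snd).comp Primrec.fst))

/-- Read `len` transitions from time `m`. -/
def foldFrom (lab : ℕ → Lab W) (m len : ℕ) (s : Option (ℕ × List Δ)) : Option (ℕ × List Δ) :=
  Nat.rec s (fun t r => fstep r (lab (m + t))) len

theorem tr_iff_foldFrom {lab : ℕ → Lab W} {m : ℕ} {s : Option (ℕ × List Δ)}
    {q : ℕ × Option (ℕ × List Δ)} :
    Tr lab (m, s) q ↔ ∃ len, q = (m + len, foldFrom lab m len s) := by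
  constructor
  · intro h
    induction h with
    | refl => exact ⟨0, rfl⟩
    | tail _ h ih =>
      obtain ⟨len, rfl⟩ := ih
      exact ⟨len + 1, h⟩
  · rintro ⟨len, rfl⟩
    induction len with
    | zero => exact Relation.ReflTransGen.refl
    | succ len ih => exact ih.tail rfl

theorem digs_agree {V : Type} {push : Sy Δ Γ → V → V}
    (hinj : ∀ a b v w, push a v = push b w → a = b ∧ v = w) :
    ∀ {w w' : List Δ} {x x' : V}, (w.map Sy.dig).foldr push x = (w'.map Sy.dig).foldr push x' →
      ∀ {i : ℕ} {a b : Δ}, w[i]? = some a → w'[i]? = some b → a = b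
  | [], _, _, _, _, _, _, _, h, _ => by simp at h
  | _ :: _, [], _, _, _, _, _, _, _, h => by simp at h
  | c :: w, c' :: w', x, x', h, i, a, b, h1, h2 => by
    obtain ⟨h3, h4⟩ := hinj _ _ _ _ h
    cases i with
    | zero => simp at h1 h2; rw [← h1, ← h2]; simpa using h3
    | succ i => exact digs_agree hinj h4 (by simpa using h1) (by simpa using h2)

theorem computable_foldFrom [Primcodable Δ] {N : ℕ} (f : Fin N → Lab W) {i : ℕ → Fin N}
    (hi : Computable i) :
    Computable fun p : ℕ × ℕ => foldFrom (fun n => f (i n)) p.1 p.2 (some (0, [])) := by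
  have h1 : Computable₂ fun (s : Option (ℕ × List Δ)) (i : Fin N) => fstep s (f i) :=
    (fstep_primrec _).to_comp
  have h2 : Computable₂ fun (p : ℕ × ℕ) (q : ℕ × Option (ℕ × List Δ)) =>
      fstep q.2 (f (i (p.1 + q.1))) :=
    h1.comp (Computable.snd.comp Computable.snd) (hi.comp (Primrec.nat_add.to_comp.comp
      (Computable.fst.comp Computable.fst) (Computable.fst.comp Computable.snd)))
  exact Computable.nat_rec (f := fun p : ℕ × ℕ => p.2) (g := fun _ => some (0, []))
    Computable.snd (Computable.const _) h2

/-- A computable orbit of the recursive system yields a computable infinite run of the simulated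
machine. -/
theorem Orbit.exists_computable_run [Finite Δ] {V : Type} {push : Sy Δ Γ → V → V} {C : V → V → Prop}
    (hinj : ∀ a b v w, push a v = push b w → a = b ∧ v = w) (o : Orbit W push C) {z : V}
    (hC : ∀ lo hi, C lo hi → ∀ (w : List Δ) (x y : V), lo = (w.map Sy.dig).foldr push x →
      hi = (w.map Sy.dig).foldr push y → ∃ x', z = (w.map Sy.dig).foldr push x')
    {N : ℕ} (e : Lab W ≃ Fin N) (he : Computable fun n => e (o.lab n)) :
    ∃ δ : ℕ → Δ, (∀ n, W.Runs ((List.range n).map δ)) ∧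
      ∀ f : Δ → ℕ, Computable fun n => f (δ n) := by
  classical
  obtain ⟨M, ⟨eΔ⟩⟩ := Finite.exists_equiv_fin Δ
  let _ : Primcodable Δ := Primcodable.ofEquiv (Fin M) eΔ
  let isT : Fin N → Bool := fun i => decide (∃ j, e.symm i = turnUp false j)
  let test : ℕ → ℕ → Option Δ := fun n k =>
    bif isT (e (o.lab k.unpair.1)) then
      (foldFrom o.lab (k.unpair.1 + 1) k.unpair.2 (some (0, []))).bind fun p => p.2[n]?
    else none
  have htest : Computable₂ test := by
    have hi : Computable fun p : ℕ × ℕ => e (o.lab p.2.unpair.1) :=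
      he.comp (Computable.fst.comp (Computable.unpair.comp Computable.snd))
    have hT : Computable isT := (Primrec.dom_finite _).to_comp
    have hf : Computable fun p : ℕ × ℕ =>
        foldFrom o.lab (p.2.unpair.1 + 1) p.2.unpair.2 (some (0, [])) := by
      have h := computable_foldFrom e.symm he
      simp only [Equiv.symm_apply_apply] at h
      exact h.comp (Computable.pair (Computable.succ.comp
        (Computable.fst.comp (Computable.unpair.comp Computable.snd)))
        (Computable.snd.comp (Computable.unpair.comp Computable.snd)))
    refine Computable.cond (hT.comp hi) ?_ (Computable.const none)
    refine Computable.option_bind hf ?_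
    exact Computable.list_getElem?.comp (Computable.snd.comp Computable.snd)
      (Computable.fst.comp Computable.fst)
  have hsound : ∀ k : ℕ, isT (e (o.lab k.unpair.1)) = true → ∀ p,
      foldFrom o.lab (k.unpair.1 + 1) k.unpair.2 (some (0, [])) = some p →
      W.Runs p.2 ∧ ∃ x, z = (p.2.map Sy.dig).foldr push x := by
    intro k hk p hp
    obtain ⟨j, hj⟩ := of_decide_eq_true hk
    rw [Equiv.symm_apply_apply] at hj
    refine runs_of_tr hinj o hC hj (n := k.unpair.1 + 1 + k.unpair.2) (d := p.1) (w := p.2) ?_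
    rw [tr_iff_foldFrom]
    exact ⟨k.unpair.2, by rw [hp]⟩
  have htest_iff : ∀ (n k : ℕ) (a : Δ), test n k = some a ↔ isT (e (o.lab k.unpair.1)) = true ∧ ∃ p : ℕ × List Δ,
      foldFrom o.lab (k.unpair.1 + 1) k.unpair.2 (some (0, [])) = some p ∧ p.2[n]? = some a := by
    intro n k a
    simp only [test]
    cases isT (e (o.lab k.unpair.1)) <;> simp [Option.bind_eq_some_iff]
  have hex : ∀ n, ∃ (k : ℕ) (p : ℕ × List Δ), isT (e (o.lab k.unpair.1)) = true ∧
      foldFrom o.lab (k.unpair.1 + 1) k.unpair.2 (some (0, [])) = some p ∧ n ≤ p.2.length := by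
    intro n
    obtain ⟨m, n', j, w, h1, h2, h3⟩ := exists_long_digits hinj (o := o) n
    obtain ⟨len, h3⟩ := tr_iff_foldFrom.1 h3
    refine ⟨Nat.pair m len, (0, w), ?_, ?_, h2⟩
    · simp [isT, h1]
    · simpa using (congrArg Prod.snd h3).symm
  have hdom : ∀ n, (Nat.rfindOpt (test n)).Dom := by
    intro n
    rw [Nat.rfindOpt_dom]
    obtain ⟨k, p, h1, h2, h3⟩ := hex (n + 1)
    exact ⟨k, p.2[n], (htest_iff _ _ _).2 ⟨h1, p, h2, by simp [List.getElem?_eq_getElem h3]⟩⟩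
  let δ : ℕ → Δ := fun n => (Nat.rfindOpt (test n)).get (hdom n)
  have hδ : ∀ n, δ n ∈ Nat.rfindOpt (test n) := fun n => Part.get_mem _
  have hcomp : Computable δ := (Partrec.rfindOpt htest).of_eq fun n => by
    exact Part.eq_some_iff.2 (hδ n)
  refine ⟨δ, fun n => ?_, fun f => (Primrec.dom_finite f).to_comp.comp hcomp⟩
  obtain ⟨k, p, h1, h2, h3⟩ := hex n
  obtain ⟨h4, x, h5⟩ := hsound k h1 p h2
  have : p.2 = (List.range n).map δ ++ p.2.drop n := by
    conv_lhs => rw [← List.take_append_drop n p.2]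
    congr 1
    apply List.ext_getElem
    · simpa using h3
    intro i hi hi'
    simp only [List.getElem_take, List.getElem_map, List.getElem_range]
    obtain ⟨k', hk'⟩ := Nat.rfindOpt_spec (hδ i)
    obtain ⟨g1, p', g2, g3⟩ := (htest_iff _ _ _).1 hk'
    obtain ⟨-, x', g5⟩ := hsound k' g1 p' g2
    exact digs_agree hinj (h5.symm.trans g5) (List.getElem?_eq_getElem _) g3
  rw [this] at h4
  exact h4.of_append

end Lab

/-- Paths of given length of a relation. -/
inductive Path {α : Type*} (R : α → α → Prop) : ℕ → α → α → Prop
  | nil (a) : Path R 0 a a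
  | tail {n a b c} : Path R n a b → R b c → Path R (n + 1) a c

/-- There is a path of length at least `n`. -/
def LongPath {α : Type*} (R : α → α → Prop) (n : ℕ) (a b : α) : Prop := ∃ m ≥ n, Path R m a b

namespace LongPath

variable {α : Type*} {R : α → α → Prop}

theorem nil (a : α) : LongPath R 0 a a := ⟨0, le_rfl, .nil a⟩

theorem one {a b : α} (h : R a b) : LongPath R 1 a b := ⟨1, le_rfl, .tail (.nil a) h⟩

theorem trans {n m : ℕ} {a b c : α} (h : LongPath R n a b) (h' : LongPath R m b c) :
    LongPath R (n + m) a c := by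
  obtain ⟨k, hk, h⟩ := h
  obtain ⟨l, hl, h'⟩ := h'
  refine ⟨k + l, by omega, ?_⟩
  clear hl
  induction h' with
  | nil => exact h
  | tail _ h2 ih => exact .tail (ih h) h2

theorem mono {n m : ℕ} {a b : α} (hnm : m ≤ n) (h : LongPath R n a b) : LongPath R m a b :=
  let ⟨k, hk, h⟩ := h
  ⟨k, hnm.trans hk, h⟩

theorem exists_seq {n : ℕ} {a b : α} (h : LongPath R n a b) :
    ∃ s : ℕ → α, ∀ i < n, R (s i) (s (i + 1)) := by
  obtain ⟨k, hk, h⟩ := h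
  suffices ∃ s : ℕ → α, s k = b ∧ ∀ i < k, R (s i) (s (i + 1)) by
    obtain ⟨s, -, hs⟩ := this
    exact ⟨s, fun i hi => hs i (by omega)⟩
  clear hk
  induction h with
  | nil a => exact ⟨fun _ => a, rfl, by simp⟩
  | @tail n a b c _ h2 ih =>
    obtain ⟨s, h3, h4⟩ := ih
    refine ⟨Function.update s (n + 1) c, by simp, fun i hi => ?_⟩
    rcases Nat.lt_succ_iff_lt_or_eq.1 hi with hi | rfl
    · rw [Function.update_of_ne (by omega), Function.update_of_ne (by omega)]
      exact h4 i hi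
    · rw [Function.update_self, Function.update_of_ne (by omega), h3]
      exact h2

end LongPath

theorem StackMachine.Step.bound {Δ κ Γ : Type} {W : StackMachine Δ κ Γ} {d : Δ}
    {L L' : κ → List Γ} (h : W.Step d L L') {n : ℕ} (hL : ∀ k, (L k).length ≤ n ∧ W.bot ∉ L k)
    (k : κ) : (L' k).length ≤ n + 1 ∧ W.bot ∉ L' k := by
  obtain ⟨l, h1, h2⟩ := h k
  have hg := W.growth d k
  have e1 := congrArg List.length h1
  have e2 := congrArg List.length h2
  simp only [List.length_append, List.length_singleton] at e1 e2
  refine ⟨by have := (hL k).1; omega, fun hb => ?_⟩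
  rcases W.ok d k with ⟨h3, h4⟩ | ⟨h3, m, h4, h5⟩
  · obtain ⟨x, hx⟩ : ∃ x, l = x ++ [W.bot] := List.append_eq_append_iff.1 h1 |>.elim
      (fun ⟨as, e, e'⟩ => by
        rcases as with _ | ⟨a, as⟩
        · exact ⟨[], by simpa using e'.symm⟩
        · exfalso
          simp only [List.cons_append, List.cons.injEq] at e'
          exact h3 (by rw [e, ← e'.1]; simp))
      (fun ⟨bs, e, e'⟩ => ⟨bs, e'⟩)
    subst hx
    rw [← List.append_assoc] at h1 h2
    have h1 := List.append_cancel_right h1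
    have h2 := List.append_cancel_right h2
    rw [h2] at hb
    rcases List.mem_append.1 hb with hb | hb
    · exact h4 hb
    · exact (hL k).2 (by rw [h1]; simp [hb])
  · rw [h3] at h1
    rcases hLk : L k with _ | ⟨a, as⟩
    · rw [hLk] at h1
      simp only [List.nil_append, List.singleton_append, List.cons.injEq, true_and] at h1
      rw [← h1, h4, List.append_nil] at h2
      rw [List.append_cancel_right h2] at hb
      exact h5 hb
    · rw [hLk] at h1
      simp only [List.cons_append, List.nil_append, List.cons.injEq] at h1
      exact (hL k).2 (by rw [hLk, h1.1]; simp)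

namespace Lab

variable {Δ κ Γ : Type} {W : StackMachine Δ κ Γ} {C : List (Sy Δ Γ) → List (Sy Δ Γ) → Prop}

open Sy

section steps

/-- One transition of the recursive system over lists. -/
def LStep (W : StackMachine Δ κ Γ) (C : List (Sy Δ Γ) → List (Sy Δ Γ) → Prop)
    (c c' : Ctl × (Reg κ → List (Sy Δ Γ))) : Prop := ∃ l : Lab W, l.Step List.cons C c c'

theorem foldr_cons_append {α : Type*} (p v : List α) : p.foldr List.cons v = p ++ v := by
  simp

theorem LStep.mk (l : Lab W) {r r' core : Reg κ → List (Sy Δ Γ)}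
    (h : ∀ j, r j = l.popR j ++ core j) (h' : ∀ j, r' (l.perm j) = l.pushR j ++ core j)
    (hC : l.isCmp = true → C (r rLo) (r rHi)) : LStep W C (l.src, r) (l.tgt, r') :=
  ⟨l, rfl, rfl, ⟨core, fun j => by simpa using h j, fun j => by simpa using h' j⟩, hC⟩

theorem forall_reg {p : Reg κ → Prop} (h0 : p rA) (h1 : p rB) (h2 : p rLo) (h3 : p rHi)
    (hk : ∀ k, p (Sum.inr k)) (j : Reg κ) : p j := by
  rcases j with i | k
  · fin_cases i
    exacts [h0, h1, h2, h3]
  · exact hk k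

variable {a b lo hi : List (Sy Δ Γ)} {k : κ → List (Sy Δ Γ)}

theorem lstep_callUp (q : Bool) : LStep W C ((false, upP q), mkReg (blank :: a) b lo hi k)
    ((false, 0), mkReg b (mk (upP q) :: blank :: a) (elo :: lo) (ehi :: hi)
      fun x => sym W.bot :: k x) :=
  LStep.mk (callUp q) (core := mkReg a b lo hi k)
    (forall_reg rfl rfl rfl rfl fun _ => rfl) (forall_reg rfl rfl rfl rfl fun _ => rfl) nofun

theorem lstep_turnUp_false (j : Fin 4) (hC : C lo hi) :
    LStep W C ((false, 0), mkReg (mk j :: a) b lo hi fun x => sym W.bot :: k x)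
    ((false, 1), mkReg (mk j :: a) b lo hi fun x => sym W.bot :: k x) :=
  LStep.mk (turnUp false j) (core := mkReg a b lo hi k)
    (forall_reg rfl rfl rfl rfl fun _ => rfl) (forall_reg rfl rfl rfl rfl fun _ => rfl)
    fun _ => hC

theorem lstep_turnUp_true (j : Fin 4) :
    LStep W C ((false, 2), mkReg (mk j :: a) b lo hi k)
    ((false, 3), mkReg (mk j :: a) b lo hi k) :=
  LStep.mk (turnUp true j) (core := mkReg a b lo hi k)
    (forall_reg rfl rfl rfl rfl fun _ => rfl) (forall_reg rfl rfl rfl rfl fun _ => rfl) nofun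

theorem lstep_up1 (d : Δ) : LStep W C ((true, 0), mkReg (blank :: a) b lo hi k)
    ((false, 0), mkReg a (blank :: b) (dig d :: lo) (dig d :: hi) k) :=
  LStep.mk (up1 d) (core := mkReg a b lo hi k)
    (forall_reg rfl rfl rfl rfl fun _ => rfl) (forall_reg rfl rfl rfl rfl fun _ => rfl) nofun

theorem lstep_up3 (M : κ → List Γ) (hM : ∀ x, W.bot ∉ M x) :
    LStep W C ((true, 2), mkReg (blank :: a) b lo hi fun x => (M x).map sym ++ k x)
    ((false, 2), mkReg a (blank :: b) lo hi fun x => (M x).tail.map sym ++ k x) := by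
  refine LStep.mk (up3 fun x => match hx : M x with
      | [] => none
      | s :: _ => some ⟨s, fun h => hM x (by simp [hx, h])⟩)
    (core := mkReg a b lo hi fun x => (M x).tail.map sym ++ k x)
    (forall_reg rfl rfl rfl rfl fun x => ?_) (forall_reg rfl rfl rfl rfl fun x => rfl) nofun
  simp only [mkReg_inr, popR]
  split <;> rename_i h <;> simp [h]

theorem lstep_callDown2 (d : Δ) {p q : κ → List (Sy Δ Γ)}
    (hp : ∀ x, ∃ l, p x = (W.popW d x).map sym ++ l ∧ q x = (W.pushW d x).map sym ++ l) :
    LStep W C ((false, 1), mkReg a (blank :: b) (dig d :: lo) (dig d :: hi) p)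
    ((false, 0), mkReg b (mk 1 :: blank :: a) (elo :: lo) (ehi :: hi)
      fun x => sym W.bot :: q x) := by
  choose l h1 h2 using hp
  exact LStep.mk (callDown2 d) (core := mkReg a b lo hi l)
    (forall_reg rfl rfl rfl rfl h1)
    (forall_reg rfl rfl rfl rfl fun x => congrArg (List.cons (sym W.bot)) (h2 x)) nofun

theorem lstep_callDown4 : LStep W C ((false, 3), mkReg a (blank :: b) lo hi k)
    ((false, 0), mkReg b (mk 3 :: blank :: a) (elo :: lo) (ehi :: hi)
      fun x => sym W.bot :: k x) :=
  LStep.mk callDown4 (core := mkReg a b lo hi k)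
    (forall_reg rfl rfl rfl rfl fun _ => rfl) (forall_reg rfl rfl rfl rfl fun _ => rfl) nofun

theorem lstep_turn2 (j : Fin 4) : LStep W C ((false, 1), mkReg a (mk j :: b) lo hi k)
    ((false, 2), mkReg a (mk j :: b) lo hi k) :=
  LStep.mk (turn2 j) (core := mkReg a b lo hi k)
    (forall_reg rfl rfl rfl rfl fun _ => rfl) (forall_reg rfl rfl rfl rfl fun _ => rfl) nofun

theorem lstep_ret (j : Fin 4) : LStep W C ((false, 3), mkReg a (mk j :: b) (elo :: lo) (ehi :: hi)
      fun x => sym W.bot :: k x)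
    ((true, j), mkReg b a lo hi k) :=
  LStep.mk (ret j) (core := mkReg a b lo hi k)
    (forall_reg rfl rfl rfl rfl fun _ => rfl) (forall_reg rfl rfl rfl rfl fun _ => rfl) nofun

theorem lstep_down (q : Bool) : LStep W C ((true, downP q), mkReg (blank :: a) b lo hi k)
    ((false, downP q), mkReg (blank :: a) b lo hi k) :=
  LStep.mk (down q) (core := mkReg a b lo hi k)
    (forall_reg rfl rfl rfl rfl fun _ => rfl) (forall_reg rfl rfl rfl rfl fun _ => rfl) nofun

end steps

/-- The digits `δ r, …, δ (r + s - 1)`. -/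
def seg (δ : ℕ → Δ) : ℕ → ℕ → List (Sy Δ Γ)
  | _, 0 => []
  | r, s + 1 => dig (δ r) :: seg δ (r + 1) s

/-- `t` blanks on top of a stack. -/
def blk (t : ℕ) (v : List (Sy Δ Γ)) : List (Sy Δ Γ) := List.replicate t blank ++ v

theorem blk_succ (t : ℕ) (v : List (Sy Δ Γ)) : blk (t + 1) v = blank :: blk t v := by
  simp [blk, List.replicate_succ]

/-- A call of size `t` can be executed in at least `t` steps. -/
def CanRun (W : StackMachine Δ κ Γ) (C : List (Sy Δ Γ) → List (Sy Δ Γ) → Prop) (t : ℕ) : Prop :=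
  ∀ j i ρ ρ' e e' (κs : κ → List (Sy Δ Γ)),
    LongPath (LStep W C) t
      ((false, 0), mkReg (blk t (mk j :: ρ)) (mk i :: ρ') (elo :: e) (ehi :: e')
        fun x => sym W.bot :: κs x)
      ((true, i), mkReg ρ' (blk t (mk j :: ρ)) e e' κs)

section canRun

variable {t : ℕ} (ih : ∀ s < t, CanRun W C s)

include ih

theorem phase1 (δ : ℕ → Δ) {j i ρ ρ' e e'} {κs : κ → List (Sy Δ Γ)} (r : ℕ) :
    ∀ s, r + s = t → LongPath (LStep W C) r
      ((false, 0), mkReg (blk r (mk j :: ρ)) (blk s (mk i :: ρ')) (seg δ r s ++ e)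
        (seg δ r s ++ e') κs)
      ((false, 0), mkReg (mk j :: ρ) (blk t (mk i :: ρ')) (seg δ 0 t ++ e)
        (seg δ 0 t ++ e') κs) := by
  induction r with
  | zero =>
    intro s hs
    obtain rfl : s = t := by omega
    exact .nil _
  | succ r ihr =>
    intro s hs
    rw [blk_succ]
    exact LongPath.mono (n := 1 + s + 1 + r) (by omega) <|
      (((LongPath.one (lstep_callUp (W := W) (C := C) false)).trans
      (ih s (by omega) _ _ _ _ _ _ _)).trans (LongPath.one (lstep_up1 (δ r)))).trans
      (blk_succ s _ ▸ ihr (s + 1) (by omega))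

theorem phase2 {δ : ℕ → Δ} {L : ℕ → κ → List Γ} (hL : ∀ n, W.Step (δ n) (L n) (L (n + 1)))
    {j i ρ ρ' e e'} {κs : κ → List (Sy Δ Γ)} (s : ℕ) :
    ∀ n, n + s = t → LongPath (LStep W C) 0
      ((false, 1), mkReg (blk n (mk j :: ρ)) (blk s (mk i :: ρ')) (seg δ n s ++ e)
        (seg δ n s ++ e') fun x => (L n x).map sym ++ sym W.bot :: κs x)
      ((false, 1), mkReg (blk t (mk j :: ρ)) (mk i :: ρ') e e'
        fun x => (L t x).map sym ++ sym W.bot :: κs x) := by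
  induction s with
  | zero =>
    intro n hn
    obtain rfl : n = t := by omega
    exact .nil _
  | succ s ihs =>
    intro n hn
    rw [blk_succ]
    have h0 : ∀ x, ∃ l, (L n x).map sym ++ sym W.bot :: κs x = (W.popW (δ n) x).map sym ++ l ∧
        (L (n + 1) x).map sym ++ sym W.bot :: κs x = (W.pushW (δ n) x).map sym ++ l := by
      intro x
      obtain ⟨l, h1, h2⟩ := hL n x
      refine ⟨l.map (sym (Δ := Δ)) ++ κs x, ?_, ?_⟩
      · have := congrArg (fun v => v.map (sym (Δ := Δ)) ++ κs x) h1
        simpa using this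
      · have := congrArg (fun v => v.map (sym (Δ := Δ)) ++ κs x) h2
        simpa using this
    exact LongPath.mono (n := 1 + s + 1 + 0) (by omega) <|
      (((LongPath.one (lstep_callDown2 (W := W) (C := C) (δ n) h0)).trans
      (ih s (by omega) _ _ _ _ _ _ _)).trans (LongPath.one (lstep_down false))).trans
      (blk_succ n _ ▸ ihs (n + 1) (by omega))

theorem phase3 {j i ρ ρ' e e'} {κs : κ → List (Sy Δ Γ)} (r : ℕ) :
    ∀ s, r + s = t → ∀ M : κ → List Γ, (∀ x, (M x).length ≤ r ∧ W.bot ∉ M x) →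
    LongPath (LStep W C) 0
      ((false, 2), mkReg (blk r (mk j :: ρ)) (blk s (mk i :: ρ')) e e'
        fun x => (M x).map sym ++ κs x)
      ((false, 2), mkReg (mk j :: ρ) (blk t (mk i :: ρ')) e e' κs) := by
  induction r with
  | zero =>
    intro s hs M hM
    obtain rfl : s = t := by omega
    obtain rfl : M = fun _ => [] := funext fun x => by simpa using (hM x).1
    exact .nil _
  | succ r ihr =>
    intro s hs M hM
    rw [blk_succ]
    exact LongPath.mono (n := 1 + s + 1 + 0) (by omega) <|
      (((LongPath.one (lstep_callUp (W := W) (C := C) true)).trans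
      (ih s (by omega) _ _ _ _ _ _ _)).trans (LongPath.one (lstep_up3 M fun x => (hM x).2))).trans
      (blk_succ s _ ▸ ihr (s + 1) (by omega) (fun x => (M x).tail) fun x =>
        ⟨by have := (hM x).1; simp; omega, fun h => (hM x).2 (List.mem_of_mem_tail h)⟩)

theorem phase4 {j i ρ ρ' e e'} {κs : κ → List (Sy Δ Γ)} (s : ℕ) :
    ∀ n, n + s = t → LongPath (LStep W C) 0
      ((false, 3), mkReg (blk n (mk j :: ρ)) (blk s (mk i :: ρ')) e e' κs)
      ((false, 3), mkReg (blk t (mk j :: ρ)) (mk i :: ρ') e e' κs) := by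
  induction s with
  | zero =>
    intro n hn
    obtain rfl : n = t := by omega
    exact .nil _
  | succ s ihs =>
    intro n hn
    rw [blk_succ]
    exact LongPath.mono (n := 1 + s + 1 + 0) (by omega) <|
      (((LongPath.one (lstep_callDown4 (W := W) (C := C))).trans
      (ih s (by omega) _ _ _ _ _ _ _)).trans (LongPath.one (lstep_down true))).trans
      (blk_succ n _ ▸ ihs (n + 1) (by omega))

end canRun

theorem canRun {δ : ℕ → Δ} {L : ℕ → κ → List Γ} (h0 : L 0 = fun _ => [])
    (hL : ∀ n, W.Step (δ n) (L n) (L (n + 1))) (t : ℕ)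
    (hC : ∀ s ≤ t, ∀ e e', C (seg δ 0 s ++ elo :: e) (seg δ 0 s ++ ehi :: e')) :
    CanRun W C t := by
  induction t using Nat.strong_induction_on with
  | _ t ih =>
  replace ih : ∀ s < t, CanRun W C s := fun s hs =>
    ih s hs fun s' hs' => hC s' (by omega)
  intro j i ρ ρ' e e' κs
  have hb : ∀ n x, (L n x).length ≤ n ∧ W.bot ∉ L n x := by
    intro n
    induction n with
    | zero => simp [h0]
    | succ n ihn => exact (hL n).bound ihn
  have p1 := phase1 ih δ (j := j) (i := i) (ρ := ρ) (ρ' := ρ') (e := elo :: e) (e' := ehi :: e')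
    (κs := fun x => sym W.bot :: κs x) t 0 rfl
  have p2 := phase2 ih hL (j := j) (i := i) (ρ := ρ) (ρ' := ρ') (e := elo :: e) (e' := ehi :: e')
    (κs := κs) t 0 (zero_add t)
  rw [h0] at p2
  have p3 := phase3 ih (j := j) (i := i) (ρ := ρ) (ρ' := ρ') (e := elo :: e) (e' := ehi :: e')
    (κs := fun x => sym W.bot :: κs x) t 0 rfl (L t) (hb t)
  have p4 := phase4 ih (j := j) (i := i) (ρ := ρ) (ρ' := ρ') (e := elo :: e) (e' := ehi :: e')
    (κs := fun x => sym W.bot :: κs x) t 0 (zero_add t)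
  exact ((((((p1.trans (.one (lstep_turnUp_false j (hC t le_rfl _ _)))).trans p2).trans
    (.one (lstep_turn2 i))).trans p3).trans (.one (lstep_turnUp_true j))).trans p4).trans
    (.one (lstep_ret i)) |>.mono (by omega)

end Lab

/-! ### Piecewise linear systems -/

theorem Ultrafilter.exists_eventually_eq {α I : Type*} [Finite I] (U : Ultrafilter α) (f : α → I) :
    ∃ i, ∀ᶠ a in U, f a = i := by
  cases nonempty_fintype I
  have h : ⋃ i ∈ (Set.univ : Set I), {a | f a = i} ∈ U := by
    refine Filter.mem_of_superset Filter.univ_mem fun a _ => by simp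
  obtain ⟨i, -, hi⟩ := (Ultrafilter.finite_biUnion_mem_iff Set.finite_univ).1 h
  exact ⟨i, hi⟩

theorem Ultrafilter.exists_tendsto_Icc {α : Type*} (U : Ultrafilter α) {f : α → ℝ} {a b : ℝ}
    (hf : ∀ᶠ n in U, f n ∈ Set.Icc a b) : ∃ r ∈ Set.Icc a b, Filter.Tendsto f U (nhds r) := by
  obtain ⟨r, h1, h2⟩ := isCompact_Icc.ultrafilter_le_nhds (U.map f) (Filter.le_principal_iff.2 hf)
  exact ⟨r, h1, h2⟩

/-- A finite family of systems of linear equations between successive points, with integer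
coefficients. -/
structure LinSys (I C E : Type) where
  allowed : I → I → Prop
  al : I → E → C → ℤ
  be : I → E → C → ℤ
  ga : I → E → ℤ

namespace LinSys

variable {I C E : Type} [Fintype C] (S : LinSys I C E)

/-- One step of a linear system. -/
def Step (i i' : I) (x x' : C → ℝ) : Prop :=
  S.allowed i i' ∧ ∀ e, ∑ c, (S.al i e c : ℝ) * x c + ∑ c, (S.be i e c : ℝ) * x' c + S.ga i e = 0

/-- Orbits in the unit cube. -/
def IsOrbit {T : Type} [Add T] [One T] (i : T → I) (x : T → C → ℝ) : Prop :=
  (∀ n c, x n c ∈ Set.Icc (0 : ℝ) 1) ∧ ∀ n, S.Step (i n) (i (n + 1)) (x n) (x (n + 1))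

theorem exists_isOrbit_int [Finite I]
    (h : ∀ N : ℕ, ∃ (i : ℕ → I) (x : ℕ → C → ℝ), (∀ n c, x n c ∈ Set.Icc (0 : ℝ) 1) ∧
      ∀ n < N, S.Step (i n) (i (n + 1)) (x n) (x (n + 1))) :
    ∃ (i : ℤ → I) (x : ℤ → C → ℝ), S.IsOrbit i x := by
  choose i x hx hs using h
  let U : Ultrafilter ℕ := Filter.hyperfilter ℕ
  have hU : ∀ m : ℕ, ∀ᶠ N in (U : Filter ℕ), m ≤ N := fun m =>
    Nat.hyperfilter_le_atTop (Filter.eventually_ge_atTop m)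
  choose i' hi' using fun n : ℤ => Ultrafilter.exists_eventually_eq U
    fun N => i (2 * N) (n + N).toNat
  choose x' hx' hx'' using fun (n : ℤ) (c : C) => Ultrafilter.exists_tendsto_Icc U
    (f := fun N => x (2 * N) (n + N).toNat c) (Filter.Eventually.of_forall fun N => hx _ _ _)
  refine ⟨i', x', hx', fun n => ?_⟩
  have key : ∀ᶠ N in (U : Filter ℕ), S.Step (i' n) (i' (n + 1)) (x (2 * N) (n + N).toNat)
      (x (2 * N) (n + 1 + N).toNat) := by
    filter_upwards [hi' n, hi' (n + 1), hU (n.natAbs + 1)] with N h1 h2 h3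
    have h4 := hs (2 * N) (n + N).toNat (by omega)
    rw [show (n + N).toNat + 1 = (n + 1 + N).toNat by omega] at h4
    rwa [h1, h2] at h4
  obtain ⟨N, hN⟩ := key.exists
  refine ⟨hN.1, fun e => ?_⟩
  have h1 : Filter.Tendsto (fun N : ℕ =>
      ∑ c, (S.al (i' n) e c : ℝ) * x (2 * N) (n + N).toNat c +
        ∑ c, (S.be (i' n) e c : ℝ) * x (2 * N) (n + 1 + N).toNat c + S.ga (i' n) e) U
      (nhds (∑ c, (S.al (i' n) e c : ℝ) * x' n c +
        ∑ c, (S.be (i' n) e c : ℝ) * x' (n + 1) c + S.ga (i' n) e)) :=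
    ((tendsto_finsetSum _ fun c _ => (hx'' n c).const_mul _).add
      (tendsto_finsetSum _ fun c _ => (hx'' (n + 1) c).const_mul _)).add_const _
  refine tendsto_nhds_unique h1 (tendsto_const_nhds.congr' ?_)
  filter_upwards [key] with N hN
  exact (hN.2 e).symm

end LinSys

/-! ### Numerical stacks -/

section Numerical

variable {Δ κ Γ : Type}

theorem Sy.finite [Finite Δ] [Finite Γ] : Finite (Sy Δ Γ) := by
  refine Finite.of_surjective
    (Sum.elim (Sum.elim Sy.mk Sy.dig) (Sum.elim Sy.sym ![Sy.blank, Sy.elo, Sy.ehi]) :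
      (Fin 4 ⊕ Δ) ⊕ (Γ ⊕ Fin 3) → Sy Δ Γ) ?_
  rintro (_ | i | d | _ | _ | s)
  exacts [⟨.inr (.inr 0), rfl⟩, ⟨.inl (.inl i), rfl⟩, ⟨.inl (.inr d), rfl⟩, ⟨.inr (.inr 1), rfl⟩,
    ⟨.inr (.inr 2), rfl⟩, ⟨.inr (.inl s), rfl⟩]

theorem Lab.finite [Finite Δ] [Finite κ] [Finite Γ] (W : StackMachine Δ κ Γ) :
    Finite (Lab W) := by
  refine Finite.of_surjective
    (Sum.elim (Sum.elim (Sum.elim callUp down) fun p => turnUp p.1 p.2)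
      (Sum.elim (Sum.elim (Sum.elim up1 callDown2) (Sum.elim up3 fun _ => callDown4))
        (Sum.elim turn2 ret)) :
      ((Bool ⊕ Bool) ⊕ Bool × Fin 4) ⊕
      (((Δ ⊕ Δ) ⊕ ((κ → Option {s // s ≠ W.bot}) ⊕ Unit)) ⊕ (Fin 4 ⊕ Fin 4)) → Lab W) ?_
  rintro (q | ⟨q, j⟩ | d | cl | d | _ | j | j | q)
  exacts [⟨.inl (.inl (.inl q)), rfl⟩, ⟨.inl (.inr (q, j)), rfl⟩,
    ⟨.inr (.inl (.inl (.inl d))), rfl⟩, ⟨.inr (.inl (.inr (.inl cl))), rfl⟩,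
    ⟨.inr (.inl (.inl (.inr d))), rfl⟩, ⟨.inr (.inl (.inr (.inr ()))), rfl⟩,
    ⟨.inr (.inr (.inl j)), rfl⟩, ⟨.inr (.inr (.inr j)), rfl⟩, ⟨.inl (.inl (.inr q)), rfl⟩]

namespace NumStack

variable {M : ℕ} (e : Sy Δ Γ ≃ Fin M)

/-- Odd codes of the stack symbols. -/
def code : Sy Δ Γ → ℕ
  | .elo => 1
  | .ehi => 2 * M + 3
  | s => 2 * e s + 3

theorem code_dig (d : Δ) : 1 < code e (.dig d) ∧ code e (.dig d) < 2 * M + 3 := by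
  have := (e (.dig d)).2
  simp only [code]
  omega

theorem code_odd (s : Sy Δ Γ) : code e s % 2 = 1 := by
  cases s <;> simp only [code] <;> omega

theorem code_le (s : Sy Δ Γ) : code e s ≤ 2 * M + 3 := by
  have := (e s).2
  cases s <;> simp only [code] <;> omega

theorem code_inj {s s' : Sy Δ Γ} (h : code e s = code e s') : s = s' := by
  have h1 := (e s).2
  have h2 := (e s').2
  have key : (e s : ℕ) = e s' → s = s' := fun h => e.injective (Fin.ext h)
  cases s <;> cases s' <;> simp only [code] at h <;> first | rfl | omega | exact key (by omega)

variable (M) in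
/-- The base of the number system. -/
abbrev base : ℕ := 2 * M + 5

theorem base_pos : (0 : ℝ) < base M := by
  simp only [base]; positivity

/-- Pushing a digit to a number. -/
noncomputable def push (s : Sy Δ Γ) (r : Set.Icc (0 : ℝ) 1) : Set.Icc (0 : ℝ) 1 :=
  ⟨(code e s + r) / base M, by have := r.2.1; positivity, by
    rw [div_le_one base_pos]
    have h1 := r.2.2
    have h2 : (code e s : ℝ) ≤ ((2 * M + 3 : ℕ) : ℝ) := by exact_mod_cast code_le e s
    simp only [base]
    push_cast at h2 ⊢
    linarith⟩

theorem coe_push (s : Sy Δ Γ) (r : Set.Icc (0 : ℝ) 1) :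
    (push e s r : ℝ) = (code e s + r) / base M := rfl

theorem push_le {s : Sy Δ Γ} {v w : Set.Icc (0 : ℝ) 1} :
    push e s v ≤ push e s w ↔ v ≤ w := by
  rw [← Subtype.coe_le_coe, coe_push, coe_push, div_le_div_iff_of_pos_right base_pos,
    ← Subtype.coe_le_coe, add_le_add_iff_left]

theorem push_le_of_code_lt {s s' : Sy Δ Γ} (h : code e s < code e s')
    (v w : Set.Icc (0 : ℝ) 1) : push e s v ≤ push e s' w := by
  rw [← Subtype.coe_le_coe, coe_push, coe_push, div_le_div_iff_of_pos_right base_pos]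
  have h1 : (code e s : ℝ) + 1 ≤ code e s' := by exact_mod_cast h
  linarith [v.2.2, w.2.1]

theorem push_inj (a b : Sy Δ Γ) (v w : Set.Icc (0 : ℝ) 1) (h : push e a v = push e b w) :
    a = b ∧ v = w := by
  have h' := congrArg (fun x : Set.Icc (0 : ℝ) 1 => (x : ℝ)) h
  simp only [coe_push] at h'
  rw [div_left_inj' base_pos.ne'] at h'
  have key : code e a = code e b := by
    have ha := code_odd e a
    have hb := code_odd e b
    by_contra hne
    rcases Nat.lt_or_gt_of_ne hne with hl | hl
    · have h1 : (code e a : ℝ) + 2 ≤ code e b := by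
        exact_mod_cast (show code e a + 2 ≤ code e b by omega)
      linarith [v.2.2, w.2.1]
    · have h1 : (code e b : ℝ) + 2 ≤ code e a := by
        exact_mod_cast (show code e b + 2 ≤ code e a by omega)
      linarith [w.2.2, v.2.1]
  refine ⟨code_inj e key, Subtype.ext ?_⟩
  rw [key] at h'
  linarith

theorem between (w : List (Sy Δ Γ)) : ∀ {z x y : Set.Icc (0 : ℝ) 1},
    w.foldr (push e) x ≤ z → z ≤ w.foldr (push e) y → ∃ x', z = w.foldr (push e) x' := by
  induction w with
  | nil => exact fun {z _ _} _ _ => ⟨z, rfl⟩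
  | cons s w ih =>
    intro z x y h1 h2
    simp only [List.foldr_cons] at h1 h2
    have h1' := (div_le_iff₀ base_pos).1 (Subtype.coe_le_coe.2 h1)
    have h2' := (le_div_iff₀ base_pos).1 (Subtype.coe_le_coe.2 h2)
    have hx := (w.foldr (push e) x).2.1
    have hy := (w.foldr (push e) y).2.2
    let z' : Set.Icc (0 : ℝ) 1 := ⟨z * base M - code e s, by linarith, by linarith⟩
    have hz : z = push e s z' := by
      apply Subtype.ext
      rw [coe_push, eq_div_iff base_pos.ne']
      simp [z']
    rw [hz] at h1 h2
    obtain ⟨x', hx'⟩ := ih ((push_le e).1 h1) ((push_le e).1 h2)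
    exact ⟨x', by rw [hz, hx']; rfl⟩

/-- The integer represented by a word. -/
def wcode : List (Sy Δ Γ) → ℤ
  | [] => 0
  | s :: p => code e s * (base M : ℤ) ^ p.length + wcode p

theorem eq_foldr_iff (p : List (Sy Δ Γ)) (core r : Set.Icc (0 : ℝ) 1) :
    r = p.foldr (push e) core ↔ (base M : ℝ) ^ p.length * r - core - wcode e p = 0 := by
  have key : ∀ p : List (Sy Δ Γ), (base M : ℝ) ^ p.length *
      ((p.foldr (push e) core : Set.Icc (0 : ℝ) 1) : ℝ) - core
      - wcode e p = 0 := by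
    intro p
    induction p with
    | nil => simp [wcode]
    | cons s p ih =>
      have hb := (base_pos (M := M)).ne'
      simp only [List.length_cons, List.foldr_cons, coe_push, wcode, pow_succ]
      push_cast at hb ih ⊢
      field_simp
      linarith
  constructor
  · rintro rfl
    exact key p
  · intro h
    apply Subtype.ext
    have hb := pow_pos (base_pos (M := M)) p.length
    have := key p
    nlinarith

/-- The number represented by a stack. -/
noncomputable def val (l : List (Sy Δ Γ)) : Set.Icc (0 : ℝ) 1 :=
  l.foldr (push e) ⟨0, le_rfl, zero_le_one⟩

theorem val_append (p l : List (Sy Δ Γ)) : val e (p ++ l) = p.foldr (push e) (val e l) :=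
  List.foldr_append

theorem val_seg_le (δ : ℕ → Δ) (l l' : List (Sy Δ Γ)) (s : ℕ) : ∀ r t, s ≤ t →
    val e (Lab.seg δ r s ++ .elo :: l) ≤ val e (Lab.seg δ r (t + 1)) ∧
    val e (Lab.seg δ r (t + 1)) ≤ val e (Lab.seg δ r s ++ .ehi :: l') := by
  induction s with
  | zero =>
    intro r t _
    have := code_dig e (δ r)
    exact ⟨push_le_of_code_lt e (s := .elo) (s' := .dig (δ r)) this.1 _ _,
      push_le_of_code_lt e (s := .dig (δ r)) (s' := .ehi) this.2 _ _⟩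
  | succ s ih =>
    intro r t ht
    obtain ⟨t, rfl⟩ : ∃ t', t = t' + 1 := ⟨t - 1, by omega⟩
    obtain ⟨h1, h2⟩ := ih (r + 1) t (by omega)
    exact ⟨(push_le e).2 h1, (push_le e).2 h2⟩

end NumStack

namespace Lab

variable (W : StackMachine Δ κ Γ) {M : ℕ} (e : Sy Δ Γ ≃ Fin M)

open NumStack

/-- Coordinates (and equations) of the linear system: the registers, what remains of the
registers after popping, and the oracle with its two comparison slacks. -/
abbrev Coord (κ : Type) := Reg κ ⊕ Reg κ ⊕ Fin 3

abbrev cReg (j : Reg κ) : Coord κ := .inl j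
abbrev cCore (j : Reg κ) : Coord κ := .inr (.inl j)
abbrev cAux {κ : Type} (i : Fin 3) : Coord κ := .inr (.inr i)

open Classical in
/-- The recursive system as a linear system. -/
noncomputable def linSys : LinSys (Lab W) (Coord κ) (Coord κ) where
  allowed l l' := l.tgt = l'.src
  al l
    | .inl j => Pi.single (cReg j) ((base M : ℤ) ^ (l.popR j).length) - Pi.single (cCore j) 1
    | .inr (.inl j) => - Pi.single (cCore j) 1
    | .inr (.inr i) =>
      if i = 0 then - Pi.single (cAux 0) 1 else
      if l.isCmp then
        if i = 1 then Pi.single (cAux 0) 1 - Pi.single (cReg rLo) 1 - Pi.single (cAux 1) 1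
        else Pi.single (cReg rHi) 1 - Pi.single (cAux 0) 1 - Pi.single (cAux 2) 1
      else 0
  be l
    | .inl _ => 0
    | .inr (.inl j) => Pi.single (cReg (l.perm j)) ((base M : ℤ) ^ (l.pushR j).length)
    | .inr (.inr i) => if i = 0 then Pi.single (cAux 0) 1 else 0
  ga l
    | .inl j => - wcode e (l.popR j)
    | .inr (.inl j) => - wcode e (l.pushR j)
    | .inr (.inr _) => 0

variable {W} [Fintype κ]

theorem sum_single (c : Coord κ) (v : ℤ) (x : Coord κ → ℝ) [DecidableEq (Coord κ)] :
    ∑ c', ((Pi.single c v : Coord κ → ℤ) c' : ℝ) * x c' = v * x c := by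
  rw [Finset.sum_eq_single c]
  · simp
  · intro b _ hb
    simp [Pi.single_eq_of_ne hb]
  · simp

theorem linSys_step {l l' : Lab W} {x x' : Coord κ → ℝ} : (linSys W e).Step l l' x x' ↔
    l.tgt = l'.src ∧
    (∀ j, (base M : ℝ) ^ (l.popR j).length * x (cReg j) - x (cCore j) - wcode e (l.popR j) = 0) ∧
    (∀ j, (base M : ℝ) ^ (l.pushR j).length * x' (cReg (l.perm j)) - x (cCore j)
      - wcode e (l.pushR j) = 0) ∧
    x' (cAux 0) = x (cAux 0) ∧
    (l.isCmp = true → x (cAux 0) - x (cReg rLo) - x (cAux 1) = 0 ∧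
      x (cReg rHi) - x (cAux 0) - x (cAux 2) = 0) := by
  classical
  have hs : ∀ (c : Coord κ) (v : ℤ) (x : Coord κ → ℝ) (h : DecidableEq (Coord κ)),
    ∑ c', ((Pi.single c v : Coord κ → ℤ) c' : ℝ) * x c' = v * x c :=
    fun c v x h => sum_single c v x
  simp only [LinSys.Step]
  refine and_congr Iff.rfl ⟨fun h => ⟨fun j => ?_, fun j => ?_, ?_, fun hc => ⟨?_, ?_⟩⟩, ?_⟩
  · have := h (.inl j)
    simp only [linSys, Pi.sub_apply, Int.cast_sub, sub_mul, Finset.sum_sub_distrib, hs] at this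
    push_cast at this ⊢
    simp at this
    linarith
  · have := h (.inr (.inl j))
    simp only [linSys, Pi.neg_apply, Int.cast_neg, neg_mul, Finset.sum_neg_distrib, hs] at this
    push_cast at this ⊢
    linarith
  · have := h (.inr (.inr 0))
    simp only [linSys, if_pos, Pi.neg_apply, Int.cast_neg, neg_mul, Finset.sum_neg_distrib, hs] at this
    push_cast at this
    linarith
  · have := h (.inr (.inr 1))
    simp [linSys, hc, sub_mul, Finset.sum_sub_distrib, hs] at this
    linarith
  · have := h (.inr (.inr 2))
    simp [linSys, hc, sub_mul, Finset.sum_sub_distrib, hs] at this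
    linarith
  · rintro ⟨h1, h2, h3, h4⟩ (j | j | i)
    · have := h1 j
      simp only [linSys, Pi.sub_apply, Int.cast_sub, sub_mul, Finset.sum_sub_distrib, hs]
      push_cast at this ⊢
      simp
      linarith
    · have := h2 j
      simp only [linSys, Pi.neg_apply, Int.cast_neg, neg_mul, Finset.sum_neg_distrib, hs]
      push_cast at this ⊢
      linarith
    · fin_cases i
      · simp only [linSys, Fin.zero_eta, if_pos, Pi.neg_apply, Int.cast_neg, neg_mul,
          Finset.sum_neg_distrib, hs]
        push_cast
        linarith
      · by_cases hc : l.isCmp = true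
        · have := (h4 hc).1
          simp [linSys, hc, sub_mul, Finset.sum_sub_distrib, hs]
          linarith
        · simp [linSys, hc]
      · by_cases hc : l.isCmp = true
        · have := (h4 hc).2
          simp [linSys, hc, sub_mul, Finset.sum_sub_distrib, hs]
          linarith
        · simp [linSys, hc]

theorem exists_computable_run_of_isOrbit [Finite Δ] {i : ℕ → Lab W} {x : ℕ → Coord κ → ℝ}
    (h : (linSys W e).IsOrbit i x) {N : ℕ} (f : Lab W ≃ Fin N)
    (hf : Computable fun n => f (i n)) :
    ∃ δ : ℕ → Δ, (∀ n, W.Runs ((List.range n).map δ)) ∧ ∀ g : Δ → ℕ, Computable fun n => g (δ n) := by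
  have hz : ∀ n, x n (cAux 0) = x 0 (cAux 0) := by
    intro n
    induction n with
    | zero => rfl
    | succ n ih => rw [((linSys_step e).1 (h.2 n)).2.2.2.1, ih]
  let v : ℕ → Coord κ → Set.Icc (0 : ℝ) 1 := fun n c => ⟨x n c, h.1 n c⟩
  let z := v 0 (cAux 0)
  let o : Orbit W (push e) fun lo hi => lo ≤ z ∧ z ≤ hi :=
    { lab := i
      cfg := fun n => ((i n).src, fun j => v n (cReg j))
      step := fun n => by
        obtain ⟨h1, h2, h3, h4, h5⟩ := (linSys_step e).1 (h.2 n)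
        refine ⟨rfl, h1.symm, ⟨fun j => v n (cCore j), fun j => (eq_foldr_iff e _ _ _).2 (h2 j),
          fun j => (eq_foldr_iff e _ _ _).2 (h3 j)⟩, fun hc => ?_⟩
        obtain ⟨h6, h7⟩ := h5 hc
        have h8 := (h.1 n (cAux 1)).1
        have h9 := (h.1 n (cAux 2)).1
        rw [hz] at h6 h7
        constructor
        · exact Subtype.coe_le_coe.1 (show x n (cReg rLo) ≤ x 0 (cAux 0) by linarith)
        · exact Subtype.coe_le_coe.1 (show x 0 (cAux 0) ≤ x n (cReg rHi) by linarith) }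
  refine o.exists_computable_run (push_inj e) (z := z) ?_ f hf
  rintro lo hi ⟨h1, h2⟩ w x' y' rfl rfl
  exact between e _ h1 h2

theorem exists_isOrbit [Finite Δ] [Finite Γ] {δ : ℕ → Δ} {L : ℕ → κ → List Γ}
    (h0 : L 0 = fun _ => []) (hL : ∀ n, W.Step (δ n) (L n) (L (n + 1))) :
    ∃ (i : ℤ → Lab W) (x : ℤ → Coord κ → ℝ), (linSys W e).IsOrbit i x := by
  have := Lab.finite W
  refine LinSys.exists_isOrbit_int _ fun N => ?_
  let z := val e (seg δ 0 (N + 1))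
  have hrun := canRun (C := fun lo hi => val e lo ≤ z ∧ z ≤ val e hi) h0 hL N
    fun s hs l l' => val_seg_le e δ l l' s 0 N hs
  obtain ⟨s, hs⟩ := (hrun 0 0 [] [] [] [] fun _ => []).exists_seq
  have hs' : ∀ n, ∃ l : Lab W, n < N → l.Step List.cons (fun lo hi => val e lo ≤ z ∧ z ≤ val e hi)
      (s n) (s (n + 1)) := by
    intro n
    by_cases hn : n < N
    · exact (hs n hn).imp fun l hl _ => hl
    · exact ⟨.callDown4, fun h => absurd h hn⟩
  choose l hl using hs'
  have hcore : ∀ n, ∃ core : Reg κ → List (Sy Δ Γ), n < N →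
      (∀ j, (s n).2 j = (l n).popR j ++ core j) ∧
      ∀ j, (s (n + 1)).2 ((l n).perm j) = (l n).pushR j ++ core j := by
    intro n
    by_cases hn : n < N
    · obtain ⟨-, -, ⟨core, h1, h2⟩, -⟩ := hl n hn
      simp only [foldr_cons_append] at h1 h2
      exact ⟨core, fun _ => ⟨h1, h2⟩⟩
    · exact ⟨fun _ => [], fun h => absurd h hn⟩
  choose core hcore using hcore
  have hN : ∃ l0 : ℕ → Lab W, (∀ n < N, l0 n = l n) ∧ ∀ n < N, (l0 n).tgt = (l0 (n + 1)).src := by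
    have hex : ∀ c : Ctl, ∃ l : Lab W, l.src = c := by
      rintro ⟨b, c⟩
      cases b <;> fin_cases c
      exacts [⟨callUp false, rfl⟩, ⟨turn2 0, rfl⟩, ⟨callUp true, rfl⟩, ⟨callDown4, rfl⟩,
        (isEmpty_or_nonempty Δ).elim (fun h => (h.false (δ 0)).elim) fun ⟨d⟩ => ⟨up1 d, rfl⟩,
        ⟨down false, rfl⟩, ⟨up3 fun _ => none, rfl⟩, ⟨down true, rfl⟩]
    choose g hg using hex
    refine ⟨fun n => if n < N then l n else g (s n).1, fun n hn => if_pos hn, fun n hn => ?_⟩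
    have h1 := (hl n hn).2.1
    simp only [if_pos hn]
    split_ifs with h2
    · rw [← h1, (hl (n + 1) h2).1]
    · rw [← h1, hg]
  obtain ⟨l0, hl0, hl1⟩ := hN
  let sl : Bool → Set.Icc (0 : ℝ) 1 → Set.Icc (0 : ℝ) 1 → ℝ := fun b u v => if b then max 0 (v - u) else 0
  have hsl : ∀ b u v, sl b u v ∈ Set.Icc (0 : ℝ) 1 := by
    intro b u v
    cases b
    · simp [sl]
    · simp only [sl, if_true]
      exact ⟨le_max_left _ _, max_le zero_le_one (by linarith [u.2.1, v.2.2])⟩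
  refine ⟨l0, fun n => Sum.elim (fun j => val e ((s n).2 j)) (Sum.elim (fun j => val e (core n j))
    ![z, sl (l n).isCmp (val e ((s n).2 rLo)) z, sl (l n).isCmp z (val e ((s n).2 rHi))]), ?_, ?_⟩
  · rintro n (j | j | i)
    · exact (val e _).2
    · exact (val e _).2
    · fin_cases i
      · exact z.2
      · exact hsl _ _ _
      · exact hsl _ _ _
  · intro n hn
    rw [linSys_step]
    refine ⟨hl1 n hn, fun j => ?_, fun j => ?_, rfl, fun hc => ?_⟩
    · rw [hl0 n hn]
      refine (eq_foldr_iff e _ _ _).1 ?_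
      rw [← val_append, (hcore n hn).1]
    · rw [hl0 n hn]
      refine (eq_foldr_iff e _ _ _).1 ?_
      rw [← val_append, (hcore n hn).2]
    · rw [hl0 n hn] at hc
      obtain ⟨h1, h2⟩ := (hl n hn).2.2.2 hc
      have h1' : (val e ((s n).2 rLo) : ℝ) ≤ z := h1
      have h2' : (z : ℝ) ≤ val e ((s n).2 rHi) := h2
      simp [sl, hc, max_eq_right (sub_nonneg.2 h1'), max_eq_right (sub_nonneg.2 h2')]

end Lab

end Numerical

/-! ### Carpets: linear systems on the hyperbolic grid -/

/-- A labelling of a hyperbolic grid (`D` descends to the first child, `R` moves right) whose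
averages along rows evolve according to a linear system. -/
structure Carpet {I C E : Type} [Fintype C] (S : LinSys I C E) (H : Type*) where
  R : H → H
  D : H → H
  comm : ∀ v, D (R v) = R (R (D v))
  lab : H → I
  bit : H → C → ℤ
  carry : H → E → ℤ
  bound : ℤ
  bit_mem : ∀ v c, bit v c ∈ Set.Icc 0 1
  carry_mem : ∀ v e, carry v e ∈ Set.Icc (-bound) bound
  lab_R : ∀ v, lab (R v) = lab v
  allowed : ∀ v, S.allowed (lab v) (lab (D v))
  eqn : ∀ v e, 2 * ∑ c, S.al (lab v) e c * bit v c
    + ∑ c, S.be (lab v) e c * (bit (D v) c + bit (R (D v)) c) + 2 * S.ga (lab v) e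
    = carry (R v) e - carry v e

namespace Carpet

variable {I C E : Type} [Fintype C] {S : LinSys I C E} {H : Type*} (T : Carpet S H)

theorem D_iterate_R (j : ℕ) (v : H) : T.D (T.R^[j] v) = T.R^[2 * j] (T.D v) := by
  induction j with
  | zero => rfl
  | succ j ih =>
    rw [Function.iterate_succ_apply', T.comm, ih, show 2 * (j + 1) = 2 * j + 1 + 1 by ring,
      Function.iterate_succ_apply', Function.iterate_succ_apply']

theorem lab_iterate_R (j : ℕ) (v : H) : T.lab (T.R^[j] v) = T.lab v := by
  induction j with
  | zero => rfl
  | succ j ih => rw [Function.iterate_succ_apply', T.lab_R, ih]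

/-- The sum of the first bits of a row. -/
def rowSum (v : H) (n : ℕ) (c : C) : ℤ := ∑ j ∈ Finset.range n, T.bit (T.R^[j] v) c

theorem rowSum_eqn (v : H) (e : E) (n : ℕ) :
    2 * ∑ c, S.al (T.lab v) e c * T.rowSum v n c
    + ∑ c, S.be (T.lab v) e c * T.rowSum (T.D v) (2 * n) c + 2 * n * S.ga (T.lab v) e
    = T.carry (T.R^[n] v) e - T.carry v e := by
  induction n with
  | zero => simp [rowSum]
  | succ n ih =>
    have h := T.eqn (T.R^[n] v) e
    rw [T.lab_iterate_R, T.D_iterate_R, ← Function.iterate_succ_apply' T.R,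
      ← Function.iterate_succ_apply' T.R] at h
    have h1 : ∀ c, T.rowSum v (n + 1) c = T.rowSum v n c + T.bit (T.R^[n] v) c := fun c =>
      Finset.sum_range_succ _ _
    have h2 : ∀ c, T.rowSum (T.D v) (2 * (n + 1)) c = T.rowSum (T.D v) (2 * n) c +
        (T.bit (T.R^[2 * n] (T.D v)) c + T.bit (T.R^[2 * n + 1] (T.D v)) c) := fun c => by
      rw [show 2 * (n + 1) = 2 * n + 1 + 1 by ring, rowSum, Finset.sum_range_succ,
        Finset.sum_range_succ, add_assoc, rowSum]
    simp only [h1, h2]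
    simp only [mul_add, Finset.sum_add_distrib] at h ⊢
    push_cast
    linarith

theorem rowSum_mem (v : H) (n : ℕ) (c : C) : T.rowSum v n c ∈ Set.Icc (0 : ℤ) n := by
  constructor
  · exact Finset.sum_nonneg fun j _ => (T.bit_mem _ _).1
  · refine (Finset.sum_le_sum fun j _ => (T.bit_mem _ _).2).trans ?_
    simp

theorem exists_isOrbit (v : H) :
    ∃ x : ℕ → C → ℝ, S.IsOrbit (fun n => T.lab (T.D^[n] v)) x := by
  let U : Ultrafilter ℕ := Filter.hyperfilter ℕ
  let a : ℕ → C → ℕ → ℝ := fun n c N =>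
    (T.rowSum (T.D^[n] v) ((N + 1) * 2 ^ n) c : ℝ) / (((N + 1) * 2 ^ n : ℕ) : ℝ)
  have ha : ∀ n c N, a n c N ∈ Set.Icc (0 : ℝ) 1 := by
    intro n c N
    obtain ⟨h1, h2⟩ := T.rowSum_mem (T.D^[n] v) ((N + 1) * 2 ^ n) c
    have h1' : (0 : ℝ) ≤ T.rowSum (T.D^[n] v) ((N + 1) * 2 ^ n) c := by exact_mod_cast h1
    have h2' : (T.rowSum (T.D^[n] v) ((N + 1) * 2 ^ n) c : ℝ) ≤ (((N + 1) * 2 ^ n : ℕ) : ℝ) := by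
      exact_mod_cast h2
    exact ⟨by positivity, div_le_one_of_le₀ h2' (Nat.cast_nonneg _)⟩
  choose x hx hx' using fun (n : ℕ) (c : C) => Ultrafilter.exists_tendsto_Icc U
    (Filter.Eventually.of_forall (ha n c))
  refine ⟨x, hx, fun n => ⟨?_, fun e => ?_⟩⟩
  · change S.allowed (T.lab (T.D^[n] v)) (T.lab (T.D^[n + 1] v))
    rw [show T.D^[n + 1] v = T.D (T.D^[n] v) from Function.iterate_succ_apply' _ _ _]
    exact T.allowed _
  have h1 : Filter.Tendsto (fun N : ℕ =>
      ∑ c, (S.al (T.lab (T.D^[n] v)) e c : ℝ) * a n c N +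
        ∑ c, (S.be (T.lab (T.D^[n] v)) e c : ℝ) * a (n + 1) c N + S.ga (T.lab (T.D^[n] v)) e) U
      (nhds (∑ c, (S.al (T.lab (T.D^[n] v)) e c : ℝ) * x n c +
        ∑ c, (S.be (T.lab (T.D^[n] v)) e c : ℝ) * x (n + 1) c + S.ga (T.lab (T.D^[n] v)) e)) :=
    ((tendsto_finsetSum _ fun c _ => (hx' n c).const_mul _).add
      (tendsto_finsetSum _ fun c _ => (hx' (n + 1) c).const_mul _)).add_const _
  have h2 : Filter.Tendsto (fun N : ℕ => (T.bound : ℝ) * (1 / ((N : ℝ) + 1))) U (nhds 0) := by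
    have := (tendsto_one_div_add_atTop_nhds_zero_nat (𝕜 := ℝ)).const_mul (T.bound : ℝ)
    rw [mul_zero] at this
    exact this.mono_left Nat.hyperfilter_le_atTop
  refine tendsto_nhds_unique h1 (squeeze_zero_norm (fun N => ?_) h2)
  set w := T.D^[n] v
  set m : ℕ := (N + 1) * 2 ^ n with hm
  have h3 := T.rowSum_eqn w e m
  have h4 : T.D^[n + 1] v = T.D w := Function.iterate_succ_apply' _ _ _
  have h5 : (N + 1) * 2 ^ (n + 1) = 2 * m := by rw [hm, pow_succ]; ring
  have hmpos : (0 : ℝ) < m := by simp only [hm]; positivity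
  have h6 : ∑ c, (S.al (T.lab w) e c : ℝ) * a n c N +
        ∑ c, (S.be (T.lab w) e c : ℝ) * a (n + 1) c N + S.ga (T.lab w) e =
      ((T.carry (T.R^[m] w) e : ℝ) - T.carry w e) / (2 * m) := by
    rw [eq_div_iff (by positivity)]
    have h3' := congrArg (fun z : ℤ => (z : ℝ)) h3
    push_cast at h3'
    rw [← h3', add_mul, add_mul, Finset.sum_mul, Finset.sum_mul, Finset.mul_sum]
    congr 1
    · congr 1
      · refine Finset.sum_congr rfl fun c _ => ?_
        simp only [a]
        rw [← hm]
        field_simp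
        rfl
      · refine Finset.sum_congr rfl fun c _ => ?_
        simp only [a]
        rw [h4, h5]
        push_cast
        field_simp
    · ring
  rw [h6, norm_div, Real.norm_eq_abs, Real.norm_eq_abs, abs_of_pos (by positivity : (0 : ℝ) < 2 * m),
    div_le_iff₀ (by positivity)]
  obtain ⟨h7, h8⟩ := T.carry_mem w e
  obtain ⟨h9, h10⟩ := T.carry_mem (T.R^[m] w) e
  have h11 : |(T.carry (T.R^[m] w) e : ℝ) - T.carry w e| ≤ 2 * T.bound := by
    rw [abs_le]
    constructor
    · exact_mod_cast (show -(2 * T.bound) ≤ T.carry (T.R^[m] w) e - T.carry w e by linarith)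
    · exact_mod_cast (show T.carry (T.R^[m] w) e - T.carry w e ≤ 2 * T.bound by linarith)
  have hb : (0 : ℝ) ≤ T.bound := by exact_mod_cast (show 0 ≤ T.bound by linarith)
  have h12 : (1 : ℝ) ≤ 1 / ((N : ℝ) + 1) * m := by
    simp only [hm]
    push_cast
    have : (1 : ℝ) ≤ 2 ^ n := one_le_pow₀ one_le_two
    field_simp
    exact this
  nlinarith

end Carpet

/-! ### Carpets from orbits -/

/-- The rounding of an orbit of a linear system to a carpet on the standard grid. -/
theorem LinSys.exists_carpet {I C E : Type} [Finite I] [Fintype C] [Finite E] {S : LinSys I C E}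
    {i : ℤ → I} {x : ℤ → C → ℝ} (h : S.IsOrbit i x) :
    ∃ T : Carpet S (ℤ × ℤ), T.R = (fun v => (v.1, v.2 + 1)) ∧ T.D = fun v => (v.1 + 1, 2 * v.2) := by
  cases nonempty_fintype I
  cases nonempty_fintype E
  have hfl : ∀ n c (m : ℤ), ⌊((m + 1 : ℤ) : ℝ) * x n c⌋ - ⌊(m : ℝ) * x n c⌋ ∈ Set.Icc (0 : ℤ) 1 := by
    intro n c m
    obtain ⟨h0, h1⟩ := h.1 n c
    push_cast
    rw [add_mul, one_mul]
    constructor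
    · exact sub_nonneg.2 (Int.floor_mono (by linarith))
    · have : ⌊(m : ℝ) * x n c + x n c⌋ ≤ ⌊(m : ℝ) * x n c + 1⌋ := Int.floor_mono (by linarith)
      rw [Int.floor_add_one] at this
      linarith
  let B : ℤ := ∑ i, ∑ e, (2 * ∑ c, |S.al i e c| + ∑ c, |S.be i e c|)
  have hB : ∀ i e, 2 * ∑ c, |S.al i e c| + ∑ c, |S.be i e c| ≤ B := by
    intro i e
    have hnn : ∀ i e, 0 ≤ 2 * ∑ c, |S.al i e c| + ∑ c, |S.be i e c| := fun i e => by positivity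
    refine (Finset.single_le_sum (f := fun e => 2 * ∑ c, |S.al i e c| + ∑ c, |S.be i e c|)
      (fun e _ => hnn i e) (Finset.mem_univ e)).trans ?_
    exact Finset.single_le_sum
      (f := fun i => ∑ e, (2 * ∑ c, |S.al i e c| + ∑ c, |S.be i e c|))
      (fun i _ => Finset.sum_nonneg fun e _ => hnn i e) (Finset.mem_univ i)
  let carry : ℤ × ℤ → E → ℤ := fun v e => 2 * ∑ c, S.al (i v.1) e c * ⌊(v.2 : ℝ) * x v.1 c⌋
    + ∑ c, S.be (i v.1) e c * ⌊((2 * v.2 : ℤ) : ℝ) * x (v.1 + 1) c⌋ + 2 * v.2 * S.ga (i v.1) e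
  refine ⟨{ R := fun v => (v.1, v.2 + 1)
            D := fun v => (v.1 + 1, 2 * v.2)
            comm := fun v => Prod.ext rfl (by ring)
            lab := fun v => i v.1
            bit := fun v c => ⌊((v.2 + 1 : ℤ) : ℝ) * x v.1 c⌋ - ⌊(v.2 : ℝ) * x v.1 c⌋
            carry := carry
            bound := B
            bit_mem := fun v c => hfl _ _ _
            carry_mem := ?_
            lab_R := fun v => rfl
            allowed := fun v => (h.2 v.1).1
            eqn := ?_ }, rfl, rfl⟩
  · intro v e
    rw [Set.mem_Icc, ← abs_le]
    refine le_trans ?_ (hB (i v.1) e)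
    have h1 : (carry v e : ℝ) = -(2 * ∑ c, (S.al (i v.1) e c : ℝ) * Int.fract ((v.2 : ℝ) * x v.1 c)
        + ∑ c, (S.be (i v.1) e c : ℝ) * Int.fract (((2 * v.2 : ℤ) : ℝ) * x (v.1 + 1) c)) := by
      have h2 := (h.2 v.1).2 e
      simp only [carry, Int.fract]
      push_cast
      simp only [mul_sub, Finset.sum_sub_distrib]
      have h3 : ∑ c, (S.al (i v.1) e c : ℝ) * ((v.2 : ℝ) * x v.1 c) =
          v.2 * ∑ c, (S.al (i v.1) e c : ℝ) * x v.1 c := by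
        rw [Finset.mul_sum]
        exact Finset.sum_congr rfl fun c _ => by ring
      have h4 : ∑ c, (S.be (i v.1) e c : ℝ) * (2 * (v.2 : ℝ) * x (v.1 + 1) c) =
          2 * v.2 * ∑ c, (S.be (i v.1) e c : ℝ) * x (v.1 + 1) c := by
        rw [Finset.mul_sum]
        exact Finset.sum_congr rfl fun c _ => by ring
      rw [h3, h4]
      linear_combination (2 * (v.2 : ℝ)) * h2
    have h2 : (|(carry v e : ℝ)|) ≤ 2 * ∑ c, |(S.al (i v.1) e c : ℝ)| + ∑ c, |(S.be (i v.1) e c : ℝ)| := by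
      rw [h1, abs_neg]
      refine (abs_add_le _ _).trans ?_
      rw [abs_mul, abs_two]
      have h5 : ∀ (a : C → ℤ) (y : C → ℝ), |∑ c, (a c : ℝ) * Int.fract (y c)| ≤ ∑ c, |(a c : ℝ)| := by
        intro a y
        refine (Finset.abs_sum_le_sum_abs _ _).trans (Finset.sum_le_sum fun c _ => ?_)
        rw [abs_mul, abs_of_nonneg (Int.fract_nonneg (y c))]
        exact mul_le_of_le_one_right (abs_nonneg _) (Int.fract_lt_one _).le
      linarith [h5 (S.al (i v.1) e) fun c => (v.2 : ℝ) * x v.1 c,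
        h5 (S.be (i v.1) e) fun c => ((2 * v.2 : ℤ) : ℝ) * x (v.1 + 1) c]
    exact_mod_cast h2
  · intro v e
    have h1 : ∀ c, ⌊((2 * v.2 + 1 : ℤ) : ℝ) * x (v.1 + 1) c⌋ - ⌊((2 * v.2 : ℤ) : ℝ) * x (v.1 + 1) c⌋
        + (⌊((2 * v.2 + 1 + 1 : ℤ) : ℝ) * x (v.1 + 1) c⌋ - ⌊((2 * v.2 + 1 : ℤ) : ℝ) * x (v.1 + 1) c⌋)
        = ⌊((2 * (v.2 + 1) : ℤ) : ℝ) * x (v.1 + 1) c⌋ - ⌊((2 * v.2 : ℤ) : ℝ) * x (v.1 + 1) c⌋ := by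
      intro c
      rw [show 2 * (v.2 + 1) = 2 * v.2 + 1 + 1 by ring]
      ring
    simp only [carry, h1, mul_sub, Finset.sum_sub_distrib]
    ring

/-! ### The hyperbolic grid in a group quasi-isometric to the hyperbolic plane -/

section Grid

variable {G : Type*} [Group G] {k : ℕ} (σ : Fin k → G)

/-- The elements represented by words of length at most `ρ`. -/
def wordBall (ρ : ℕ) : Set G := {g | ∃ w : List (Fin k), w.length ≤ ρ ∧ (w.map σ).prod = g}

variable {σ}

theorem IsSymmGen.exists_word (hσ : IsSymmGen σ) (g : G) : ∃ w : List (Fin k), (w.map σ).prod = g := by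
  have hinv : ∀ w : List (Fin k), ∃ w' : List (Fin k), (w'.map σ).prod = ((w.map σ).prod)⁻¹ := by
    intro w
    induction w with
    | nil => exact ⟨[], by simp⟩
    | cons a w ih =>
      obtain ⟨w', hw'⟩ := ih
      obtain ⟨b, hb⟩ := hσ.2 a
      exact ⟨w' ++ [b], by simp [hw', hb]⟩
  have hg : g ∈ Subgroup.closure (Set.range σ) := hσ.1 ▸ Subgroup.mem_top g
  induction hg using Subgroup.closure_induction with
  | mem x hx =>
    obtain ⟨a, rfl⟩ := hx
    exact ⟨[a], by simp⟩
  | one => exact ⟨[], by simp⟩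
  | mul x y _ _ hx hy =>
    obtain ⟨u, rfl⟩ := hx
    obtain ⟨v, rfl⟩ := hy
    exact ⟨u ++ v, by simp⟩
  | inv x _ hx =>
    obtain ⟨u, rfl⟩ := hx
    exact hinv u

theorem IsSymmGen.mem_wordBall (hσ : IsSymmGen σ) {g g' : G} {ρ : ℕ} (h : wordDist σ g g' ≤ ρ) :
    g⁻¹ * g' ∈ wordBall σ ρ := by
  have h1 : (wordNorm σ (g⁻¹ * g')) ∈ {n | ∃ w : List (Fin k), w.length = n ∧ (w.map σ).prod = g⁻¹ * g'} := by
    refine Nat.sInf_mem ?_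
    obtain ⟨w, hw⟩ := hσ.exists_word (g⁻¹ * g')
    exact ⟨_, w, rfl, hw⟩
  obtain ⟨w, hw, hw'⟩ := h1
  refine ⟨w, ?_, hw'⟩
  rw [hw]
  rw [wordDist] at h
  exact_mod_cast h

/-- The vertices of the hyperbolic grid. -/
noncomputable def gridPoint (v : ℤ × ℤ) : UpperHalfPlane :=
  ⟨⟨v.2 * (2 : ℝ) ^ (-v.1), (2 : ℝ) ^ (-v.1)⟩, by positivity⟩

theorem coe_gridPoint (v : ℤ × ℤ) :
    (gridPoint v : ℂ) = ⟨v.2 * (2 : ℝ) ^ (-v.1), (2 : ℝ) ^ (-v.1)⟩ := rfl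

theorem gridPoint_im (v : ℤ × ℤ) : (gridPoint v).im = (2 : ℝ) ^ (-v.1) := rfl

theorem dist_gridPoint_right (v : ℤ × ℤ) : dist (gridPoint v) (gridPoint (v.1, v.2 + 1)) ≤ 1 := by
  refine (UpperHalfPlane.dist_le_dist_coe_div_sqrt _ _).trans ?_
  have h : (0 : ℝ) < 2 ^ (-v.1) := by positivity
  rw [gridPoint_im, gridPoint_im, Real.sqrt_mul_self h.le, div_le_one h, coe_gridPoint, coe_gridPoint,
    Complex.dist_of_im_eq (by rfl), Real.dist_eq, abs_sub_comm]
  push_cast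
  rw [add_mul, one_mul, add_sub_cancel_left, abs_of_pos h]

theorem dist_gridPoint_down (v : ℤ × ℤ) : dist (gridPoint v) (gridPoint (v.1 + 1, 2 * v.2)) ≤ 1 := by
  refine (UpperHalfPlane.dist_le_dist_coe_div_sqrt _ _).trans ?_
  have h : (0 : ℝ) < 2 ^ (-v.1) := by positivity
  have h2 : (2 : ℝ) ^ (-(v.1 + 1)) = 2 ^ (-v.1) / 2 := by
    rw [neg_add, zpow_add₀ two_ne_zero]; norm_num; ring
  rw [gridPoint_im, gridPoint_im, coe_gridPoint, coe_gridPoint]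
  simp only [h2]
  push_cast
  rw [Complex.dist_of_re_eq (by simp; ring), Real.dist_eq]
  have h3 : (2 : ℝ) ^ (-v.1) - 2 ^ (-v.1) / 2 = 2 ^ (-v.1) / 2 := by ring
  rw [h3, abs_of_pos (by positivity), div_le_one (Real.sqrt_pos.2 (by positivity))]
  refine Real.le_sqrt_of_sq_le ?_
  nlinarith

theorem exists_dist_gridPoint_le (z : UpperHalfPlane) : ∃ v, dist z (gridPoint v) ≤ 2 := by
  obtain ⟨n, hn1, hn2⟩ := exists_mem_Ico_zpow z.im_pos (one_lt_two (α := ℝ))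
  have h : (0 : ℝ) < 2 ^ n := by positivity
  rw [zpow_add_one₀ two_ne_zero] at hn2
  refine ⟨(-n, ⌊z.re / 2 ^ n⌋), (UpperHalfPlane.dist_le_dist_coe_div_sqrt _ _).trans ?_⟩
  have h1 : (2 : ℝ) ^ n ≤ √(z.im * 2 ^ n) := Real.le_sqrt_of_sq_le (by nlinarith)
  rw [gridPoint_im]
  simp only [neg_neg]
  rw [div_le_iff₀ (h.trans_le h1)]
  have h2 : dist (z : ℂ) (gridPoint (-n, ⌊z.re / 2 ^ n⌋)) ≤ 2 ^ n + 2 ^ n := by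
    rw [dist_eq_norm]
    refine (Complex.norm_le_abs_re_add_abs_im _).trans (add_le_add ?_ ?_)
    · rw [coe_gridPoint]
      simp only [neg_neg, Complex.sub_re, UpperHalfPlane.coe_re]
      have h3 := Int.floor_le (z.re / 2 ^ n)
      have h4 := Int.lt_floor_add_one (z.re / 2 ^ n)
      rw [le_div_iff₀ h] at h3
      rw [div_lt_iff₀ h] at h4
      rw [abs_le]
      constructor <;> nlinarith
    · rw [coe_gridPoint]
      simp only [neg_neg, Complex.sub_im, UpperHalfPlane.coe_im]
      rw [abs_le]
      constructor <;> linarith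
  linarith

theorem exists_gridPoint_separated (r : ℝ) : ∃ N : ℕ, 0 < N ∧ ∀ v v' : ℤ × ℤ,
    dist (gridPoint v) (gridPoint v') ≤ r → (v.1 : ZMod N) = v'.1 → (v.2 : ZMod N) = v'.2 → v = v' := by
  obtain ⟨N, hN⟩ := exists_nat_gt (max (r / Real.log 2) (Real.exp r - 1))
  have hN1 := (le_max_left _ _).trans_lt hN
  have hN2 := (le_max_right _ _).trans_lt hN
  have hlog : 0 < Real.log 2 := Real.log_pos one_lt_two
  refine ⟨N + 1, N.succ_pos, fun v v' hr h1 h2 => ?_⟩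
  have key : ∀ a b : ℤ, (a : ZMod (N + 1)) = b → |(a : ℝ) - b| ≤ N → a = b := by
    intro a b hab hN
    rw [ZMod.intCast_eq_intCast_iff_dvd_sub] at hab
    have : b - a = 0 := by
      refine Int.eq_zero_of_abs_lt_dvd hab ?_
      rw [abs_sub_comm] at hN
      have : |b - a| ≤ (N : ℤ) := by exact_mod_cast hN
      push_cast
      linarith
    linarith
  have e1 : v.1 = v'.1 := by
    refine key _ _ h1 ?_
    have h3 := (UpperHalfPlane.dist_log_im_le _ _).trans hr
    rw [gridPoint_im, gridPoint_im, Real.log_zpow, Real.log_zpow, Real.dist_eq, ← sub_mul, abs_mul,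
      abs_of_pos hlog, ← le_div_iff₀ hlog] at h3
    push_cast at h3
    rw [show -(v.1 : ℝ) - -v'.1 = -(v.1 - v'.1) by ring, abs_neg] at h3
    linarith
  refine Prod.ext e1 (key _ _ h2 ?_)
  have h3 := UpperHalfPlane.dist_coe_le (gridPoint v) (gridPoint v')
  have h : (0 : ℝ) < 2 ^ (-v'.1) := by positivity
  rw [gridPoint_im, coe_gridPoint, coe_gridPoint, e1, Complex.dist_of_im_eq (by rfl), Real.dist_eq] at h3
  simp only [← sub_mul] at h3
  rw [abs_mul, abs_of_pos h, mul_comm, mul_le_mul_iff_right₀ h] at h3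
  have := Real.exp_le_exp.2 hr
  linarith

theorem IsQIToSpace.exists_grid (hσ : IsSymmGen σ) {f : G → UpperHalfPlane} (hf : IsQIToSpace σ f) :
    ∃ (ψ : ℤ × ℤ → G) (ρ N : ℕ) (idx : ℤ × ℤ → Fin N),
      (∀ v, (ψ v)⁻¹ * ψ (v.1, v.2 + 1) ∈ wordBall σ ρ) ∧
      (∀ v, (ψ v)⁻¹ * ψ (v.1 + 1, 2 * v.2) ∈ wordBall σ ρ) ∧
      (∀ g, ∃ v, g⁻¹ * ψ v ∈ wordBall σ ρ) ∧
      ∀ v v', ψ v = ψ v' → idx v = idx v' → v = v' := by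
  obtain ⟨C, hC, hdist, hdense⟩ := hf
  choose ψ hψ using fun v => hdense (gridPoint v)
  obtain ⟨N, hN, hsep⟩ := exists_gridPoint_separated (C + C)
  have : NeZero N := ⟨hN.ne'⟩
  let e : ZMod N × ZMod N ≃ Fin (Fintype.card (ZMod N × ZMod N)) := Fintype.equivFin _
  have hball : ∀ g g', dist (f g) (f g') ≤ 2 * C + 2 → g⁻¹ * g' ∈ wordBall σ ⌈C * (3 * C + 2)⌉₊ := by
    intro g g' h
    refine hσ.mem_wordBall (le_trans ?_ (Nat.le_ceil _))
    have h1 := (hdist g g').1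
    have hC0 : 0 < C := by linarith
    have h2 : (1 / C) * wordDist σ g g' ≤ 3 * C + 2 := by linarith
    rw [one_div, inv_mul_le_iff₀ hC0] at h2
    exact h2
  have htri : ∀ v v', dist (gridPoint v) (gridPoint v') ≤ 1 → dist (f (ψ v)) (f (ψ v')) ≤ 2 * C + 2 := by
    intro v v' h
    have h1 := dist_triangle4 (f (ψ v)) (gridPoint v) (gridPoint v') (f (ψ v'))
    have h2 := hψ v
    rw [dist_comm] at h2
    linarith [hψ v']
  refine ⟨ψ, _, _, fun v => e (v.1, v.2), fun v => hball _ _ (htri _ _ (dist_gridPoint_right v)),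
    fun v => hball _ _ (htri _ _ (dist_gridPoint_down v)), fun g => ?_, fun v v' h1 h2 => ?_⟩
  · obtain ⟨v, hv⟩ := exists_dist_gridPoint_le (f g)
    exact ⟨v, hball _ _ ((dist_triangle _ (gridPoint v) _).trans (by linarith [hψ v]))⟩
  · have h3 := Prod.ext_iff.1 (e.injective h2)
    refine hsep v v' ((dist_triangle _ (f (ψ v)) _).trans ?_) h3.1 h3.2
    have := hψ v'
    rw [dist_comm, ← h1] at this
    linarith [hψ v]

end Grid

/-! ### Subshifts of finite type from local rules -/

theorem isSFT_of_local {G A : Type*} [Group G] [Finite A] (D : Finset G) (P : (G → A) → Prop)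
    (hP : ∀ x y, (∀ h ∈ D, x h = y h) → P x → P y) :
    IsSFT {x : G → A | ∀ g, P fun h => x (g * h)} := by
  classical
  have hfin : {p : Pattern G A | p.dom = D ∧ ∀ x : G → A, (∀ h : {h // h ∈ p.dom}, x h = p.val h) → ¬P x}.Finite := by
    refine (Set.finite_range fun v : {h // h ∈ D} → A => (⟨D, v⟩ : Pattern G A)).subset ?_
    rintro ⟨D', v⟩ ⟨rfl, -⟩
    exact ⟨v, rfl⟩
  refine ⟨hfin.toFinset.toList, Set.ext fun x => ?_⟩
  simp only [Finset.mem_toList, Set.Finite.mem_toFinset, Set.mem_ofPred_eq]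
  constructor
  · rintro h ⟨D', v⟩ ⟨-, hv⟩ g hm
    exact hv (fun h => x (g⁻¹ * h)) hm (h g⁻¹)
  · intro h g
    by_contra hg
    refine h ⟨D, fun h => x (g * h)⟩ ⟨rfl, fun y hy hPy => hg ?_⟩ g⁻¹ fun h => ?_
    · exact hP _ _ (fun h hh => hy ⟨h, hh⟩) hPy
    · simp [shift]

/-- The data attached to a vertex of a carpet hosted by a group element: its labels, and pointers
to its right and lower neighbours. -/
structure Cell (I C E Q J : Type) (B : ℤ) where
  lab : I
  bit : C → Set.Icc (0 : ℤ) 1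
  carry : E → Set.Icc (-B) B
  right : Q × J
  down : Q × J

namespace Cell

variable {I C E Q J : Type} {B : ℤ}

instance [Finite I] [Finite C] [Finite E] [Finite Q] [Finite J] : Finite (Cell I C E Q J B) := by
  refine Finite.of_injective (fun t : Cell I C E Q J B => (t.lab, t.bit, t.carry, t.right, t.down)) ?_
  rintro ⟨⟩ ⟨⟩ h
  simpa using h

/-- The local rule satisfied around the identity by a configuration of cells which encodes a
carpet of `S`. -/
def Rule {G : Type*} [Group G] [Fintype C] (S : LinSys I C E) (val : Q → G)
    (x : G → J → Option (Cell I C E Q J B)) : Prop :=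
  (∃ q a t, x (val q) a = some t) ∧
  ∀ a t, x 1 a = some t → ∃ tR tD tRD,
    x (val t.right.1) t.right.2 = some tR ∧ x (val t.down.1) t.down.2 = some tD ∧
    x (val t.down.1 * val tD.right.1) tD.right.2 = some tRD ∧
    val t.right.1 * val tR.down.1 = val t.down.1 * val tD.right.1 * val tRD.right.1 ∧
    tR.down.2 = tRD.right.2 ∧ tR.lab = t.lab ∧ S.allowed t.lab tD.lab ∧
    ∀ e, 2 * ∑ c, S.al t.lab e c * (t.bit c : ℤ)
      + ∑ c, S.be t.lab e c * ((tD.bit c : ℤ) + tRD.bit c) + 2 * S.ga t.lab e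
      = (tR.carry e : ℤ) - t.carry e

theorem exists_window {G : Type*} [Group G] [Fintype C] [Finite Q] (S : LinSys I C E) (val : Q → G) :
    ∃ D : Finset G, ∀ x y : G → J → Option (Cell I C E Q J B), (∀ h ∈ D, x h = y h) →
      Rule S val x → Rule S val y := by
  classical
  have := Fintype.ofFinite Q
  refine ⟨insert 1 (Finset.univ.image val ∪ Finset.univ.image fun q : Q × Q => val q.1 * val q.2), ?_⟩
  intro x y h ⟨⟨q, a, t, ht⟩, hx⟩
  have h1 : x 1 = y 1 := h _ (by simp)
  have hv : ∀ q, x (val q) = y (val q) := fun q => h _ (by simp)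
  have hvv : ∀ q q', x (val q * val q') = y (val q * val q') := fun q q' => h _ <| by
    simp only [Finset.mem_insert, Finset.mem_union, Finset.mem_image, Finset.mem_univ, true_and]
    exact .inr (.inr ⟨(q, q'), rfl⟩)
  refine ⟨⟨q, a, t, hv q ▸ ht⟩, fun a t ht => ?_⟩
  obtain ⟨tR, tD, tRD, hR, hD, hRD, hh⟩ := hx a t (h1 ▸ ht)
  exact ⟨tR, tD, tRD, hv _ ▸ hR, hv _ ▸ hD, hvv _ _ ▸ hRD, hh⟩

section Host

variable {G : Type*} {x : G → J → Option (Cell I C E Q J B)}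

/-- The vertices of the carpet encoded by a configuration of cells. -/
abbrev Host (x : G → J → Option (Cell I C E Q J B)) := {v : G × J // (x v.1 v.2).isSome}

/-- The cell of a vertex. -/
def cell (v : Host x) : Cell I C E Q J B := (x v.1.1 v.1.2).get v.2

theorem eq_some_cell (v : Host x) : x v.1.1 v.1.2 = some (cell v) := (Option.some_get _).symm

variable [Group G] {val : Q → G}

/-- The place pointed to by `p`, seen from `v`. -/
def place (val : Q → G) (v : G × J) (p : Q × J) : G × J := (v.1 * val p.1, p.2)

variable [Fintype C] {S : LinSys I C E}

theorem rule_cell (h : ∀ g, Rule S val fun g' => x (g * g')) (v : Host x) : ∃ vR vD vRD : Host x,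
    vR.1 = place val v.1 (cell v).right ∧ vD.1 = place val v.1 (cell v).down ∧
    vRD.1 = place val vD.1 (cell vD).right ∧
    place val vR.1 (cell vR).down = place val vRD.1 (cell vRD).right ∧
    (cell vR).lab = (cell v).lab ∧ S.allowed (cell v).lab (cell vD).lab ∧
    ∀ e, 2 * ∑ c, S.al (cell v).lab e c * ((cell v).bit c : ℤ)
      + ∑ c, S.be (cell v).lab e c * (((cell vD).bit c : ℤ) + (cell vRD).bit c)
      + 2 * S.ga (cell v).lab e = ((cell vR).carry e : ℤ) - (cell v).carry e := by
  obtain ⟨tR, tD, tRD, hR, hD, hRD, h1, h2, hh⟩ := (h v.1.1).2 v.1.2 (cell v)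
    (by simpa using eq_some_cell v)
  let vR : Host x := ⟨place val v.1 (cell v).right, by simp only [place, hR, Option.isSome_some]⟩
  let vD : Host x := ⟨place val v.1 (cell v).down, by simp only [place, hD, Option.isSome_some]⟩
  have eR : cell vR = tR := Option.some_injective _ ((eq_some_cell vR).symm.trans hR)
  have eD : cell vD = tD := Option.some_injective _ ((eq_some_cell vD).symm.trans hD)
  simp only [← mul_assoc] at hRD
  let vRD : Host x := ⟨place val vD.1 tD.right, by
    simp only [place, vD, hRD, Option.isSome_some]⟩
  have eRD : cell vRD = tRD := Option.some_injective _ ((eq_some_cell vRD).symm.trans hRD)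
  refine ⟨vR, vD, vRD, rfl, rfl, by rw [eD], ?_, by rw [eR]; exact hh.1, by rw [eD]; exact hh.2.1, ?_⟩
  · rw [eR, eRD]
    refine Prod.ext ?_ h2
    simp only [place, vR, vRD, vD, mul_assoc] at h1 ⊢
    rw [h1]
  · rw [eR, eD, eRD]
    exact hh.2.2

/-- The carpet encoded by a configuration of cells. -/
theorem exists_carpet (h : ∀ g, Rule S val fun g' => x (g * g')) : ∃ T : Carpet S (Host x),
    (∀ v, T.lab v = (cell v).lab) ∧ ∀ v, (T.D v).1 = place val v.1 (cell v).down := by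
  choose vR vD vRD hR hD hRD hcomm hlab hal heq using rule_cell h
  have e : ∀ v, vRD v = vR (vD v) := fun v => Subtype.ext ((hRD v).trans (hR _).symm)
  refine ⟨{ R := vR
            D := vD
            comm := fun v => Subtype.ext ?_
            lab := fun v => (cell v).lab
            bit := fun v c => (cell v).bit c
            carry := fun v e => (cell v).carry e
            bound := B
            bit_mem := fun v c => ((cell v).bit c).2
            carry_mem := fun v e => ((cell v).carry e).2
            lab_R := hlab
            allowed := hal
            eqn := fun v => by rw [← e]; exact heq v }, fun v => rfl, hD⟩
  change (vD (vR v)).1 = (vR (vR (vD v))).1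
  rw [← e, hD (vR v), hR (vRD v)]
  exact hcomm v

theorem exists_host (h : ∀ g, Rule S val fun g' => x (g * g')) : Nonempty (Host x) := by
  obtain ⟨q, a, t, ht⟩ := (h 1).1
  simp only [one_mul] at ht
  exact ⟨⟨(val q, a), by simp [ht]⟩⟩

end Host

/-- The configuration of cells encoding a carpet on the standard grid, given a placement of that grid in
the group. -/
theorem exists_rule {G : Type*} [Group G] [Fintype C] {S : LinSys I C E} (T : Carpet S (ℤ × ℤ))
    {val : Q → G} {ψ : ℤ × ℤ → G} {idx : ℤ × ℤ → J} (hR : ∀ v, (ψ v)⁻¹ * ψ (T.R v) ∈ Set.range val)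
    (hD : ∀ v, (ψ v)⁻¹ * ψ (T.D v) ∈ Set.range val) (hdense : ∀ g, ∃ v, g⁻¹ * ψ v ∈ Set.range val)
    (hinj : ∀ v v', ψ v = ψ v' → idx v = idx v' → v = v') :
    ∃ x : G → J → Option (Cell I C E Q J T.bound), ∀ g, Rule S val fun g' => x (g * g') := by
  classical
  choose r hr using hR
  choose d hd using hD
  let t : ℤ × ℤ → Cell I C E Q J T.bound := fun v =>
    { lab := T.lab v
      bit := fun c => ⟨T.bit v c, T.bit_mem v c⟩
      carry := fun e => ⟨T.carry v e, T.carry_mem v e⟩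
      right := (r v, idx (T.R v))
      down := (d v, idx (T.D v)) }
  let x : G → J → Option (Cell I C E Q J T.bound) := fun g a =>
    if h : ∃ v, ψ v = g ∧ idx v = a then some (t h.choose) else none
  have hx : ∀ v, x (ψ v) (idx v) = some (t v) := by
    intro v
    have h : ∃ v', ψ v' = ψ v ∧ idx v' = idx v := ⟨v, rfl, rfl⟩
    have h' : h.choose = v := hinj _ _ h.choose_spec.1 h.choose_spec.2
    simp only [x]
    rw [dif_pos h, h']
  have hx' : ∀ g a s, x g a = some s → ∃ v, ψ v = g ∧ idx v = a ∧ s = t v := by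
    intro g a s hs
    simp only [x] at hs
    split_ifs at hs with h
    exact ⟨_, h.choose_spec.1, h.choose_spec.2, (Option.some_injective _ hs).symm⟩
  have hr' : ∀ v, ψ v * val (r v) = ψ (T.R v) := fun v => by rw [hr]; simp
  have hd' : ∀ v, ψ v * val (d v) = ψ (T.D v) := fun v => by rw [hd]; simp
  refine ⟨x, fun g => ⟨?_, fun a s hs => ?_⟩⟩
  · obtain ⟨v, q, hq⟩ := hdense g
    refine ⟨q, idx v, t v, ?_⟩
    simp only [hq, mul_inv_cancel_left, hx]
  · obtain ⟨v, hv, rfl, rfl⟩ := hx' _ _ _ hs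
    rw [mul_one] at hv
    subst hv
    refine ⟨t (T.R v), t (T.D v), t (T.R (T.D v)), ?_, ?_, ?_, ?_, ?_, T.lab_R v, T.allowed v,
      T.eqn v⟩
    · simp only [t, hr', hx]
    · simp only [t, hd', hx]
    · simp only [t, ← mul_assoc, hd', hr', hx]
    · refine mul_left_cancel (a := ψ v) ?_
      simp only [t, ← mul_assoc, hd', hr', T.comm]
    · simp only [t, T.comm]

end Cell

/-! ### From linear systems to subshifts of finite type -/

section Cover

variable {G : Type*} [Group G] {k : ℕ} (σ : Fin k → G)

theorem cover_mk_append (l : List (Fin k × Bool)) (w : List (Fin k)) :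
    cover σ (FreeGroup.mk (l ++ w.map fun a => (a, true))) = cover σ (FreeGroup.mk l) * (w.map σ).prod := by
  simp only [cover, FreeGroup.lift_mk, List.map_append, List.prod_append, List.map_map]
  rfl

theorem confFun_comp_cover {A : Type*} [Encodable A] (x : G → A) (l : List (Fin k × Bool)) :
    confFun (x ∘ cover σ) (Encodable.encode l) = Encodable.encode (some (x (cover σ (FreeGroup.mk l)))) := by
  have : (Encodable.decode (α := FreeGroup (Fin k)) (Encodable.encode l)) = some (FreeGroup.mk l) := by
    change (Encodable.decode (Encodable.encode l)).bind _ = _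
    rw [Encodable.encodek]
    rfl
  rw [confFun, this]
  rfl

end Cover

theorem Cell.exists_computable_path {G : Type*} [Group G] {k : ℕ} {σ : Fin k → G} (hσ : IsSymmGen σ)
    {I C E Q : Type} {M n : ℕ} {B : ℤ} (word : Q → List (Fin k))
    (e : (Fin M → Option (Cell I C E Q (Fin M) B)) ≃ Fin n) {x : G → Fin n}
    (hx : Computable (confFun (x ∘ cover σ))) {D : Host (fun g => e.symm (x g)) → Host (fun g => e.symm (x g))}
    (hD : ∀ v, (D v).1 = place (fun q => ((word q).map σ).prod) v.1 (cell v).down)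
    (v : Host fun g => e.symm (x g)) {N : ℕ} (f : I → Fin N) :
    Computable fun m => f (cell (D^[m] v)).lab := by
  classical
  let look : Option (Option (Fin n)) × Fin M → Option (Cell I C E Q (Fin M) B) := fun p =>
    p.1.join.bind fun s => e.symm s p.2
  let down : Option (Option (Fin n)) × Fin M → List (Fin k × Bool) × Fin M := fun p =>
    (look p).elim ([], p.2) fun t => ((word t.down.1).map fun a => (a, true), t.down.2)
  let lab : Option (Option (Fin n)) × Fin M → Fin N := fun p =>
    (look p).elim (f (cell v).lab) fun t => f t.lab
  have hdown : Computable down := (Primrec.dom_finite down).to_comp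
  have hlab : Computable lab := (Primrec.dom_finite lab).to_comp
  let read : List (Fin k × Bool) × Fin M → Option (Option (Fin n)) × Fin M := fun p =>
    (Encodable.decode (confFun (x ∘ cover σ) (Encodable.encode p.1)), p.2)
  have hread : Computable read :=
    (Computable.decode.comp (hx.comp (Computable.encode.comp Computable.fst))).pair Computable.snd
  let step : List (Fin k × Bool) × Fin M → List (Fin k × Bool) × Fin M := fun p =>
    (p.1 ++ (down (read p)).1, (down (read p)).2)
  have hstep : Computable step :=
    (Computable.list_append.comp Computable.fst (Computable.fst.comp (hdown.comp hread))).pair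
      (Computable.snd.comp (hdown.comp hread))
  obtain ⟨w, hw⟩ := hσ.exists_word v.1.1
  let st : ℕ → List (Fin k × Bool) × Fin M := fun m =>
    Nat.rec ([] ++ w.map fun a => (a, true), v.1.2) (fun _ p => step p) m
  have hst : Computable st :=
    Computable.nat_rec Computable.id (Computable.const _) (hstep.comp (Computable.snd.comp Computable.snd)).to₂
  have hlook : ∀ (u : Host fun g => e.symm (x g)) p, u.1 = (cover σ (FreeGroup.mk p.1), p.2) →
      look (read p) = some (cell u) := by
    intro u p hp
    have h1 := eq_some_cell u
    rw [hp] at h1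
    simp only [look, read, confFun_comp_cover, Encodable.encodek]
    exact h1
  have key : ∀ m, (D^[m] v).1 = (cover σ (FreeGroup.mk (st m).1), (st m).2) := by
    intro m
    induction m with
    | zero =>
      refine Prod.ext ?_ rfl
      change v.1.1 = cover σ (FreeGroup.mk ([] ++ w.map fun a => (a, true)))
      rw [cover_mk_append, hw, ← FreeGroup.one_eq_mk, map_one, one_mul]
    | succ m ih =>
      rw [Function.iterate_succ_apply', hD, ih]
      change _ = (cover σ (FreeGroup.mk (step (st m)).1), (step (st m)).2)
      simp only [step, down, hlook _ _ ih, Option.elim_some, cover_mk_append]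
      rfl
  refine (hlab.comp (hread.comp hst)).of_eq fun m => ?_
  simp only [lab, hlook _ _ (key m), Option.elim_some]

theorem LinSys.exists_isSFT {G : Type*} [Group G] {k : ℕ} {σ : Fin k → G} (hσ : IsSymmGen σ)
    {f : G → UpperHalfPlane} (hf : IsQIToSpace σ f) {I C E : Type} [Finite I] [Fintype C] [Finite E]
    {S : LinSys I C E} {i : ℤ → I} {z : ℤ → C → ℝ} (h : S.IsOrbit i z) :
    ∃ (n : ℕ) (X : Set (G → Fin n)), IsSFT X ∧ X.Nonempty ∧
      ∀ y ∈ mSet (pullback (cover σ) X), Computable y → ∃ (j : ℕ → I) (u : ℕ → C → ℝ),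
        S.IsOrbit j u ∧ ∀ {N : ℕ} (f : I → Fin N), Computable fun m => f (j m) := by
  obtain ⟨ψ, ρ, M, idx, hR, hD, hdense, hinj⟩ := hf.exists_grid hσ
  obtain ⟨T, hTR, hTD⟩ := LinSys.exists_carpet h
  let Q := {w : List (Fin k) // w.length ≤ ρ}
  have : Finite Q := (List.finite_length_le (Fin k) ρ).to_subtype
  let val : Q → G := fun q => (q.1.map σ).prod
  have hval : ∀ g, g ∈ wordBall σ ρ → g ∈ Set.range val := fun g ⟨w, hw, hw'⟩ => ⟨⟨w, hw⟩, hw'⟩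
  obtain ⟨x, hx⟩ := Cell.exists_rule (J := Fin M) T (val := val) (ψ := ψ) (idx := idx)
    (fun v => hval _ (by rw [hTR]; exact hR v)) (fun v => hval _ (by rw [hTD]; exact hD v))
    (fun g => (hdense g).imp fun v hv => hval _ hv) hinj
  have e := Finite.equivFin (Fin M → Option (Cell I C E Q (Fin M) T.bound))
  obtain ⟨W, hW⟩ := Cell.exists_window (J := Fin M) (B := T.bound) S val
  refine ⟨_, {x | ∀ g, Cell.Rule S val fun g' => e.symm (x (g * g'))},
    isSFT_of_local W (fun x => Cell.Rule S val fun g' => e.symm (x g')) fun x y hxy =>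
      hW _ _ fun h hh => congrArg e.symm (hxy h hh), ⟨fun g => e (x g), by simpa using hx⟩, ?_⟩
  rintro _ ⟨_, ⟨x', hx', rfl⟩, rfl⟩ hcomp
  obtain ⟨v⟩ := Cell.exists_host (x := fun g => e.symm (x' g)) hx'
  obtain ⟨T', hlab, hD'⟩ := Cell.exists_carpet (x := fun g => e.symm (x' g)) hx'
  obtain ⟨u, hu⟩ := T'.exists_isOrbit v
  refine ⟨_, u, hu, fun f => ?_⟩
  simp only [hlab]
  exact Cell.exists_computable_path hσ (fun q : Q => q.1) e hcomp hD' v f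

/-! ### Stack machines with a finite control -/

/-- A machine with a finite control and stacks indexed by `K`. The control state selects the stack
to look at; the top symbol of that stack and a nondeterministic bit determine the next control
state and the word which replaces the top symbol. -/
structure Automaton (Q K A : Type) where
  key : Option Q → K
  act : Option Q → Option A → Bool → Option (Q × List A)
  length_le : ∀ c o b p, act c o b = some p → p.2.length ≤ o.toList.length + 1

namespace Automaton

variable {Q K A : Type} (M : Automaton Q K A)

/-- The configuration following `s` when the nondeterministic choice is `b`. -/
def next [DecidableEq K] (b : Bool) (s : Option Q × (K → List A)) :
    Option (Option Q × (K → List A)) :=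
  (M.act s.1 (s.2 (M.key s.1)).head? b).map fun p =>
    (some p.1, Function.update s.2 (M.key s.1) (p.2 ++ (s.2 (M.key s.1)).tail))

/-- The instructions of the associated stack machine. -/
abbrev Instr : Type := {d : Option Q × Option A × Bool // (M.act d.1 d.2.1 d.2.2).isSome}

/-- The stack machine associated with an automaton; the control is kept on an additional stack. -/
def toStackMachine [DecidableEq K] : StackMachine M.Instr (Option K) (Option (Q ⊕ A)) where
  bot := none
  popW d k := k.elim [d.1.1.map Sum.inl] fun k =>
    if k = M.key d.1.1 then [d.1.2.1.map Sum.inr] else []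
  pushW d k := k.elim
    (some (Sum.inl ((M.act d.1.1 d.1.2.1 d.1.2.2).get d.2).1) :: if d.1.1 = none then [none] else [])
    fun k => if k = M.key d.1.1 then
      ((M.act d.1.1 d.1.2.1 d.1.2.2).get d.2).2.map (fun a => some (Sum.inr a)) ++
        if d.1.2.1 = none then [none] else [] else []
  ok := by
    rintro ⟨⟨c, o, b⟩, hd⟩ k
    cases k with
    | none =>
      cases c with
      | none => exact .inr ⟨rfl, [_], by simp; rfl, by simp⟩
      | some q => exact .inl (by simp)
    | some k =>
      by_cases hk : k = M.key c
      · cases o with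
        | none => exact .inr ⟨by simp [hk], _, by simp [hk]; rfl, by simp⟩
        | some a => exact .inl (by simp [hk])
      · exact .inl (by simp [hk])
  growth := by
    rintro ⟨⟨c, o, b⟩, hd⟩ k
    cases k with
    | none => cases c <;> simp
    | some k =>
      by_cases hk : k = M.key c
      · have := M.length_le c o b _ (Option.some_get hd).symm
        cases o <;> simpa [hk] using this
      · simp [hk]

/-- The stacks of the stack machine which represent a configuration. -/
def stackWord (s : Option Q × (K → List A)) : Option K → List (Option (Q ⊕ A)) := fun k =>
  k.elim (s.1.toList.map fun q => some (Sum.inl q)) fun k => (s.2 k).map fun a => some (Sum.inr a)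

variable {M} [DecidableEq K]

theorem step_stackWord {s s' : Option Q × (K → List A)} {d : M.Instr} (h1 : d.1.1 = s.1)
    (h2 : d.1.2.1 = (s.2 (M.key s.1)).head?) (h3 : M.next d.1.2.2 s = some s') :
    M.toStackMachine.Step d (stackWord s) (stackWord s') := by
  obtain ⟨⟨c, o, b⟩, hd⟩ := d
  obtain ⟨c', S⟩ := s
  simp only at h1 h2 h3
  subst h1
  obtain ⟨p, hp⟩ := Option.isSome_iff_exists.1 hd
  simp only at hp
  have h3' : s' = (some p.1, Function.update S (M.key c) (p.2 ++ (S (M.key c)).tail)) := by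
    simp only [next, ← h2, hp, Option.map_some, Option.some.injEq] at h3
    exact h3.symm
  subst h3'
  intro k
  cases k with
  | none => cases c <;> simp [toStackMachine, stackWord, hp]
  | some k =>
    by_cases hk : k = M.key c
    · subst hk
      rcases hS : S (M.key c) with _ | ⟨a, l⟩
      · rw [hS] at h2
        simp only [List.head?_nil] at h2
        subst h2
        exact ⟨[], by simp [toStackMachine, stackWord, hp, hS]⟩
      · rw [hS] at h2
        simp only [List.head?_cons] at h2
        subst h2
        exact ⟨l.map (fun a => some (Sum.inr a)) ++ [none],
          by simp [toStackMachine, stackWord, hp, hS]⟩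
    · simp [toStackMachine, stackWord, hk]

theorem exists_next_of_step {s : Option Q × (K → List A)} {d : M.Instr}
    {L : Option K → List (Option (Q ⊕ A))} (h : M.toStackMachine.Step d (stackWord s) L) :
    d.1.1 = s.1 ∧ ∃ s', M.next d.1.2.2 s = some s' ∧ L = stackWord s' := by
  have h1 : d.1.1 = s.1 := by
    obtain ⟨l, hl, -⟩ := h none
    obtain ⟨c, S⟩ := s
    have := congrArg List.head? hl
    rcases hc : d.1.1 with _ | q <;> cases c <;> simp_all [toStackMachine, stackWord]
  have h2 : d.1.2.1 = (s.2 (M.key s.1)).head? := by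
    obtain ⟨l, hl, -⟩ := h (some (M.key s.1))
    have := congrArg List.head? hl
    rcases hS : s.2 (M.key s.1) with _ | ⟨a, t⟩ <;> rcases hc : d.1.2.1 with _ | q <;>
      simp_all [toStackMachine, stackWord]
  refine ⟨h1, ?_⟩
  obtain ⟨p, hp⟩ := Option.isSome_iff_exists.1 d.2
  refine ⟨(some p.1, Function.update s.2 (M.key s.1) (p.2 ++ (s.2 (M.key s.1)).tail)), ?_, ?_⟩
  · rw [h1, h2] at hp
    simp [next, hp]
  · have h3 := step_stackWord (s := s) (d := d) h1 h2
      (s' := (some p.1, Function.update s.2 (M.key s.1) (p.2 ++ (s.2 (M.key s.1)).tail)))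
      (by rw [h1, h2] at hp; simp [next, hp])
    funext k
    obtain ⟨l, e1, e2⟩ := h k
    obtain ⟨l', e3, e4⟩ := h3 k
    rw [e1] at e3
    rw [List.append_cancel_left e3, ← e4] at e2
    exact List.append_cancel_right e2

theorem exists_steps {b : ℕ → Bool} {s : ℕ → Option Q × (K → List A)}
    (h0 : s 0 = (none, fun _ => [])) (h : ∀ n, M.next (b n) (s n) = some (s (n + 1))) :
    ∃ (δ : ℕ → M.Instr) (L : ℕ → Option K → List (Option (Q ⊕ A))), L 0 = (fun _ => []) ∧
      ∀ n, M.toStackMachine.Step (δ n) (L n) (L (n + 1)) := by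
  refine ⟨fun n => ⟨((s n).1, ((s n).2 (M.key (s n).1)).head?, b n), ?_⟩, fun n => stackWord (s n),
    ?_, fun n => step_stackWord rfl rfl (h n)⟩
  · have := h n
    simp only [next, Option.map_eq_some_iff] at this
    obtain ⟨p, hp, -⟩ := this
    exact Option.isSome_iff_exists.2 ⟨p, hp⟩
  · funext k
    cases k <;> simp [stackWord, h0]

theorem exists_next_of_runs {δ : ℕ → M.Instr}
    (h : ∀ n, M.toStackMachine.Runs ((List.range n).map δ)) :
    ∃ s : ℕ → Option Q × (K → List A), s 0 = (none, fun _ => []) ∧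
      ∀ n, (δ n).1.1 = (s n).1 ∧ M.next (δ n).1.2.2 (s n) = some (s (n + 1)) := by
  have key : ∀ l L, M.toStackMachine.Reach l L → ∃ s, L = stackWord s := by
    intro l L hL
    induction hL with
    | nil => exact ⟨(none, fun _ => []), by funext k; cases k <;> rfl⟩
    | snoc _ hs ih =>
      obtain ⟨s, rfl⟩ := ih
      obtain ⟨-, s', -, rfl⟩ := exists_next_of_step hs
      exact ⟨s', rfl⟩
  let s : ℕ → Option Q × (K → List A) := fun n =>
    Nat.rec (none, fun _ => []) (fun n s => (M.next (δ n).1.2.2 s).getD s) n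
  have hs : ∀ n L, M.toStackMachine.Reach ((List.range n).map δ) L → L = stackWord (s n) := by
    intro n
    induction n with
    | zero =>
      intro L hL
      generalize hl : (List.range 0).map δ = l at hL
      cases hL with
      | nil => funext k; cases k <;> rfl
      | snoc => simp at hl
    | succ n ih =>
      intro L hL
      generalize hl : (List.range (n + 1)).map δ = l at hL
      cases hL with
      | nil => simp at hl
      | snoc h1 h2 =>
        rw [List.range_succ, List.map_append] at hl
        obtain ⟨e1, e2⟩ := List.append_inj' hl rfl
        simp only [List.map_cons, List.map_nil, List.cons.injEq, and_true] at e2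
        subst e1 e2
        rw [ih _ h1] at h2
        obtain ⟨-, s', h3, h4⟩ := exists_next_of_step h2
        rw [h4]
        change _ = stackWord ((M.next (δ n).1.2.2 (s n)).getD (s n))
        rw [h3]
        rfl
  refine ⟨s, rfl, fun n => ?_⟩
  obtain ⟨L, hL⟩ := h (n + 1)
  generalize hl : (List.range (n + 1)).map δ = l at hL
  cases hL with
  | nil => simp at hl
  | snoc h1 h2 =>
    rw [List.range_succ, List.map_append] at hl
    obtain ⟨e1, e2⟩ := List.append_inj' hl rfl
    simp only [List.map_cons, List.map_nil, List.cons.injEq, and_true] at e2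
    subst e1 e2
    rw [hs n _ h1] at h2
    obtain ⟨h5, s', h3, h4⟩ := exists_next_of_step h2
    refine ⟨h5, ?_⟩
    change _ = some ((M.next (δ n).1.2.2 (s n)).getD (s n))
    rw [h3]
    rfl

end Automaton

/-! ### A computable tree without computable branches

A number `n ≠ 0` represents the word of its binary digits after the leading one; the words
`n / 2 ^ k` are its prefixes. -/

section Diag

open Nat.Partrec (Code)
open Nat.Partrec.Code (evaln)

/-- All prefixes of `n` differ at their last digit from the diagonal computation. -/
def Diag (n : ℕ) : Prop :=
  ∀ k e, 2 ^ e ≤ n / 2 ^ k → n / 2 ^ k < 2 ^ (e + 1) →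
    n / 2 ^ k % 2 ∉ Code.eval (Denumerable.ofNat Code e) e

/-- The approximation of `Diag` by computations of bounded length. -/
def DiagApprox (n : ℕ) : Prop :=
  ∀ k < n, ∀ e < n, 2 ^ e ≤ n / 2 ^ k → n / 2 ^ k < 2 ^ (e + 1) →
    n / 2 ^ k % 2 ∉ evaln n (Denumerable.ofNat Code e) e

theorem Diag.diagApprox {n : ℕ} (h : Diag n) : DiagApprox n :=
  fun k _ e _ h1 h2 h3 => h k e h1 h2 (Nat.Partrec.Code.evaln_sound h3)

theorem diag_one : Diag 1 := by
  intro k e h1 h2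
  have hk : k = 0 := by
    by_contra hk
    rw [Nat.div_eq_of_lt (Nat.one_lt_two_pow hk)] at h1
    exact absurd h1 (by simp)
  subst hk
  have he : e = 0 := by
    by_contra he
    have := Nat.one_lt_two_pow he
    simp only [pow_zero, Nat.div_one] at h1
    omega
  subst he
  have : Denumerable.ofNat Code 0 = Code.zero := by
    rw [show 0 = Encodable.encode Code.zero from rfl, Denumerable.ofNat_encode]
  rw [this]
  simp only [Code.eval, pow_zero, Nat.div_one, Nat.one_mod]
  exact fun h => one_ne_zero (Part.mem_some_iff.1 h)

theorem two_mul_add_div_two_pow (m b k : ℕ) (hb : b < 2) :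
    (2 * m + b) / 2 ^ (k + 1) = m / 2 ^ k := by
  rw [pow_succ', ← Nat.div_div_eq_div_mul]
  congr 1
  omega

theorem Diag.exists_succ {m : ℕ} (h : Diag m) (hm : m ≠ 0) : ∃ b : Bool, Diag (2 * m + b.toNat) := by
  classical
  let e := Nat.log 2 m + 1
  let b : Bool := decide (0 ∈ Code.eval (Denumerable.ofNat Code e) e)
  refine ⟨b, fun k e' h1 h2 => ?_⟩
  cases k with
  | zero =>
    simp only [pow_zero, Nat.div_one] at *
    have he : e' = e := by
      have h3 := Nat.pow_log_le_self 2 hm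
      have h4 := Nat.lt_pow_succ_log_self one_lt_two m
      have h5 := Bool.toNat_lt b
      have h6 : 2 ^ e' < 2 ^ (e + 1) := by
        simp only [e, pow_succ] at *
        omega
      have h7 : 2 ^ e < 2 ^ (e' + 1) := by
        simp only [e, pow_succ] at *
        omega
      have := (Nat.pow_lt_pow_iff_right one_lt_two).1 h6
      have := (Nat.pow_lt_pow_iff_right one_lt_two).1 h7
      omega
    subst he
    rw [Nat.mul_add_mod, Nat.mod_eq_of_lt (Bool.toNat_lt b)]
    by_cases h0 : 0 ∈ Code.eval (Denumerable.ofNat Code e) e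
    · have : b = true := decide_eq_true h0
      intro h1
      rw [this] at h1
      exact absurd (Part.mem_unique h0 h1) (by simp)
    · have : b = false := decide_eq_false h0
      simpa [this] using h0
  | succ k =>
    rw [two_mul_add_div_two_pow _ _ _ (Bool.toNat_lt b)] at *
    exact h k e' h1 h2

theorem primrec_two_pow : Primrec fun n : ℕ => 2 ^ n :=
  (Primrec.nat_iff.2 <| Nat.Primrec.pow.comp ((Nat.Primrec.const 2).pair .id)).of_eq
    fun n => by simp

theorem primrecPred_diagApprox : PrimrecPred DiagApprox := by
  have hd : PrimrecRel fun e y : ℕ => 2 ^ e ≤ y.unpair.1 / 2 ^ y.unpair.2 →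
      y.unpair.1 / 2 ^ y.unpair.2 < 2 ^ (e + 1) →
      y.unpair.1 / 2 ^ y.unpair.2 % 2 ∉ evaln y.unpair.1 (Denumerable.ofNat Code e) e := by
    have hn : Primrec fun p : ℕ × ℕ => p.2.unpair.1 :=
      Primrec.fst.comp (Primrec.unpair.comp Primrec.snd)
    have hk : Primrec fun p : ℕ × ℕ => p.2.unpair.2 :=
      Primrec.snd.comp (Primrec.unpair.comp Primrec.snd)
    have hq : Primrec fun p : ℕ × ℕ => p.2.unpair.1 / 2 ^ p.2.unpair.2 :=
      Primrec.nat_div.comp hn (primrec_two_pow.comp hk)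
    have h1 : PrimrecPred fun p : ℕ × ℕ => 2 ^ p.1 ≤ p.2.unpair.1 / 2 ^ p.2.unpair.2 :=
      Primrec.nat_le.comp (primrec_two_pow.comp Primrec.fst) hq
    have h2 : PrimrecPred fun p : ℕ × ℕ => p.2.unpair.1 / 2 ^ p.2.unpair.2 < 2 ^ (p.1 + 1) :=
      Primrec.nat_lt.comp hq (primrec_two_pow.comp (Primrec.succ.comp Primrec.fst))
    have h3 : PrimrecPred fun p : ℕ × ℕ =>
        evaln p.2.unpair.1 (Denumerable.ofNat Code p.1) p.1 =
          some (p.2.unpair.1 / 2 ^ p.2.unpair.2 % 2) :=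
      Primrec.eq.comp (Nat.Partrec.Code.primrec_evaln.comp
        ((hn.pair ((Primrec.ofNat Code).comp Primrec.fst)).pair Primrec.fst))
        (Primrec.option_some.comp (Primrec.nat_mod.comp hq (Primrec.const 2)))
    exact ((h1.and (h2.and h3)).not).of_eq fun p => by simp
  have h1 : PrimrecRel fun k n : ℕ => ∀ e < n, 2 ^ e ≤ n / 2 ^ k → n / 2 ^ k < 2 ^ (e + 1) →
      n / 2 ^ k % 2 ∉ evaln n (Denumerable.ofNat Code e) e :=
    (hd.forall_lt.comp Primrec.snd
      (Primrec₂.natPair.comp Primrec.snd Primrec.fst)).of_eq fun p => by simp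
  exact (h1.forall_lt.comp Primrec.id Primrec.id).of_eq fun p => by simp [DiagApprox]

theorem not_computable_of_diagApprox {u : ℕ → ℕ} (h0 : u 0 = 1)
    (hu : ∀ n, u (n + 1) = u n ∨ ∃ b < 2, u (n + 1) = 2 * u n + b)
    (hd : ∀ B, ∃ n, B ≤ u n ∧ DiagApprox (u n)) : ¬Computable u := by
  intro hc
  have hex : ∀ e, ∃ n, 2 ^ e ≤ u n := fun e => (hd (2 ^ e)).imp fun _ h => h.1
  have hψ : Computable fun e => u (Nat.find (hex e)) % 2 := by
    refine Primrec.nat_mod.to_comp.comp (hc.comp ?_) (Computable.const 2)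
    refine Computable.find (P := fun e n => 2 ^ e ≤ u n) ?_ hex
    exact ⟨fun _ => inferInstance, Primrec.nat_le.decide.to_comp.comp
      (primrec_two_pow.to_comp.comp Computable.fst) (hc.comp Computable.snd)⟩
  obtain ⟨c, hc⟩ := Nat.Partrec.Code.exists_code.1 (Partrec.nat_iff.1 hψ)
  let e := Encodable.encode c
  let n := Nat.find (hex e)
  have h1 : 2 ^ e ≤ u n := Nat.find_spec (hex e)
  have h2 : u n < 2 ^ (e + 1) := by
    rcases hn : n with _ | m
    · rw [h0]
      exact Nat.one_lt_two_pow (by omega)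
    · have h3 : u m < 2 ^ e := not_le.1 (Nat.find_min (hex e) (m := m) (by omega))
      rw [pow_succ]
      rcases hu m with h | ⟨b, hb, h⟩ <;> omega
  have h3 : u n % 2 ∈ Code.eval c e := by
    rw [hc]
    exact Part.mem_some _
  obtain ⟨K, hK⟩ := Nat.Partrec.Code.evaln_complete.1 h3
  have hpre : ∀ j, ∃ k, u (n + j) / 2 ^ k = u n := by
    intro j
    induction j with
    | zero => exact ⟨0, by simp⟩
    | succ j ih =>
      obtain ⟨k, hk⟩ := ih
      rw [← add_assoc]
      rcases hu (n + j) with h | ⟨b, hb, h⟩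
      · exact ⟨k, by rw [h, hk]⟩
      · exact ⟨k + 1, by rw [h, two_mul_add_div_two_pow _ _ _ hb, hk]⟩
  have hmono : Monotone u := monotone_nat_of_le_succ fun n => by
    rcases hu n with h | ⟨b, hb, h⟩ <;> omega
  obtain ⟨n', hn', hd'⟩ := hd (K + e + 1 + u n)
  have hle : n ≤ n' := by
    by_contra hlt
    have := hmono (not_le.1 hlt).le
    omega
  obtain ⟨k, hk⟩ := hpre (n' - n)
  rw [Nat.add_sub_cancel' hle] at hk
  have hk' : k < u n' := by
    by_contra hlt
    rw [Nat.div_eq_of_lt ((not_lt.1 hlt).trans_lt Nat.lt_two_pow_self)] at hk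
    rw [← hk] at h1
    exact absurd h1 (by simp)
  have := hd' k hk' e (by omega)
  rw [hk, Denumerable.ofNat_encode] at this
  exact this h1 h2 (Nat.Partrec.Code.evaln_mono (by omega) hK)

end Diag

/-! ### A stack machine without computable runs -/

section Sim

open Turing Turing.PartrecToTM2 Relation

/-- Statements of the machines which evaluate codes. -/
abbrev TMStmt : Type := TM2.Stmt (fun _ : K' => Γ') Λ' (Option Γ')

/-- Control states of the simulation: `none` is used to prepare the first input. -/
abbrev TMState : Type := Option (TMStmt × Option Γ')

/-- The stack accessed in a control state. -/
def simKey : Option TMState → K'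
  | some (some (.push k _ _, _)) => k
  | some (some (.peek k _ _, _)) => k
  | some (some (.pop k _ _, _)) => k
  | _ => .main

/-- The digit symbol of a bit. -/
def digit (b : Bool) : Γ' := if b then .bit1 else .bit0

/-- The transitions: simulate the machine, and when it halts with a positive result append a
nondeterministic digit to the result and restart. -/
def simAct (start : TMStmt) :
    Option TMState → Option Γ' → Bool → Option (TMState × List Γ')
  | none, none, _ => some (none, [.cons])
  | some none, some x, _ => some (some (start, none), [.bit1, x])
  | some (some (.push _ f q, v)), o, _ => some (some (q, v), f v :: o.toList)
  | some (some (.peek _ f q, v)), o, _ => some (some (q, f v o), o.toList)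
  | some (some (.pop _ f q, v)), o, _ => some (some (q, f v o), [])
  | some (some (.load a q, v)), o, _ => some (some (q, a v), o.toList)
  | some (some (.branch f q₁ q₂, v)), o, _ => some (some (cond (f v) q₁ q₂, v), o.toList)
  | some (some (.goto f, v)), o, _ => some (some (tr (f v), v), o.toList)
  | some (some (.halt, _)), some .bit0, b => some (some (start, none), [digit b, .bit0])
  | some (some (.halt, _)), some .bit1, b => some (some (start, none), [digit b, .bit1])
  | _, _, _ => none

/-- The simulating automaton. -/
def sim (start : TMStmt) : Automaton TMState K' Γ' where
  key := simKey
  act := simAct start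
  length_le := by
    intro c o b p h
    unfold simAct at h
    split at h <;> simp only [Option.some.injEq, reduceCtorEq] at h <;> subst h <;> simp

/-- Configurations of the simulation. -/
abbrev SimCfg : Type := Option TMState × (K' → List Γ')

variable {start : TMStmt}

/-- A step of the simulation which does not depend on the nondeterministic choice. -/
def Micro (start : TMStmt) (s s' : SimCfg) : Prop := ∀ b, (sim start).next b s = some s'

/-- The configuration of the simulation representing a machine configuration. -/
def ofCfg (c : TM2.Cfg (fun _ : K' => Γ') Λ' (Option Γ')) : SimCfg :=
  (some (some (c.l.elim .halt tr, c.var)), c.stk)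

theorem update_toList_append (S : K' → List Γ') (k : K') :
    Function.update S k ((S k).head?.toList ++ (S k).tail) = S := by
  have : (S k).head?.toList ++ (S k).tail = S k := by cases S k <;> rfl
  rw [this, Function.update_eq_self]

theorem reach_stepAux (q : TMStmt) (v : Option Γ') (S : K' → List Γ') :
    ReflTransGen (Micro start) (some (some (q, v)), S) (ofCfg (TM2.stepAux q v S)) := by
  induction q generalizing v S with
  | push k f q ih =>
    refine ReflTransGen.head (fun b => ?_) (ih v _)
    have : f v :: ((S k).head?.toList ++ (S k).tail) = f v :: S k := by cases S k <;> rfl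
    simp [Automaton.next, sim, simAct, simKey, this]
  | peek k f q ih =>
    refine ReflTransGen.head (fun b => ?_) (ih _ S)
    simp [Automaton.next, sim, simAct, simKey, update_toList_append]
  | pop k f q ih =>
    refine ReflTransGen.head (fun b => ?_) (ih _ _)
    simp [Automaton.next, sim, simAct, simKey]
  | load a q ih =>
    refine ReflTransGen.head (fun b => ?_) (ih _ S)
    simp [Automaton.next, sim, simAct, simKey, update_toList_append]
  | branch f q₁ q₂ ih₁ ih₂ =>
    have h : ReflTransGen (Micro start) (some (some (cond (f v) q₁ q₂, v)), S)
        (ofCfg (TM2.stepAux (.branch f q₁ q₂) v S)) := by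
      rw [TM2.stepAux]
      cases f v
      exacts [ih₂ _ _, ih₁ _ _]
    refine ReflTransGen.head (fun b => ?_) h
    simp [Automaton.next, sim, simAct, simKey, update_toList_append]
  | goto f =>
    refine ReflTransGen.single fun b => ?_
    simp [Automaton.next, sim, simAct, simKey, update_toList_append, ofCfg]
    rfl
  | halt => exact .refl

theorem reach_of_reaches {c c' : TM2.Cfg (fun _ : K' => Γ') Λ' (Option Γ')}
    (h : StateTransition.Reaches (TM2.step tr) c c') :
    ReflTransGen (Micro start) (ofCfg c) (ofCfg c') := by
  induction h with
  | refl => exact .refl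
  | @tail c₁ c₂ _ h ih =>
    refine ih.trans ?_
    obtain ⟨_ | l, v, S⟩ := c₁
    · cases h
    · simp only [TM2.step, Option.mem_def, Option.some.injEq] at h
      subst h
      exact reach_stepAux _ _ _

theorem trNat_two_mul_add (m : ℕ) (hm : m ≠ 0) (b : Bool) :
    trNat (2 * m + b.toNat) = digit b :: trNat m := by
  obtain ⟨p, rfl⟩ : ∃ p : PosNum, (p : ℕ) = m := by
    have := Num.to_of_nat m
    rcases hn : (m : Num) with _ | p
    · rw [hn] at this
      exact absurd this.symm hm
    · exact ⟨p, by rw [hn] at this; exact this⟩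
  have h1 : ∀ p : PosNum, trNat (p : ℕ) = trPosNum p := fun p => by
    rw [trNat, PosNum.of_to_nat]
    rfl
  cases b
  · have : 2 * (p : ℕ) + false.toNat = (p.bit0 : ℕ) := by
      rw [PosNum.cast_bit0]
      simp [two_mul]
    rw [this, h1, h1]
    rfl
  · have : 2 * (p : ℕ) + true.toNat = (p.bit1 : ℕ) := by
      rw [PosNum.cast_bit1]
      simp [two_mul]
    rw [this, h1, h1]
    rfl

theorem exists_trNat_eq_cons (m : ℕ) (hm : m ≠ 0) :
    ∃ x l, trNat m = x :: l ∧ (x = .bit0 ∨ x = .bit1) := by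
  rcases hn : (m : Num) with _ | p
  · have := Num.to_of_nat m
    rw [hn] at this
    exact absurd this.symm hm
  · rw [trNat, hn]
    cases p
    exacts [⟨_, _, rfl, .inr rfl⟩, ⟨_, _, rfl, .inr rfl⟩, ⟨_, _, rfl, .inl rfl⟩]

/-- The start of the computation on a number. -/
def startCfg (start : TMStmt) (n : ℕ) : SimCfg :=
  (some (some (start, none)), K'.elim (trList [n]) [] [] [])

/-- The end of a computation with result a number. -/
def haltCfg (n : ℕ) : SimCfg := (some (some (.halt, none)), K'.elim (trList [n]) [] [] [])

theorem next_haltCfg (n : ℕ) (b : Bool) :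
    (sim start).next b (haltCfg n) = if n = 0 then none else some (startCfg start (2 * n + b.toNat)) := by
  split_ifs with h
  · subst h
    simp [Automaton.next, sim, simAct, simKey, haltCfg]
  · obtain ⟨x, l, hl, hx⟩ := exists_trNat_eq_cons n h
    rcases hx with rfl | rfl <;>
      simp [Automaton.next, sim, simAct, simKey, haltCfg, startCfg, trNat_two_mul_add n h, hl]

theorem reach_startCfg_one :
    ReflTransGen (Micro start) (none, fun _ => []) (startCfg start 1) := by
  have h1 : trNat 1 = [.bit1] := rfl
  have h0 : (fun _ => [] : K' → List Γ') = K'.elim [] [] [] [] := by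
    funext k
    cases k <;> rfl
  refine .head (b := (some none, K'.elim [.cons] [] [] [])) (fun b => ?_) (.single fun b => ?_)
  · simp [Automaton.next, sim, simAct, simKey, h0]
  · simp [Automaton.next, sim, simAct, simKey, startCfg, h1]

theorem exists_sim_code {g : ℕ → ℕ} (hg : Computable g) :
    ∃ c : ToPartrec.Code, ∀ n, ReflTransGen (Micro (tr (trNormal c .halt)))
      (startCfg (tr (trNormal c .halt)) n) (haltCfg (g n)) := by
  obtain ⟨c, hc⟩ := ToPartrec.Code.exists_code (Nat.Partrec'.part_iff₁.2 hg.partrec)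
  refine ⟨c, fun n => ?_⟩
  have h1 := tr_eval c [n]
  have h2 : c.eval [n] = Part.some [g n] := (hc ⟨[n], rfl⟩).trans (Part.map_some _ _)
  have h3 : PartrecToTM2.halt [g n] ∈
      StateTransition.eval (TM2.step tr) (PartrecToTM2.init c [n]) := by
    rw [h1, h2]
    exact ⟨trivial, rfl⟩
  exact reach_of_reaches (StateTransition.mem_eval.1 h3).1

end Sim

namespace Automaton

variable {Q K A : Type} (M : Automaton Q K A)

/-- The restriction of an automaton to a set of control states. -/
noncomputable def restrict (F : Set Q) : Automaton F K A where
  key c := M.key (c.map Subtype.val)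
  act c o b := (M.act (c.map Subtype.val) o b).bind fun p =>
    open scoped Classical in if h : p.1 ∈ F then some (⟨p.1, h⟩, p.2) else none
  length_le := by
    intro c o b p hp
    rw [Option.bind_eq_some_iff] at hp
    obtain ⟨p', h1, h2⟩ := hp
    split_ifs at h2 with h
    rw [Option.some.injEq] at h2
    subst h2
    exact M.length_le _ _ _ _ h1

variable {M} [DecidableEq K] {F : Set Q}

theorem restrict_next {b : Bool} {s s' : Option F × (K → List A)} :
    (M.restrict F).next b s = some s' ↔
      M.next b (s.1.map Subtype.val, s.2) = some (s'.1.map Subtype.val, s'.2) := by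
  obtain ⟨c, S⟩ := s
  obtain ⟨c', S'⟩ := s'
  simp only [next, restrict, Option.map_eq_some_iff, Option.bind_eq_some_iff]
  constructor
  · rintro ⟨p, ⟨p', h1, h2⟩, h3⟩
    split_ifs at h2 with h
    rw [Option.some.injEq] at h2
    subst h2
    simp only [Prod.mk.injEq] at h3
    obtain ⟨rfl, rfl⟩ := h3
    exact ⟨p', h1, rfl⟩
  · rintro ⟨p, h1, h2⟩
    simp only [Prod.mk.injEq] at h2
    obtain ⟨h2, rfl⟩ := h2
    rcases c' with _ | ⟨q, hq⟩
    · simp at h2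
    · simp only [Option.map_some, Option.some.injEq] at h2
      obtain ⟨q', l⟩ := p
      simp only at h2
      subst h2
      exact ⟨(⟨q', hq⟩, l), ⟨(q', l), h1, by simp [hq]⟩, rfl⟩

end Automaton

section Sim

open Turing Turing.PartrecToTM2 Relation

theorem exists_sim_states (c : ToPartrec.Code) : ∃ F : Set TMState, F.Finite ∧
    ∀ (s : Option F) o b p,
      simAct (tr (trNormal c .halt)) (s.map Subtype.val) o b = some p → p.1 ∈ F := by
  classical
  let T := TM2.stmts tr (codeSupp c .halt)
  let _ : Inhabited Λ' := ⟨trNormal c .halt⟩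
  have hT : TM2.Supports tr (codeSupp c .halt) := tr_supports c .halt
  have hgoto : ∀ l ∈ codeSupp c .halt, some (tr l) ∈ T := fun l hl =>
    Finset.some_mem_insertNone.2 (Finset.mem_biUnion.2 ⟨l, hl, TM2.stmts₁_self⟩)
  have hsub : ∀ q q', q' ∈ TM2.stmts₁ q → some q ∈ T → some q' ∈ T :=
    fun q q' h => TM2.stmts_trans h
  have hstart : some (tr (trNormal c .halt)) ∈ T := hgoto _ hT.1
  let F : Set TMState := {q | ∀ p ∈ q, some p.1 ∈ T}
  have hF : F.Finite := by
    have h1 : ((fun q : TMStmt => some q) ⁻¹' (T : Set (Option TMStmt))).Finite :=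
      T.finite_toSet.preimage (Option.some_injective _).injOn
    refine (((h1.prod Set.finite_univ).image some).insert none).subset fun q hq => ?_
    rcases q with _ | p
    · exact Set.mem_insert _ _
    · exact Set.mem_insert_of_mem _ ⟨p, ⟨hq p rfl, trivial⟩, rfl⟩
  have hmem : ∀ q v, some q ∈ T → some (q, v) ∈ F := by
    rintro q v h p hp
    cases hp
    exact h
  refine ⟨F, hF, fun s o b p h => ?_⟩
  have hs : ∀ q v, s.map Subtype.val = some (some (q, v)) → some q ∈ T := by
    intro q v hq
    rw [Option.map_eq_some_iff] at hq
    obtain ⟨⟨a, ha⟩, -, rfl⟩ := hq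
    exact ha _ rfl
  generalize s.map Subtype.val = s at *
  unfold simAct at h
  split at h <;> simp only [Option.some.injEq, reduceCtorEq] at h <;> subst h
  · rintro p ⟨⟩
  · exact hmem _ _ hstart
  · exact hmem _ _ (hsub _ _ (by simp [TM2.stmts₁, TM2.stmts₁_self]) (hs _ _ rfl))
  · exact hmem _ _ (hsub _ _ (by simp [TM2.stmts₁, TM2.stmts₁_self]) (hs _ _ rfl))
  · exact hmem _ _ (hsub _ _ (by simp [TM2.stmts₁, TM2.stmts₁_self]) (hs _ _ rfl))
  · exact hmem _ _ (hsub _ _ (by simp [TM2.stmts₁, TM2.stmts₁_self]) (hs _ _ rfl))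
  · refine hmem _ _ (hsub _ _ ?_ (hs _ _ rfl))
    rename_i f q₁ q₂ v
    cases f v <;> simp [TM2.stmts₁, TM2.stmts₁_self]
  · exact hmem _ _ (hgoto _ (TM2.stmts_supportsStmt hT (hs _ _ rfl) _))
  · exact hmem _ _ hstart
  · exact hmem _ _ hstart

variable {start : TMStmt}

theorem exists_branch {g : ℕ → ℕ} (hg : ∀ n, Diag n → g n = n)
    (hstart : ∀ n, ReflTransGen (Micro start) (startCfg start n) (haltCfg (g n))) :
    ∃ (b : ℕ → Bool) (s : ℕ → SimCfg), s 0 = (none, fun _ => []) ∧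
      ∀ n, (sim start).next (b n) (s n) = some (s (n + 1)) := by
  let P : SimCfg → Prop := fun s => ∃ m ≠ 0, Diag m ∧ ReflTransGen (Micro start) s (haltCfg m)
  have hP : ∀ s, P s → ∃ b s', (sim start).next b s = some s' ∧ P s' := by
    rintro s ⟨m, hm, hd, h⟩
    rcases h.cases_head with rfl | ⟨s', h1, h2⟩
    · obtain ⟨b, hb⟩ := hd.exists_succ hm
      refine ⟨b, startCfg start (2 * m + b.toNat), by rw [next_haltCfg, if_neg hm],
        2 * m + b.toNat, by omega, hb, ?_⟩
      have := hstart (2 * m + b.toNat)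
      rwa [hg _ hb] at this
    · exact ⟨false, s', h1 _, m, hm, hd, h2⟩
  have h0 : P (none, fun _ => []) := by
    refine ⟨1, one_ne_zero, diag_one, reach_startCfg_one.trans ?_⟩
    have := hstart 1
    rwa [hg _ diag_one] at this
  choose b t h1 h2 using hP
  let s : ℕ → {s // P s} := fun n => Nat.rec ⟨_, h0⟩ (fun _ s => ⟨t s.1 s.2, h2 s.1 s.2⟩) n
  exact ⟨fun n => b (s n).1 (s n).2, fun n => (s n).1, rfl, fun n => h1 (s n).1 (s n).2⟩

/-- The nondeterministic digit used in a halting control state. -/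
noncomputable def haltDigit (c : Option TMState) (b : Bool) : Option Bool :=
  open scoped Classical in if ∃ v, c = some (some (.halt, v)) then some b else none

/-- The number whose digits are the nondeterministic digits used so far. -/
def digitNum (o : ℕ → Option Bool) (n : ℕ) : ℕ :=
  Nat.rec 1 (fun n u => (o n).elim u fun b => 2 * u + b.toNat) n

theorem diagApprox_digitNum {g : ℕ → ℕ} (hg : ∀ n, g n ≠ 0 → g n = n ∧ DiagApprox n)
    (hstart : ∀ n, ReflTransGen (Micro start) (startCfg start n) (haltCfg (g n)))
    {b : ℕ → Bool} {s : ℕ → SimCfg} (h0 : s 0 = (none, fun _ => []))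
    (h : ∀ n, (sim start).next (b n) (s n) = some (s (n + 1))) (B : ℕ) :
    ∃ n, B ≤ digitNum (fun n => haltDigit (s n).1 (b n)) n ∧
      DiagApprox (digitNum (fun n => haltDigit (s n).1 (b n)) n) := by
  set u := digitNum fun n => haltDigit (s n).1 (b n) with hu
  have hu0 : ∀ n, haltDigit (s n).1 (b n) = none → u (n + 1) = u n := by
    intro n hn
    change (haltDigit (s n).1 (b n)).elim (u n) _ = _
    rw [hn]
    rfl
  have hu1 : ∀ n, haltDigit (s n).1 (b n) = some (b n) → u (n + 1) = 2 * u n + (b n).toNat := by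
    intro n hn
    change (haltDigit (s n).1 (b n)).elim (u n) _ = _
    rw [hn]
    rfl
  have hhalt : ∀ m, (haltCfg m).1 = some (some (.halt, none)) := fun m => rfl
  have hstep : ∀ n m, s n = haltCfg m →
      m ≠ 0 ∧ u (n + 1) = 2 * u n + (b n).toNat ∧ s (n + 1) = startCfg start (2 * m + (b n).toNat) := by
    intro n m hs
    have h1 := h n
    rw [hs, next_haltCfg] at h1
    split_ifs at h1 with hm
    refine ⟨hm, hu1 n ?_, (Option.some.inj h1).symm⟩
    rw [hs]
    exact if_pos ⟨none, rfl⟩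
  have hmicro : ∀ n s', Micro start (s n) s' → s' = s (n + 1) ∧ u (n + 1) = u n := by
    intro n s' hs
    refine ⟨Option.some.inj ((hs (b n)).symm.trans (h n)), hu0 n (if_neg ?_)⟩
    rintro ⟨v, hv⟩
    generalize s n = t at hs hv
    obtain ⟨c, S⟩ := t
    simp only at hv
    subst hv
    have h1 := hs true
    have h2 := hs false
    rw [← h2] at h1
    have h3 := congrArg (Option.map fun t : SimCfg => (t.2 .main).head?) h1
    rcases hS : S .main with _ | ⟨x, l⟩
    · simp [Automaton.next, sim, simAct, simKey, hS] at h2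
    · cases x <;> simp [Automaton.next, sim, simAct, simKey, hS, digit] at h2 h3
  have hinv : ∀ n, ReflTransGen (Micro start) (s n) (haltCfg (g (u n))) := by
    intro n
    induction n with
    | zero =>
      rw [h0]
      exact reach_startCfg_one.trans (hstart 1)
    | succ n ih =>
      rcases ih.cases_head with h1 | ⟨s', h1, h2⟩
      · obtain ⟨hm, h2, h3⟩ := hstep n _ h1
        rw [h3, h2, (hg _ hm).1]
        exact hstart _
      · obtain ⟨rfl, h3⟩ := hmicro n _ h1
        rwa [h3]
  have hreach : ∀ n, ∃ n', s n' = haltCfg (g (u n')) ∧ u n' = u n := by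
    intro n
    generalize ht : haltCfg (g (u n)) = t
    obtain ⟨s', hs'⟩ : ∃ s', s' = s n := ⟨_, rfl⟩
    have h1 := hinv n
    rw [ht, ← hs'] at h1
    induction h1 using ReflTransGen.head_induction_on generalizing n with
    | refl => exact ⟨n, by rw [← hs', ht], rfl⟩
    | head h1 h2 ih =>
      rw [hs'] at h1
      obtain ⟨h3, h4⟩ := hmicro n _ h1
      obtain ⟨n', h5, h6⟩ := ih (n + 1) (by rw [h4, ht]) h3
      exact ⟨n', h5, h6.trans h4⟩
  have hpos : ∀ B, ∃ n, B < u n := by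
    intro B
    induction B with
    | zero => exact ⟨0, one_pos⟩
    | succ B ih =>
      obtain ⟨n, hn⟩ := ih
      obtain ⟨n', h1, h2⟩ := hreach n
      obtain ⟨-, h3, -⟩ := hstep n' _ h1
      exact ⟨n' + 1, by omega⟩
  obtain ⟨n, hn⟩ := hpos B
  obtain ⟨n', h1, h2⟩ := hreach n
  obtain ⟨hm, -, -⟩ := hstep n' _ h1
  exact ⟨n', by omega, (hg _ hm).2⟩

theorem exists_stackMachine : ∃ (Δ κ Γ : Type) (_ : Finite Δ) (_ : Fintype κ) (_ : Finite Γ)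
    (W : StackMachine Δ κ Γ),
    (∃ (δ : ℕ → Δ) (L : ℕ → κ → List Γ), L 0 = (fun _ => []) ∧
      ∀ n, W.Step (δ n) (L n) (L (n + 1))) ∧
    ¬∃ δ : ℕ → Δ, (∀ n, W.Runs ((List.range n).map δ)) ∧
      ∀ f : Δ → ℕ, Computable fun n => f (δ n) := by
  classical
  let g : ℕ → ℕ := fun n => if DiagApprox n then n else 0
  have hgc : Computable g :=
    (Primrec.ite primrecPred_diagApprox Primrec.id (Primrec.const 0)).to_comp
  obtain ⟨c, hc⟩ := exists_sim_code hgc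
  obtain ⟨F, hF, hact⟩ := exists_sim_states c
  have hfin : Finite F := hF
  let M := (sim (tr (trNormal c .halt))).restrict F
  have hK : Finite K' := Finite.of_surjective (![K'.main, .rev, .aux, .stack]) fun k => by
    cases k
    exacts [⟨0, rfl⟩, ⟨1, rfl⟩, ⟨2, rfl⟩, ⟨3, rfl⟩]
  refine ⟨M.Instr, Option K', Option (F ⊕ Γ'), inferInstance, Fintype.ofFinite _, inferInstance,
    M.toStackMachine, ?_, ?_⟩
  · obtain ⟨b, s, h0, h⟩ := exists_branch (g := g) (fun n hn => if_pos hn.diagApprox) hc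
    have hs : ∀ n, ∃ q : Option F, q.map Subtype.val = (s n).1 := by
      intro n
      induction n with
      | zero => exact ⟨none, by rw [h0]; rfl⟩
      | succ n ih =>
        obtain ⟨q, hq⟩ := ih
        have h1 := h n
        simp only [Automaton.next, Option.map_eq_some_iff] at h1
        obtain ⟨p, hp, h2⟩ := h1
        rw [← hq] at hp
        rw [← h2]
        exact ⟨some ⟨p.1, hact q _ _ _ hp⟩, rfl⟩
    choose q hq using hs
    refine Automaton.exists_steps (b := b) (s := fun n => (q n, (s n).2)) ?_ fun n => ?_
    · have h1 := hq 0
      rw [h0] at h1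
      simp only [Option.map_eq_none_iff] at h1
      simp [h1, h0]
    · rw [Automaton.restrict_next]
      simp only [hq]
      exact h n
  · rintro ⟨δ, hδ, hcomp⟩
    obtain ⟨t, h0, ht⟩ := Automaton.exists_next_of_runs hδ
    let s : ℕ → SimCfg := fun n => ((t n).1.map Subtype.val, (t n).2)
    have hd := diagApprox_digitNum (g := g) (s := s) (b := fun n => (δ n).1.2.2) (fun n hn => by
      by_cases h : DiagApprox n
      · exact ⟨if_pos h, h⟩
      · exact absurd (if_neg h) hn) hc (by simp [s, h0]) fun n => Automaton.restrict_next.1 (ht n).2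
    refine not_computable_of_diagApprox rfl (fun n => ?_) hd ?_
    · change (haltDigit (s n).1 (δ n).1.2.2).elim _ _ = _ ∨ ∃ b < 2,
        (haltDigit (s n).1 (δ n).1.2.2).elim _ _ = _
      cases haltDigit (s n).1 (δ n).1.2.2 with
      | none => exact .inl rfl
      | some b => exact .inr ⟨b.toNat, Bool.toNat_lt b, rfl⟩
    · have h1 := hcomp fun d => (haltDigit (d.1.1.map Subtype.val) d.1.2.2).elim 0 fun b => b.toNat + 1
      have h2 : Primrec₂ fun w u : ℕ => if w = 0 then u else 2 * u + (w - 1) :=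
        Primrec.ite (Primrec.eq.comp Primrec.fst (Primrec.const 0)) Primrec.snd
          (Primrec.nat_add.comp (Primrec.nat_mul.comp (Primrec.const 2) Primrec.snd)
            (Primrec.pred.comp Primrec.fst))
      refine (Computable.nat_rec (f := fun n : ℕ => n) (g := fun _ => 1) Computable.id
        (Computable.const 1) (h2.to_comp.comp (h1.comp (Computable.fst.comp Computable.snd))
          (Computable.snd.comp Computable.snd)).to₂).of_eq fun n => ?_
      unfold digitNum
      induction n with
      | zero => rfl
      | succ n ih =>
        simp only at ih ⊢
        rw [ih]
        have h3 : (δ n).1.1.map Subtype.val = (s n).1 := by rw [(ht n).1]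
        rw [h3]
        cases haltDigit (s n).1 (δ n).1.2.2 <;> simp

end Sim

/-- Every finitely generated group which is quasi-isometric to the hyperbolic plane
(Mathlib's `UpperHalfPlane` with its hyperbolic metric) admits a nonempty SFT with
nonzero Medvedev degree, i.e. a nonempty SFT whose pullback contains no computable
configuration. -/
theorem statement15 {G : Type*} [Group G] {k : ℕ} (σ : Fin k → G) (hσ : IsSymmGen σ)
    (hqi : ∃ f : G → UpperHalfPlane, IsQIToSpace σ f) :
    ∃ (n : ℕ) (X : Set (G → Fin n)), IsSFT X ∧ X.Nonempty ∧
      ∀ y ∈ mSet (pullback (cover σ) X), ¬Computable y := by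
  obtain ⟨f, hf⟩ := hqi
  obtain ⟨Δ, κ, Γ, _, _, _, W, ⟨δ, L, h0, hL⟩, hW⟩ := exists_stackMachine
  have := Lab.finite W
  have : Finite (Sy Δ Γ) := Sy.finite
  obtain ⟨M, ⟨e⟩⟩ := Finite.exists_equiv_fin (Sy Δ Γ)
  obtain ⟨N, ⟨l⟩⟩ := Finite.exists_equiv_fin (Lab W)
  obtain ⟨i, x, hx⟩ := Lab.exists_isOrbit e h0 hL
  obtain ⟨n, X, hX, hne, hc⟩ := LinSys.exists_isSFT hσ hf hx
  refine ⟨n, X, hX, hne, fun y hy hyc => ?_⟩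
  obtain ⟨j, u, hu, hj⟩ := hc y hy hyc
  exact hW (Lab.exists_computable_run_of_isOrbit e hu l (hj l))

end MedvedevFormal
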